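/- Let A be a positive square-free integer with A ≡ 1 or 25 (mod 36). Then limsup_{X→∞} ( Σ_{D ∈ N⁺(X,1,12A)} rank E_D(ℚ) ) / ( #N⁺(X,1,12A) ) ≤ 1. -/

import Mathlib

open Filter

/-- The Mordell curve `y² = x³ + a` as a Weierstrass curve over `ℚ`. -/
noncomputable def MordellCurve (a : ℤ) : WeierstrassCurve ℚ :=
  { a₁ := 0, a₂ := 0, a₃ := 0, a₄ := 0, a₆ := (a : ℚ) }

/-- The Mordell–Weil rank of `y² = x³ + a` over `ℚ`. -/
noncomputable def mordellRank (a : ℤ) : ℕ :=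
  Module.finrank ℤ (MordellCurve a).toAffine.Point

/-- An integer is a fundamental discriminant if it is the discriminant of a quadratic
number field: `Δ ≠ 1` and either `Δ` is square-free with `Δ ≡ 1 (mod 4)`, or `Δ = 4·m'`
with `m'` square-free and `m' ≡ 2` or `3 (mod 4)`. -/
def IsFundamentalDiscriminant (Δ : ℤ) : Prop :=
  Δ ≠ 1 ∧ ((Squarefree Δ ∧ Δ % 4 = 1) ∨
    ∃ m' : ℤ, Δ = 4 * m' ∧ Squarefree m' ∧ (m' % 4 = 2 ∨ m' % 4 = 3))

/-- `Nplus X m N` is the set of fundamental discriminants `Δ` with `0 < Δ < X` and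
`Δ ≡ m (mod N)`. -/
def Nplus (X : ℝ) (m N : ℤ) : Set ℤ :=
  {Δ : ℤ | 0 < Δ ∧ (Δ : ℝ) < X ∧ IsFundamentalDiscriminant Δ ∧ Δ ≡ m [ZMOD N]}

namespace MW

theorem mc_eq (k : ℤ) (x y : ℚ) : (MordellCurve k).toAffine.Equation x y ↔ y ^ 2 = x ^ 3 + k := by
  rw [WeierstrassCurve.Affine.equation_iff]; simp [MordellCurve]

theorem mc_ns (k : ℤ) (hk : k ≠ 0) (x y : ℚ) :
    (MordellCurve k).toAffine.Nonsingular x y ↔ y ^ 2 = x ^ 3 + k := by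
  rw [WeierstrassCurve.Affine.nonsingular_iff, mc_eq]
  simp only [MordellCurve]
  constructor
  · exact fun h => h.1
  · intro h
    refine ⟨h, ?_⟩
    by_contra hc
    push Not at hc
    have hy : y = 0 := by linarith [hc.2]
    have hx : x = 0 := by have := hc.1; simp at this; exact this
    subst hy hx
    apply hk
    have : (k:ℚ) = 0 := by linarith
    exact_mod_cast this

/-- Points of the Mordell curve. -/
abbrev Pt (k : ℤ) := (MordellCurve k).toAffine.Point

/-- constructor -/
noncomputable def pt (k : ℤ) (hk : k ≠ 0) (x y : ℚ) (h : y ^ 2 = x ^ 3 + k) : Pt k :=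
  .some x y ((mc_ns k hk x y).2 h)

theorem pt_cases (k : ℤ) (hk : k ≠ 0) (P : Pt k) : P = 0 ∨ ∃ x y h, P = pt k hk x y h := by
  rcases P with _ | ⟨x, y, h⟩
  · left; rfl
  · right; exact ⟨x, y, (mc_ns k hk x y).1 h, rfl⟩

theorem pt_ne_zero (k : ℤ) (hk : k ≠ 0) (x y h) : pt k hk x y h ≠ 0 := by
  intro h; exact WeierstrassCurve.Affine.Point.some_ne_zero _ h

theorem pt_inj {k : ℤ} {hk : k ≠ 0} {x y h x' y' h'} (e : pt k hk x y h = pt k hk x' y' h') :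
    x = x' ∧ y = y' := by
  simpa [pt] using e

theorem pt_neg (k : ℤ) (hk : k ≠ 0) (x y h) :
    - pt k hk x y h = pt k hk x (-y) (by rw [← h]; ring) := by
  simp only [pt, WeierstrassCurve.Affine.Point.neg_some]
  congr 1
  simp [WeierstrassCurve.Affine.negY, MordellCurve]

theorem pt_add_of_ne (k : ℤ) (hk : k ≠ 0) (x y : ℚ) (h) (x' y' : ℚ) (h') (hx : x ≠ x') (l : ℚ)
    (hl : l * (x - x') = y - y') (h3) :
    pt k hk x y h + pt k hk x' y' h' =
      pt k hk (l ^ 2 - x - x') (-(l * (l ^ 2 - x - x' - x) + y)) h3 := by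
  have hs : (MordellCurve k).toAffine.slope x x' y y' = l := by
    rw [WeierstrassCurve.Affine.slope_of_X_ne hx, ← hl]
    field_simp [sub_ne_zero.2 hx]
  simp only [pt, WeierstrassCurve.Affine.Point.add_of_X_ne hx]
  simp only [hs]
  congr 1 <;> simp only [WeierstrassCurve.Affine.addX, WeierstrassCurve.Affine.addY,
    WeierstrassCurve.Affine.negAddY, WeierstrassCurve.Affine.negY, MordellCurve] <;> ring

theorem pt_dbl (k : ℤ) (hk : k ≠ 0) (x y h) (hy : y ≠ 0) (l : ℚ)
    (hl : l * (2 * y) = 3 * x ^ 2) (h3) :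
    pt k hk x y h + pt k hk x y h =
      pt k hk (l ^ 2 - x - x) (-(l * (l ^ 2 - x - x - x) + y)) h3 := by
  have hyn : y ≠ (MordellCurve k).toAffine.negY x y := by
    simp [WeierstrassCurve.Affine.negY, MordellCurve]
    intro h; apply hy; linarith
  have hs : (MordellCurve k).toAffine.slope x x y y = l := by
    rw [WeierstrassCurve.Affine.slope_of_Y_ne rfl hyn]
    rw [div_eq_iff (sub_ne_zero.2 hyn)]
    simp only [WeierstrassCurve.Affine.negY, MordellCurve]
    linear_combination -hl
  simp only [pt, WeierstrassCurve.Affine.Point.add_self_of_Y_ne hyn]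
  simp only [hs]
  congr 1 <;> simp only [WeierstrassCurve.Affine.addX, WeierstrassCurve.Affine.addY,
    WeierstrassCurve.Affine.negAddY, WeierstrassCurve.Affine.negY, MordellCurve] <;> ring

theorem pt_congr {k : ℤ} {hk : k ≠ 0} {x y h x' y' h'} (e : x = x') (e' : y = y') :
    pt k hk x y h = pt k hk x' y' h' := by subst e e'; rfl

theorem exists_line (k : ℤ) (hk : k ≠ 0) (x y : ℚ) (h) (x' y' : ℚ) (h')
    (hne : pt k hk x y h + pt k hk x' y' h' ≠ 0) :
    ∃ l m x3 y3 h3, pt k hk x y h + pt k hk x' y' h' = pt k hk x3 (-y3) h3 ∧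
      y = l * x + m ∧ y' = l * x' + m ∧ y3 = l * x3 + m ∧
      x + x' + x3 = l ^ 2 ∧ x * x' + x * x3 + x' * x3 = - 2 * l * m ∧
      x * x' * x3 = m ^ 2 - k := by
  by_cases hx : x = x'
  · subst hx
    have hyy : y = y' ∨ y = - y' := by
      have : (y - y') * (y + y') = 0 := by linear_combination h - h'
      rcases mul_eq_zero.1 this with h | h
      · left; linarith
      · right; linarith
    rcases hyy with e | e
    · subst e
      have hy : y ≠ 0 := by
        intro hy
        apply hne
        rw [add_eq_zero_iff_eq_neg, pt_neg]
        apply pt_congr rfl; simp [hy]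
      obtain ⟨l, hl'⟩ : ∃ l : ℚ, l * (2 * y) = 3 * x ^ 2 :=
        ⟨3 * x ^ 2 / (2 * y), by field_simp⟩
      have e2 : x * x + x * (l ^ 2 - x - x) + x * (l ^ 2 - x - x) = -2 * l * (y - l * x) := by
        linear_combination hl'
      have e3 : x * x * (l ^ 2 - x - x) = (y - l * x) ^ 2 - k := by
        linear_combination x * hl' - h
      have h3 : (-(l * (l ^ 2 - x - x - x) + y)) ^ 2 = (l ^ 2 - x - x) ^ 3 + k := by
        linear_combination (l^2 - x - x) * e2 - e3
      refine ⟨l, y - l * x, l ^ 2 - x - x, l * (l ^ 2 - x - x - x) + y, h3,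
        pt_dbl k hk x y h hy l hl' _, ?_, ?_, ?_, ?_, e2, e3⟩ <;> ring
    · exfalso
      apply hne
      rw [add_eq_zero_iff_eq_neg, pt_neg]
      exact pt_congr rfl e
  · have hx' := sub_ne_zero.2 hx
    obtain ⟨l, hl'⟩ : ∃ l : ℚ, l * (x - x') = y - y' :=
      ⟨(y - y') / (x - x'), by field_simp⟩
    have e2 : x * x' + x * (l ^ 2 - x - x') + x' * (l ^ 2 - x - x') = -2 * l * (y - l * x) := by
      apply mul_left_cancel₀ hx'
      linear_combination (y + y' - l * (x - x')) * hl' + h - h'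
    have e3 : x * x' * (l ^ 2 - x - x') = (y - l * x) ^ 2 - k := by
      linear_combination x * e2 - h
    have h3 : (-(l * (l ^ 2 - x - x' - x) + y)) ^ 2 = (l ^ 2 - x - x') ^ 3 + k := by
      linear_combination (l^2 - x - x') * e2 - e3
    refine ⟨l, y - l * x, l ^ 2 - x - x', l * (l ^ 2 - x - x' - x) + y, h3,
        pt_add_of_ne k hk x y h x' y' h' hx l hl' _, ?_, ?_, ?_, ?_, e2, e3⟩
    · ring
    · linear_combination hl'
    · ring
    · ring

/-- L1 -/
theorem add_of_line (k : ℤ) (hk : k ≠ 0) (l m x y : ℚ) (h) (x' y' : ℚ) (h') (x3 y3 : ℚ) (h3)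
    (hy : y = l * x + m) (hy' : y' = l * x' + m) (hy3 : y3 = l * x3 + m)
    (e1 : x + x' + x3 = l ^ 2) (e2 : x * x' + x * x3 + x' * x3 = - 2 * l * m)
    (e3 : x * x' * x3 = m ^ 2 - k) :
    pt k hk x y h + pt k hk x' y' h' = pt k hk x3 (-y3) h3 := by
  have hx3 : x3 = l ^ 2 - x - x' := by linarith
  by_cases hx : x = x'
  · subst hx
    have : y = y' := by linarith
    subst this
    by_cases h0 : y = 0
    · exfalso
      -- x is a double root, so 3x^2 = 2 l y = 0
      have : x ^ 2 = 0 := by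
        rw [hx3] at e2
        have : y - l * x = m := by linarith
        rw [← this] at e2
        rw [h0] at e2
        linear_combination (-1/3 : ℚ) * e2
      have hx0 : x = 0 := by simpa using this
      rw [h0, hx0] at h
      apply hk
      have : (k:ℚ) = 0 := by linarith
      exact_mod_cast this
    · have hl' : l * (2 * y) = 3 * x ^ 2 := by
        rw [hx3] at e2
        have : y - l * x = m := by linarith
        rw [← this] at e2
        linear_combination e2
      have h3' : (-(l * (l ^ 2 - x - x - x) + y)) ^ 2 = (l ^ 2 - x - x) ^ 3 + k := by
        rw [← hx3, ← h3, hy3, hy]; ring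
      rw [pt_dbl k hk x y h h0 l hl' h3']
      apply pt_congr hx3.symm
      rw [hy3, hx3, hy]; ring
  · have h3' : (-(l * (l ^ 2 - x - x' - x) + y)) ^ 2 = (l ^ 2 - x - x') ^ 3 + k := by
        rw [← hx3, ← h3, hy3, hy]; ring
    rw [pt_add_of_ne k hk x y h x' y' h' hx l (by rw [hy, hy']; ring) h3']
    apply pt_congr hx3.symm
    rw [hy3, hx3, hy]; ring

end MW

namespace MW

theorem x_ne (k : ℤ) (hns : ∀ y : ℚ, y ^ 2 ≠ k) (x y : ℚ) (h : y ^ 2 = x ^ 3 + k) : x ≠ 0 := by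
  intro hx; apply hns y; rw [h, hx]; ring

theorem ns_ne (k : ℤ) (hns : ∀ y : ℚ, y ^ 2 ≠ k) : k ≠ 0 := by
  rintro rfl; exact hns 0 (by simp)

theorem phi_eq (k k' : ℤ) (c : ℚ) (hc : c ≠ 0) (hkk : (k' : ℚ) * c ^ 6 = -27 * k) (x y : ℚ)
    (hx : x ≠ 0) (h : y ^ 2 = x ^ 3 + k) :
    (y * (x ^ 3 - 8 * k) / (c ^ 3 * x ^ 3)) ^ 2 = ((x ^ 3 + 4 * k) / (c ^ 2 * x ^ 2)) ^ 3 + k' := by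
  have : (k' : ℚ) = -27 * k / c ^ 6 := by field_simp; linarith
  rw [this]
  field_simp
  linear_combination (x ^ 3 - 8 * k) ^ 2 * h

/-- the 3-isogeny on points -/
noncomputable def phiFun (k k' : ℤ) (c : ℚ) (hc : c ≠ 0) (hkk : (k' : ℚ) * c ^ 6 = -27 * k)
    (hns : ∀ y : ℚ, y ^ 2 ≠ k) (hk' : k' ≠ 0) : Pt k → Pt k'
  | 0 => 0
  | .some x y h => pt k' hk' ((x ^ 3 + 4 * k) / (c ^ 2 * x ^ 2))
      (y * (x ^ 3 - 8 * k) / (c ^ 3 * x ^ 3))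
      (phi_eq k k' c hc hkk x y
        (x_ne k hns x y ((mc_ns k (ns_ne k hns) x y).1 h)) ((mc_ns k (ns_ne k hns) x y).1 h))

theorem phi_line (k l m x1 x2 x3 : ℚ) (h1 : x1 ≠ 0) (h2 : x2 ≠ 0) (h3 : x3 ≠ 0)
    (e1 : x1 + x2 + x3 = l ^ 2) (e2 : x1 * x2 + x1 * x3 + x2 * x3 = - 2 * l * m)
    (e3 : x1 * x2 * x3 = m ^ 2 - k) (L M : ℚ)
    (hL : L * (m ^ 2 - k) = l * (m ^ 2 + 3 * k))
    (hM : M * (m ^ 2 - k) = m * (m ^ 2 - 9 * k) - 4 * k * l ^ 3)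
    (X1 X2 X3 : ℚ) (hX1 : X1 = (x1 ^ 3 + 4 * k) / x1 ^ 2)
    (hX2 : X2 = (x2 ^ 3 + 4 * k) / x2 ^ 2) (hX3 : X3 = (x3 ^ 3 + 4 * k) / x3 ^ 2) :
    X1 + X2 + X3 = L ^ 2 ∧ X1 * X2 + X1 * X3 + X2 * X3 = - 2 * L * M ∧
      X1 * X2 * X3 = M ^ 2 + 27 * k := by
  have hm : m ^ 2 - k ≠ 0 := by rw [← e3]; positivity
  have hL' : L = l * (m ^ 2 + 3 * k) / (m ^ 2 - k) := by rw [eq_div_iff hm, hL]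
  have hM' : M = (m * (m ^ 2 - 9 * k) - 4 * k * l ^ 3) / (m ^ 2 - k) := by rw [eq_div_iff hm, hM]
  have s1 : X1 + X2 + X3 = ((x1 + x2 + x3) * (x1 * x2 * x3) ^ 2 +
      4 * k * ((x1 * x2 + x1 * x3 + x2 * x3) ^ 2 - 2 * (x1 + x2 + x3) * (x1 * x2 * x3)))
      / (x1 * x2 * x3) ^ 2 := by
    rw [hX1, hX2, hX3]; field_simp; ring
  have s2 : X1 * X2 + X1 * X3 + X2 * X3 = ((x1 * x2 * x3) ^ 2 * (x1 * x2 + x1 * x3 + x2 * x3) +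
      4 * k * ((x1 + x2 + x3) * ((x1 * x2 + x1 * x3 + x2 * x3) ^ 2 - 2 * (x1 + x2 + x3) * (x1 * x2 * x3))
        - (x1 * x2 * x3) * (x1 * x2 + x1 * x3 + x2 * x3)) +
      16 * k ^ 2 * ((x1 + x2 + x3) ^ 2 - 2 * (x1 * x2 + x1 * x3 + x2 * x3)))
      / (x1 * x2 * x3) ^ 2 := by
    rw [hX1, hX2, hX3]; field_simp; ring
  have s3 : X1 * X2 * X3 = ((x1 * x2 * x3) ^ 3 +
      4 * k * ((x1 * x2 + x1 * x3 + x2 * x3) ^ 3 - 3 * (x1 + x2 + x3) *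
        (x1 * x2 + x1 * x3 + x2 * x3) * (x1 * x2 * x3) + 3 * (x1 * x2 * x3) ^ 2) +
      16 * k ^ 2 * ((x1 + x2 + x3) ^ 3 - 3 * (x1 + x2 + x3) * (x1 * x2 + x1 * x3 + x2 * x3) +
        3 * (x1 * x2 * x3)) + 64 * k ^ 3)
      / (x1 * x2 * x3) ^ 2 := by
    rw [hX1, hX2, hX3]; field_simp; ring
  rw [s1, s2, s3, hL', hM', e1, e2, e3]
  refine ⟨?_, ?_, ?_⟩ <;> field_simp <;> ring

theorem phi_on_line (k l m x L M : ℚ) (hx : x ≠ 0) (hm : m ^ 2 - k ≠ 0)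
    (h : (l * x + m) ^ 2 = x ^ 3 + k)
    (hL : L * (m ^ 2 - k) = l * (m ^ 2 + 3 * k))
    (hM : M * (m ^ 2 - k) = m * (m ^ 2 - 9 * k) - 4 * k * l ^ 3) :
    (l * x + m) * (x ^ 3 - 8 * k) / x ^ 3 = L * ((x ^ 3 + 4 * k) / x ^ 2) + M := by
  have hL' : L = l * (m ^ 2 + 3 * k) / (m ^ 2 - k) := by rw [eq_div_iff hm, hL]
  have hM' : M = (m * (m ^ 2 - 9 * k) - 4 * k * l ^ 3) / (m ^ 2 - k) := by rw [eq_div_iff hm, hM]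
  rw [hL', hM']
  field_simp
  linear_combination (4 * k * (l * x - 2 * m)) * h

theorem phiFun_zero (k k' c hc hkk hns hk') : phiFun k k' c hc hkk hns hk' 0 = 0 := rfl

theorem phiFun_pt (k k' c hc hkk hns hk' hk x y h) :
    phiFun k k' c hc hkk hns hk' (pt k hk x y h) =
      pt k' hk' ((x ^ 3 + 4 * k) / (c ^ 2 * x ^ 2))
      (y * (x ^ 3 - 8 * k) / (c ^ 3 * x ^ 3)) (phi_eq k k' c hc hkk x y (x_ne k hns x y h) h) := rfl

theorem phiFun_neg (k k' c hc hkk hns hk') (P : Pt k) :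
    phiFun k k' c hc hkk hns hk' (-P) = - phiFun k k' c hc hkk hns hk' P := by
  have hk := ns_ne k hns
  rcases pt_cases k hk P with rfl | ⟨x, y, h, rfl⟩
  · rw [neg_zero, phiFun_zero, neg_zero]
  · rw [pt_neg, phiFun_pt, phiFun_pt, pt_neg]
    apply pt_congr rfl; ring

theorem phiFun_add (k k' c hc hkk hns hk') (P Q : Pt k) :
    phiFun k k' c hc hkk hns hk' (P + Q) =
      phiFun k k' c hc hkk hns hk' P + phiFun k k' c hc hkk hns hk' Q := by
  have hk := ns_ne k hns
  by_cases hPQ : P + Q = 0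
  · have : Q = -P := by rw [eq_neg_iff_add_eq_zero, add_comm]; exact hPQ
    rw [hPQ, this, phiFun_neg, phiFun_zero, add_neg_cancel]
  rcases pt_cases k hk P with rfl | ⟨x1, y1, h1, rfl⟩
  · rw [phiFun_zero, zero_add, zero_add]
  rcases pt_cases k hk Q with rfl | ⟨x2, y2, h2, rfl⟩
  · rw [phiFun_zero, add_zero, add_zero]
  obtain ⟨l, m, x3, y3, h3, hs, ey1, ey2, ey3, e1, e2, e3⟩ := exists_line k hk x1 y1 h1 x2 y2 h2 hPQ
  rw [hs, phiFun_pt, phiFun_pt, phiFun_pt]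
  have n1 := x_ne k hns _ _ h1
  have n2 := x_ne k hns _ _ h2
  have n3 := x_ne k hns _ _ h3
  have hm : m ^ 2 - (k : ℚ) ≠ 0 := by rw [← e3]; positivity
  obtain ⟨L, hL⟩ : ∃ L : ℚ, L * (m ^ 2 - k) = l * (m ^ 2 + 3 * k) :=
    ⟨l * (m ^ 2 + 3 * k) / (m ^ 2 - k), by field_simp⟩
  obtain ⟨M, hM⟩ : ∃ M : ℚ, M * (m ^ 2 - k) = m * (m ^ 2 - 9 * k) - 4 * k * l ^ 3 :=
    ⟨(m * (m ^ 2 - 9 * k) - 4 * k * l ^ 3) / (m ^ 2 - k), by field_simp⟩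
  obtain ⟨f1, f2, f3⟩ := phi_line k l m x1 x2 x3 n1 n2 n3 e1 e2 e3 L M hL hM _ _ _ rfl rfl rfl
  have hk'' : (k' : ℚ) = -27 * k / c ^ 6 := by field_simp; linarith
  have key : ∀ x y : ℚ, y ^ 2 = x ^ 3 + k → y = l * x + m →
      y * (x ^ 3 - 8 * k) / (c ^ 3 * x ^ 3) =
        (L / c) * ((x ^ 3 + 4 * k) / (c ^ 2 * x ^ 2)) + M / c ^ 3 := by
    intro x y h hy
    have nx := x_ne k hns _ _ h
    rw [hy] at h
    have := phi_on_line k l m x L M nx hm h hL hM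
    rw [hy]
    have e : (l * x + m) * (x ^ 3 - 8 * k) / (c ^ 3 * x ^ 3) =
      ((l * x + m) * (x ^ 3 - 8 * k) / x ^ 3) / c ^ 3 := by field_simp
    rw [e, this]
    field_simp
  have hX : ∀ x : ℚ, (x ^ 3 + 4 * k) / (c ^ 2 * x ^ 2) = ((x ^ 3 + 4 * k) / x ^ 2) / c ^ 2 := by
    intro x; rw [div_div, mul_comm (c ^ 2)]
  have h3' : y3 ^ 2 = x3 ^ 3 + k := by rw [← h3]; ring
  symm
  have hneg : pt k' hk' ((x3 ^ 3 + 4 * k) / (c ^ 2 * x3 ^ 2))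
      (-y3 * (x3 ^ 3 - 8 * k) / (c ^ 3 * x3 ^ 3)) (phi_eq k k' c hc hkk x3 (-y3) n3 h3) =
      pt k' hk' ((x3 ^ 3 + 4 * k) / (c ^ 2 * x3 ^ 2))
      (-(y3 * (x3 ^ 3 - 8 * k) / (c ^ 3 * x3 ^ 3)))
      (by rw [← phi_eq k k' c hc hkk x3 (-y3) n3 h3]; ring) := by
    apply pt_congr rfl; ring
  rw [hneg]
  apply add_of_line k' hk' (L / c) (M / c ^ 3)
  · exact key _ _ h1 ey1
  · exact key _ _ h2 ey2
  · exact key _ _ h3' ey3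
  · rw [hX, hX, hX, ← add_div, ← add_div, f1]; field_simp
  · rw [hX, hX, hX]
    have : ∀ a b d : ℚ, a / c ^ 2 * (b / c ^ 2) + a / c ^ 2 * (d / c ^ 2) + b / c ^ 2 * (d / c ^ 2) =
      (a * b + a * d + b * d) / c ^ 4 := by intros; field_simp
    rw [this, f2]; field_simp
  · rw [hX, hX, hX]
    have : ∀ a b d : ℚ, a / c ^ 2 * (b / c ^ 2) * (d / c ^ 2) =
      (a * b * d) / c ^ 6 := by intros; field_simp
    rw [this, f3, hk'']; field_simp; ring

/-- the isogeny as a homomorphism -/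
noncomputable def phi (k k' : ℤ) (c : ℚ) (hc : c ≠ 0) (hkk : (k' : ℚ) * c ^ 6 = -27 * k)
    (hns : ∀ y : ℚ, y ^ 2 ≠ k) (hk' : k' ≠ 0) : Pt k →+ Pt k' :=
  AddMonoidHom.mk' (phiFun k k' c hc hkk hns hk') (phiFun_add k k' c hc hkk hns hk')

theorem phi_pt (k k' c hc hkk hns hk' hk x y h) :
    phi k k' c hc hkk hns hk' (pt k hk x y h) =
      pt k' hk' ((x ^ 3 + 4 * k) / (c ^ 2 * x ^ 2))
      (y * (x ^ 3 - 8 * k) / (c ^ 3 * x ^ 3)) (phi_eq k k' c hc hkk x y (x_ne k hns x y h) h) := rfl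

/-- multiplication by three is the composite -/
theorem phi_comp (k k' : ℤ) (c c' : ℚ) (hc hkk hns hk' hc' hkk' hns' hk) (hcc : c * c' = 3)
    (P : Pt k) :
    phi k' k c' hc' hkk' hns' hk (phi k k' c hc hkk hns hk' P) = 3 • P := by
  rcases pt_cases k hk P with rfl | ⟨x, y, h, rfl⟩
  · simp
  have nx := x_ne k hns _ _ h
  rw [phi_pt, phi_pt]
  have nX := x_ne k' hns' _ _ (phi_eq k k' c hc hkk x y nx h)
  have nX' : x ^ 3 + 4 * (k : ℚ) ≠ 0 := by
    intro h; apply nX; rw [h]; simp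
  have hk'' : (k' : ℚ) = -27 * k / c ^ 6 := by field_simp; linarith
  have hc'' : c' = 3 / c := by field_simp; linarith
  have hkq : (k : ℚ) = y ^ 2 - x ^ 3 := by rw [h]; ring
  have h3 : (3 : ℕ) • pt k hk x y h = pt k hk x y h + pt k hk x y h + pt k hk x y h := by
    rw [show (3 : ℕ) = 2 + 1 from rfl, add_nsmul, two_nsmul, one_nsmul]
  rw [h3]
  by_cases hy : y = 0
  · have : pt k hk x y h + pt k hk x y h = 0 := by
      rw [add_eq_zero_iff_eq_neg, pt_neg]; apply pt_congr rfl; simp [hy]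
    rw [this, zero_add]
    subst hy
    have hkq : (k : ℚ) = - x ^ 3 := by rw [hkq]; ring
    apply pt_congr
    · rw [hk'', hc'', hkq]; field_simp; ring
    · simp
  · obtain ⟨l, hl⟩ : ∃ l : ℚ, l * (2 * y) = 3 * x ^ 2 :=
      ⟨3 * x ^ 2 / (2 * y), by field_simp⟩
    have hl' : l = 3 * x ^ 2 / (2 * y) := by field_simp; linarith
    have hX2 : l ^ 2 - x - x - x ≠ 0 := by
      intro h0; apply nX'
      rw [hl'] at h0
      field_simp at h0
      rw [hkq]
      have : 3 * x * (3 * x ^ 3 - 4 * y ^ 2) = 0 := by linear_combination h0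
      rcases mul_eq_zero.1 this with h | h
      · exfalso; apply nx; linarith
      · linear_combination -h
    have e3 : x * x * (l ^ 2 - x - x) = (y - l * x) ^ 2 - k := by
      linear_combination x * hl - h
    have h2 : (-(l * (l ^ 2 - x - x - x) + y)) ^ 2 = (l ^ 2 - x - x) ^ 3 + k := by
      have e2 : x * x + x * (l ^ 2 - x - x) + x * (l ^ 2 - x - x) = -2 * l * (y - l * x) := by
        linear_combination hl
      linear_combination (l^2 - x - x) * e2 - e3
    rw [pt_dbl k hk x y h hy l hl h2]
    obtain ⟨l2, hl2⟩ : ∃ l2 : ℚ, l2 * ((l ^ 2 - x - x) - x) = -(l * (l ^ 2 - x - x - x) + y) - y :=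
      ⟨(-(l * (l ^ 2 - x - x - x) + y) - y) / (l ^ 2 - x - x - x), by field_simp⟩
    have hl2' : l2 = - l - 2 * y / (l ^ 2 - x - x - x) := by field_simp; linarith
    have hD : 9 * x ^ 4 - 12 * x * y ^ 2 ≠ 0 := by
      intro h0; apply hX2; rw [hl']; field_simp; linear_combination h0
    have hD' : 3 * x ^ 3 - 4 * y ^ 2 ≠ 0 := by
      intro h0; apply hD; linear_combination 3 * x * h0
    have hl2'' : l2 = - 3 * x ^ 2 / (2 * y) - 8 * y ^ 3 / (3 * x * (3 * x ^ 3 - 4 * y ^ 2)) := by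
      rw [hl2', hl']
      have : (3 * x ^ 2 / (2 * y)) ^ 2 - x - x - x = 3 * x * (3 * x ^ 3 - 4 * y ^ 2) / (4 * y ^ 2) := by
        field_simp; ring
      rw [this]; field_simp; ring
    have hX3 : ((((x ^ 3 + 4 * k) / (c ^ 2 * x ^ 2)) ^ 3 + 4 * k') /
        (c' ^ 2 * ((x ^ 3 + 4 * k) / (c ^ 2 * x ^ 2)) ^ 2)) = l2 ^ 2 - (l ^ 2 - x - x) - x := by
      obtain ⟨w, hw⟩ : ∃ w : ℚ, w = 3 * x ^ 3 - 4 * y ^ 2 := ⟨_, rfl⟩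
      have hxk : x ^ 3 + 4 * (k : ℚ) = - w := by rw [hkq, hw]; ring
      have hw0 : w ≠ 0 := by rw [hw]; exact hD'
      rw [hk'', hc'', hl2'', hl', hxk, hkq, ← hw]
      field_simp
      rw [hw]
      ring
    have hY3 : (y * (x ^ 3 - 8 * k) / (c ^ 3 * x ^ 3)) *
        (((x ^ 3 + 4 * k) / (c ^ 2 * x ^ 2)) ^ 3 - 8 * k') /
        (c' ^ 3 * ((x ^ 3 + 4 * k) / (c ^ 2 * x ^ 2)) ^ 3) =
        -(l2 * (l2 ^ 2 - (l ^ 2 - x - x) - x - (l ^ 2 - x - x)) +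
          -(l * (l ^ 2 - x - x - x) + y)) := by
      obtain ⟨w, hw⟩ : ∃ w : ℚ, w = 3 * x ^ 3 - 4 * y ^ 2 := ⟨_, rfl⟩
      have hxk : x ^ 3 + 4 * (k : ℚ) = - w := by rw [hkq, hw]; ring
      have hw0 : w ≠ 0 := by rw [hw]; exact hD'
      rw [hk'', hc'', hl2'', hl', hxk, hkq, ← hw]
      field_simp
      rw [hw]
      ring
    have h3' := phi_eq k' k c' hc' hkk' _ _ nX (phi_eq k k' c hc hkk x y nx h)
    rw [hX3, hY3] at h3'
    rw [pt_add_of_ne k hk _ _ h2 x y h (fun h => hX2 (by rw [h]; ring)) l2 hl2 h3']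
    exact pt_congr hX3 hY3

end MW

namespace MW

variable {K : Type*} [Field K] [CharZero K]

theorem ind_of_ns (k : ℤ) (hns : ∀ y : ℚ, y ^ 2 ≠ k) (δ : K) (hδ : δ ^ 2 = k) (a b : ℚ)
    (h : (a : K) + b * δ = 0) : a = 0 ∧ b = 0 := by
  have hb : b = 0 := by
    by_contra hb
    have hb' : (b : K) ≠ 0 := by exact_mod_cast hb
    apply hns (a / b)
    have : δ = -((a / b : ℚ) : K) := by
      push_cast
      field_simp
      linear_combination h
    rw [this] at hδ
    have h2 : (((a / b : ℚ) ^ 2 : ℚ) : K) = ((k : ℚ) : K) := by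
      push_cast; push_cast at hδ; rw [← hδ]; ring
    exact_mod_cast h2
  subst hb
  simpa using h

theorem ind_eq (k : ℤ) (hns : ∀ y : ℚ, y ^ 2 ≠ k) (δ : K) (hδ : δ ^ 2 = k) (a b a' b' : ℚ)
    (h : (a : K) + b * δ = a' + b' * δ) : a = a' ∧ b = b' := by
  have := ind_of_ns k hns δ hδ (a - a') (b - b') (by push_cast; linear_combination h)
  constructor <;> linarith [this.1, this.2]

theorem kernel_aux (k k' : ℤ) (c : ℚ) (hc : c ≠ 0) (hkk : (k : ℚ) * c ^ 6 = -27 * k')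
    (hns' : ∀ y : ℚ, y ^ 2 ≠ k') (hk : k ≠ 0) (x y : ℚ) (h : y ^ 2 = x ^ 3 + k) (p q : ℚ)
    (hy : y = p ^ 3 + 3 * p * q ^ 2 * k) (h1 : 1 = 3 * p ^ 2 * q + q ^ 3 * k) :
    pt k hk x y h ∈ (phi k' k c hc hkk hns' hk).range := by
  have hq : q ≠ 0 := by rintro rfl; norm_num at h1
  have hx : x = p ^ 2 - k * q ^ 2 := by
    have : x ^ 3 = (p ^ 2 - k * q ^ 2) ^ 3 := by
      have e : x ^ 3 = y ^ 2 - k * 1 ^ 2 := by rw [h]; ring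
      rw [e, hy, h1]; ring
    exact (Odd.strictMono_pow (by decide : Odd 3)).injective this
  have hk' : (k' : ℚ) = - k * c ^ 6 / 27 := by linarith
  have hp : p ^ 2 = (1 - q ^ 3 * k) / (3 * q) := by field_simp; linarith
  have hE : (c ^ 3 * p / (3 * q)) ^ 2 = (c ^ 2 / (3 * q)) ^ 3 + k' := by
    rw [hk']; field_simp; linear_combination -27 * h1
  refine ⟨pt k' (ns_ne k' hns') (c ^ 2 / (3 * q)) (c ^ 3 * p / (3 * q)) hE, ?_⟩
  rw [phi_pt]
  apply pt_congr
  · rw [hx, hk']; field_simp; linear_combination 27 * h1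
  · rw [hy, hk']; field_simp; linear_combination 27 * p * h1

/-- if `y + δ` is a cube then the point is in the image of the isogeny. -/
theorem kernel_psi (k k' : ℤ) (c : ℚ) (hc : c ≠ 0) (hkk : (k : ℚ) * c ^ 6 = -27 * k')
    (hns' : ∀ y : ℚ, y ^ 2 ≠ k') (hns : ∀ y : ℚ, y ^ 2 ≠ k) (hk : k ≠ 0)
    (δ : K) (hδ : δ ^ 2 = k) (hsp : ∀ z : K, ∃ p q : ℚ, z = p + q * δ)
    (x y : ℚ) (h : y ^ 2 = x ^ 3 + k) (z : K) (hz : (y : K) + δ = z ^ 3) :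
    pt k hk x y h ∈ (phi k' k c hc hkk hns' hk).range := by
  obtain ⟨p, q, rfl⟩ := hsp z
  have := ind_eq k hns δ hδ y 1 (p ^ 3 + 3 * p * q ^ 2 * k) (3 * p ^ 2 * q + q ^ 3 * k) (by
    push_cast
    rw [one_mul, hz]
    linear_combination (3 * p * q ^ 2 + q ^ 3 * δ : K) * hδ)
  exact kernel_aux k k' c hc hkk hns' hk x y h p q this.1 this.2

theorem coset_psi (k k' : ℤ) (c : ℚ) (hc : c ≠ 0) (hkk : (k : ℚ) * c ^ 6 = -27 * k')
    (hns' : ∀ y : ℚ, y ^ 2 ≠ k') (hns : ∀ y : ℚ, y ^ 2 ≠ k) (hk : k ≠ 0)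
    (δ : K) (hδ : δ ^ 2 = k) (hsp : ∀ z : K, ∃ p q : ℚ, z = p + q * δ)
    (x y : ℚ) (h : y ^ 2 = x ^ 3 + k) (x' y' : ℚ) (h' : y' ^ 2 = x' ^ 3 + k)
    (z : K) (hz : (y : K) + δ = (y' + δ) * z ^ 3) :
    pt k hk x y h - pt k hk x' y' h' ∈ (phi k' k c hc hkk hns' hk).range := by
  rw [sub_eq_add_neg, pt_neg]
  by_cases h0 : pt k hk x y h + pt k hk x' (-y') (by rw [← h']; ring) = 0
  · rw [h0]; exact zero_mem _
  obtain ⟨l, m, x3, y3, h3, hs, ey1, ey2, ey3, e1, e2, e3⟩ := exists_line k hk _ _ _ _ _ _ h0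
  rw [hs]
  have hm : (m : K) + δ ≠ 0 := by
    intro h
    have := ind_of_ns k hns δ hδ m 1 (by push_cast; linear_combination h)
    exact one_ne_zero this.2
  have f1 : (x : K) + x' + x3 = l ^ 2 := by exact_mod_cast e1
  have f2 : (x : K) * x' + x * x3 + x' * x3 = -2 * l * m := by exact_mod_cast e2
  have f3 : (x : K) * x' * x3 = m ^ 2 - k := by exact_mod_cast e3
  have g1 : (y : K) = l * x + m := by exact_mod_cast ey1
  have g2 : -(y' : K) = l * x' + m := by exact_mod_cast ey2
  have g3 : (y3 : K) = l * x3 + m := by exact_mod_cast ey3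
  have hp : ((y : K) + δ) * (-y' + δ) * (y3 + δ) = (m + δ) ^ 3 := by
    rw [g1, g2, g3]
    linear_combination l ^ 3 * f3 + l ^ 2 * (m + δ) * f2 + l * (m + δ) ^ 2 * f1 + l ^ 3 * hδ
  have hn' : (-(y' : K) + δ) * (y' + δ) = - x' ^ 3 := by
    have : (y' : K) ^ 2 = x' ^ 3 + k := by exact_mod_cast h'
    linear_combination hδ - this
  have hn3 : (-(y3 : K) + δ) * (y3 + δ) = - x3 ^ 3 := by
    have : (-(y3 : K)) ^ 2 = x3 ^ 3 + k := by exact_mod_cast h3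
    linear_combination hδ - this
  apply kernel_psi k k' c hc hkk hns' hns hk δ hδ hsp _ _ h3 (x3 * x' * z / (m + δ))
  rw [div_pow, eq_div_iff (pow_ne_zero 3 hm), ← hp, hz]
  push_cast
  linear_combination (-z ^ 3 * x3 ^ 3) * hn' + ((-(y':K) + δ) * (y' + δ) * z ^ 3) * hn3

/-- The concrete quadratic field. -/
abbrev QF (k : ℤ) := QuadraticAlgebra ℚ (k : ℚ) 0

theorem exists_K (k : ℤ) (hns : ∀ y : ℚ, y ^ 2 ≠ k) :
    ∃ (K : Type) (_ : Field K) (_ : CharZero K) (δ : K),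
      δ ^ 2 = k ∧ ∀ z : K, ∃ p q : ℚ, z = p + q * δ := by
  haveI : Fact (∀ r : ℚ, r ^ 2 ≠ (k : ℚ) + 0 * r) := ⟨fun r => by simpa using hns r⟩
  haveI : CharZero (QF k) := by
    apply charZero_of_injective_algebraMap (R := ℚ) (A := QF k)
    exact (algebraMap ℚ (QF k)).injective
  have hq : ∀ p : ℚ, (p : QF k) = ⟨p, 0⟩ := by
    intro p
    have : (p : QF k) = algebraMap ℚ (QF k) p := by simp
    rw [this]; rfl
  refine ⟨QF k, inferInstance, inferInstance, ⟨0, 1⟩, ?_, ?_⟩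
  · have : ((k : ℤ) : QF k) = ((k : ℚ) : QF k) := by simp
    rw [this, hq, pow_two]
    ext <;> simp
  · rintro ⟨p, q⟩
    refine ⟨p, q, ?_⟩
    rw [hq, hq]
    ext <;> simp

end MW

namespace MW

/-- naive height -/
noncomputable def Hq (x : ℚ) : ℝ := max |(x.num : ℝ)| (x.den : ℝ)

theorem Hq_ge_one (x : ℚ) : 1 ≤ Hq x :=
  le_max_of_le_right (by exact_mod_cast x.pos)

theorem Hq_le (N D : ℤ) (hD : D ≠ 0) : Hq ((N : ℚ) / D) ≤ max |(N : ℝ)| |(D : ℝ)| := by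
  obtain ⟨c, h1, h2⟩ := Rat.num_den_mk hD (Rat.divInt_eq_div N D).symm
  have hc : c ≠ 0 := by rintro rfl; apply hD; rw [h2]; simp
  have hc1 : (1 : ℝ) ≤ |(c : ℝ)| := by exact_mod_cast Int.one_le_abs hc
  unfold Hq
  apply max_le_max
  · have : |(N : ℝ)| = |(c : ℝ)| * |(((N : ℚ) / D).num : ℝ)| := by
      rw [← abs_mul]; exact_mod_cast congrArg (fun z : ℤ => |(z : ℝ)|) h1
    rw [this]; exact le_mul_of_one_le_left (abs_nonneg _) hc1
  · have : |(D : ℝ)| = |(c : ℝ)| * (((N : ℚ) / D).den : ℝ) := by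
      have h3 : (((N : ℚ) / D).den : ℝ) = |(((N : ℚ) / D).den : ℝ)| := by simp
      rw [h3, ← abs_mul]; exact_mod_cast congrArg (fun z : ℤ => |(z : ℝ)|) h2
    rw [this]; exact le_mul_of_one_le_left (by positivity) hc1

theorem Hq_ge (N D e : ℤ) (hD : D ≠ 0) (he : e ≠ 0) (h : ∀ d, d ∣ N → d ∣ D → d ∣ e) :
    max |(N : ℝ)| |(D : ℝ)| ≤ |(e : ℝ)| * Hq ((N : ℚ) / D) := by
  obtain ⟨c, h1, h2⟩ := Rat.num_den_mk hD (Rat.divInt_eq_div N D).symm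
  have hce : c ∣ e := h c (Dvd.intro _ h1.symm) (Dvd.intro _ h2.symm)
  have hce' : |(c : ℝ)| ≤ |(e : ℝ)| := by
    exact_mod_cast Int.le_of_dvd (abs_pos.2 he) ((abs_dvd_abs _ _).2 hce)
  unfold Hq
  rw [mul_max_of_nonneg _ _ (abs_nonneg _)]
  apply max_le_max
  · have : |(N : ℝ)| = |(c : ℝ)| * |(((N : ℚ) / D).num : ℝ)| := by
      rw [← abs_mul]; exact_mod_cast congrArg (fun z : ℤ => |(z : ℝ)|) h1
    rw [this]; exact mul_le_mul_of_nonneg_right hce' (abs_nonneg _)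
  · have : |(D : ℝ)| = |(c : ℝ)| * (((N : ℚ) / D).den : ℝ) := by
      have h3 : (((N : ℚ) / D).den : ℝ) = |(((N : ℚ) / D).den : ℝ)| := by simp
      rw [h3, ← abs_mul]; exact_mod_cast congrArg (fun z : ℤ => |(z : ℝ)|) h2
    rw [this]; exact mul_le_mul_of_nonneg_right hce' (by positivity)

/-- log height on points -/
noncomputable def ht (k : ℤ) : Pt k → ℝ
  | 0 => 0
  | .some x _ _ => Real.log (Hq x)

theorem ht_zero (k : ℤ) : ht k 0 = 0 := rfl
theorem ht_pt (k hk x y h) : ht k (pt k hk x y h) = Real.log (Hq x) := rfl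

theorem ht_nonneg (k : ℤ) (P : Pt k) : 0 ≤ ht k P := by
  rcases P with _ | ⟨x, y, h⟩
  · exact le_refl _
  · exact Real.log_nonneg (Hq_ge_one x)

theorem dvd_aux (k u w d : ℤ) (huw : IsCoprime u w) (h1 : d ∣ u ^ 3 + 4 * k * w ^ 3)
    (h2 : d ∣ u ^ 2 * w) : d ∣ 4 * k := by
  have hNw : IsCoprime (u ^ 3 + 4 * k * w ^ 3) w := by
    have : IsCoprime (u ^ 3) w := huw.pow_left
    have := this.add_mul_right_left (4 * k * w ^ 2)
    rwa [show u ^ 3 + 4 * k * w ^ 2 * w = u ^ 3 + 4 * k * w ^ 3 by ring] at this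
  have hdw : IsCoprime d w := hNw.of_isCoprime_of_dvd_left h1
  have h3 : d ∣ u ^ 2 := hdw.dvd_of_dvd_mul_right h2
  have h4 : d ∣ 4 * k * w ^ 3 := by
    have : d ∣ u ^ 3 := h3.trans (Dvd.intro u (by ring))
    exact (dvd_add_right this).1 h1
  exact (hdw.pow_right (n := 3)).dvd_of_dvd_mul_right h4

theorem ineq_aux (k u w : ℝ) (hk : 1 ≤ |k|) (hw : 0 < w) :
    (max |u| w) ^ 3 ≤ 4 * |k| * max |u ^ 3 + 4 * k * w ^ 3| (u ^ 2 * w) := by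
  set U := |u| with hU
  have hU0 : 0 ≤ U := abs_nonneg _
  have hu2 : u ^ 2 = U ^ 2 := by rw [hU, sq_abs]
  set κ := |k|
  have a1 : |u ^ 3| = U ^ 3 := abs_pow _ _
  have a2 : |4 * k * w ^ 3| = 4 * κ * w ^ 3 := by
    rw [abs_mul, abs_mul, abs_of_pos (by positivity : 0 < w ^ 3)]; simp [κ]
  have t1 : U ^ 3 - 4 * κ * w ^ 3 ≤ |u ^ 3 + 4 * k * w ^ 3| := by
    have := abs_sub_abs_le_abs_sub (u ^ 3) (-(4 * k * w ^ 3)); rw [abs_neg, a1, a2, sub_neg_eq_add] at this; exact this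
  have t2 : 4 * κ * w ^ 3 - U ^ 3 ≤ |u ^ 3 + 4 * k * w ^ 3| := by
    have := abs_sub_abs_le_abs_sub (4 * k * w ^ 3) (-(u ^ 3)); rw [abs_neg, a1, a2, sub_neg_eq_add, add_comm] at this; exact this
  have m1 := le_max_left |u ^ 3 + 4 * k * w ^ 3| (u ^ 2 * w)
  have m2 := le_max_right |u ^ 3 + 4 * k * w ^ 3| (u ^ 2 * w)
  set M := max |u ^ 3 + 4 * k * w ^ 3| (u ^ 2 * w)
  have hM : 0 ≤ M := (abs_nonneg _).trans m1
  rw [hu2] at m2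
  have hMκ : M ≤ κ * M := le_mul_of_one_le_left hM hk
  rcases le_or_gt (2 * κ * w) U with c1 | c1
  · have : w ≤ U := by nlinarith
    rw [max_eq_left this]
    have e1 : 2 * κ * w ^ 3 * 4 ≤ U ^ 3 := by
      have s1 : 2 * κ * w * w ^ 2 ≤ U * w ^ 2 := mul_le_mul_of_nonneg_right c1 (by positivity)
      have s2 : 2 * w ≤ U := by nlinarith
      have s3 : (2 * w) ^ 2 ≤ U ^ 2 := by gcongr
      have s4 : U * (2 * w) ^ 2 ≤ U * U ^ 2 := by gcongr
      nlinarith [pow_nonneg hU0 3]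
    nlinarith
  · rcases le_or_gt w (2 * U) with c2 | c2
    · rcases le_total w U with c3 | c3
      · rw [max_eq_left c3]
        have : U ^ 2 * U ≤ U ^ 2 * (2 * κ * w) := by gcongr
        nlinarith [mul_le_mul_of_nonneg_left m2 (by positivity : 0 ≤ κ)]
      · rw [max_eq_right c3]
        have : w ^ 2 ≤ (2 * U) ^ 2 := by gcongr
        have : w ^ 2 * w ≤ (2 * U) ^ 2 * w := by gcongr
        nlinarith
    · rw [max_eq_right (by linarith)]
      have : (2 * U) ^ 3 ≤ w ^ 3 := by gcongr
      have : w ^ 3 ≤ κ * w ^ 3 := le_mul_of_one_le_left (by positivity) hk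
      nlinarith

theorem phi_ht (k k' : ℤ) (c : ℤ) (hc : (c : ℚ) ≠ 0) (hkk hns hk') :
    ∃ C : ℝ, ∀ P : Pt k, 3 * ht k P - C ≤ ht k' (phi k k' c hc hkk hns hk' P) := by
  have hk := ns_ne k hns
  have hcz : c ≠ 0 := by exact_mod_cast hc
  have hkR : (1 : ℝ) ≤ |(k : ℝ)| := by exact_mod_cast Int.one_le_abs hk
  have hcR : (1 : ℝ) ≤ |(c : ℝ)| := by exact_mod_cast Int.one_le_abs hcz
  set B : ℝ := 4 * |(k : ℝ)| * (|((4 * k * c ^ 2 : ℤ) : ℝ)|) with hB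
  have hB1 : 1 ≤ B := by
    rw [hB]; push_cast; rw [abs_mul, abs_mul, abs_pow]
    have h1 : (1:ℝ) ≤ |(c : ℝ)| ^ 2 := one_le_pow₀ hcR
    have h2 : (1:ℝ) ≤ |(4:ℝ)| * |(k : ℝ)| := by rw [abs_of_pos (by norm_num)]; linarith
    have h3 : (1:ℝ) ≤ 4 * |(k : ℝ)| := by linarith
    exact one_le_mul_of_one_le_of_one_le h3 (one_le_mul_of_one_le_of_one_le h2 h1)
  refine ⟨Real.log B, fun P => ?_⟩
  rcases pt_cases k hk P with rfl | ⟨x, y, h, rfl⟩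
  · simp [ht_zero, Real.log_nonneg hB1]
  rw [phi_pt, ht_pt, ht_pt]
  have nx := x_ne k hns _ _ h
  have hu : x.num ≠ 0 := Rat.num_ne_zero.2 nx
  have hw : (x.den : ℤ) ≠ 0 := by exact_mod_cast x.den_ne_zero
  have e : (x ^ 3 + 4 * k) / ((c : ℚ) ^ 2 * x ^ 2) =
      ((x.num ^ 3 + 4 * k * (x.den : ℤ) ^ 3 : ℤ) : ℚ) / ((c ^ 2 * (x.num ^ 2 * (x.den : ℤ)) : ℤ) : ℚ) := by
    have hwq : (x.den : ℚ) ≠ 0 := by exact_mod_cast x.den_ne_zero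
    have huq : (x.num : ℚ) ≠ 0 := by exact_mod_cast hu
    have hx : x = (x.num : ℚ) / x.den := (Rat.num_div_den x).symm
    push_cast
    generalize (x.num : ℚ) = u at *
    generalize (x.den : ℚ) = w at *
    subst hx
    field_simp
  rw [e]
  have key := Hq_ge (x.num ^ 3 + 4 * k * (x.den : ℤ) ^ 3) (c ^ 2 * (x.num ^ 2 * (x.den : ℤ)))
    (4 * k * c ^ 2) (mul_ne_zero (pow_ne_zero _ hcz) (mul_ne_zero (pow_ne_zero _ hu) hw))
    (mul_ne_zero (mul_ne_zero (by norm_num) hk) (pow_ne_zero _ hcz)) (by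
      intro d h1 h2
      have hcop : IsCoprime x.num (x.den : ℤ) := by
        rw [Int.isCoprime_iff_gcd_eq_one]; exact x.reduced
      have hg := dvd_aux k x.num x.den (gcd (x.num ^ 3 + 4 * k * (x.den : ℤ) ^ 3) (x.num ^ 2 * (x.den : ℤ)))
        hcop (gcd_dvd_left _ _) (gcd_dvd_right _ _)
      have : d ∣ c ^ 2 * gcd (x.num ^ 3 + 4 * k * (x.den : ℤ) ^ 3) (x.num ^ 2 * (x.den : ℤ)) := by
        refine (dvd_gcd (h1.mul_left (c ^ 2)) h2).trans ?_
        rw [gcd_mul_left]; exact mul_dvd_mul_right (normalize_associated _).dvd _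
      refine this.trans ?_
      rw [mul_comm]
      exact mul_dvd_mul_right hg _)
  set H' := Hq (((x.num ^ 3 + 4 * k * (x.den : ℤ) ^ 3 : ℤ) : ℚ) /
    ((c ^ 2 * (x.num ^ 2 * (x.den : ℤ)) : ℤ) : ℚ))
  have h0 := ineq_aux (k : ℝ) (x.num : ℝ) (x.den : ℝ) hkR (by exact_mod_cast x.pos)
  have h1 : (Hq x) ^ 3 ≤ B * H' := by
    refine h0.trans ?_
    rw [hB, mul_assoc (4 * |(k : ℝ)|)]
    apply mul_le_mul_of_nonneg_left _ (by positivity)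
    refine le_trans ?_ key
    apply max_le_max
    · push_cast; exact le_refl _
    · push_cast
      rw [abs_mul, abs_of_nonneg (by positivity : (0:ℝ) ≤ (x.num : ℝ) ^ 2 * (x.den : ℝ)), abs_pow]
      exact le_mul_of_one_le_left (by positivity) (one_le_pow₀ hcR)
  have hH := Hq_ge_one x
  have hH' : 1 ≤ H' := Hq_ge_one _
  have := Real.log_le_log (by positivity) h1
  rw [Real.log_pow, Real.log_mul (by positivity) (by positivity)] at this
  push_cast at this
  linarith

end MW

namespace MW

theorem add_ht (k : ℤ) (hk : k ≠ 0) (Q : Pt k) :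
    ∃ C : ℝ, ∀ P : Pt k, ht k (P + Q) ≤ 2 * ht k P + C := by
  rcases pt_cases k hk Q with rfl | ⟨x0, y0, h0, rfl⟩
  · refine ⟨0, fun P => ?_⟩
    rw [add_zero]; linarith [ht_nonneg k P]
  obtain ⟨u0, hu0⟩ : ∃ u : ℤ, u = x0.num := ⟨_, rfl⟩
  obtain ⟨w0, hw0⟩ : ∃ w : ℤ, w = (x0.den : ℤ) := ⟨_, rfl⟩
  have integ : ∀ x y : ℚ, y ^ 2 = x ^ 3 + k → ∃ s : ℤ, (s : ℚ) = y * x.den ^ 2 ∧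
      |(s : ℝ)| ≤ (1 + |(k : ℝ)|) * Hq x ^ 2 := by
    intro x y h
    have hwq : (x.den : ℚ) ≠ 0 := by exact_mod_cast x.den_ne_zero
    have hx : x = (x.num : ℚ) / x.den := (Rat.num_div_den x).symm
    have hsq : (y * x.den ^ 2) ^ 2 = ((x.den * (x.num ^ 3 + k * x.den ^ 3) : ℤ) : ℚ) := by
      have : (y * x.den ^ 2) ^ 2 = (x ^ 3 + k) * x.den ^ 4 := by rw [← h]; ring
      rw [this]
      push_cast
      generalize (x.num : ℚ) = u at *
      generalize (x.den : ℚ) = w at *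
      subst hx
      field_simp
    have hIn1 : ∃ s : ℤ, (s : ℚ) = y * x.den ^ 2 := by
      have hi : IsIntegral ℤ (y * (x.den : ℚ) ^ 2) := by
        apply IsIntegral.of_pow (n := 2) (by norm_num)
        rw [hsq]; exact isIntegral_algebraMap
      obtain ⟨s, hs⟩ := IsIntegrallyClosed.isIntegral_iff.1 hi
      exact ⟨s, hs⟩
    obtain ⟨s, hs⟩ := hIn1
    refine ⟨s, hs, ?_⟩
    rw [← hs] at hsq
    have hsq' : s ^ 2 = x.den * (x.num ^ 3 + k * x.den ^ 3) := by exact_mod_cast hsq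
    have hsR : (s : ℝ) ^ 2 = x.den * (x.num ^ 3 + k * x.den ^ 3) := by exact_mod_cast hsq'
    have hu : |(x.num : ℝ)| ≤ Hq x := le_max_left _ _
    have hw : (x.den : ℝ) ≤ Hq x := le_max_right _ _
    have hw' : (0 : ℝ) ≤ x.den := by positivity
    have hH := Hq_ge_one x
    apply abs_le_of_sq_le_sq _ (by positivity)
    rw [hsR]
    calc (x.den : ℝ) * (x.num ^ 3 + k * x.den ^ 3)
        ≤ x.den * (|(x.num : ℝ)| ^ 3 + |(k : ℝ)| * x.den ^ 3) := by
          apply mul_le_mul_of_nonneg_left _ hw'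
          apply add_le_add
          · rw [← abs_pow]; exact le_abs_self _
          · exact mul_le_mul_of_nonneg_right (le_abs_self _) (by positivity)
      _ ≤ Hq x * (Hq x ^ 3 + |(k : ℝ)| * Hq x ^ 3) := by gcongr
      _ = (1 + |(k : ℝ)|) * Hq x ^ 4 := by ring
      _ ≤ (1 + |(k : ℝ)|) ^ 2 * Hq x ^ 4 := by
          apply mul_le_mul_of_nonneg_right _ (by positivity)
          nlinarith [abs_nonneg (k : ℝ)]
      _ = ((1 + |(k : ℝ)|) * Hq x ^ 2) ^ 2 := by ring
  obtain ⟨s0, hs0, -⟩ := integ x0 y0 h0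
  set C1 : ℝ := |(u0 : ℝ)| * (|(w0 : ℝ)| + |(u0 : ℝ)|) + 2 * |(k : ℝ)| * |(w0 : ℝ)| ^ 2
    + 2 * ((1 + |(k : ℝ)|) * |(s0 : ℝ)|) with hC1
  set C2 : ℝ := (|(w0 : ℝ)| + |(u0 : ℝ)|) ^ 2 with hC2
  have hC1' : 0 ≤ C1 := by positivity
  have hC2' : 0 ≤ C2 := by positivity
  refine ⟨Real.log (1 + C1 + C2) + ht k (pt k hk x0 y0 h0 + pt k hk x0 y0 h0) +
    ht k (pt k hk x0 y0 h0), fun P => ?_⟩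
  have n1 := ht_nonneg k (pt k hk x0 y0 h0 + pt k hk x0 y0 h0)
  have n2 := ht_nonneg k (pt k hk x0 y0 h0)
  have n3 : 0 ≤ Real.log (1 + C1 + C2) := Real.log_nonneg (by linarith)
  have n4 := ht_nonneg k P
  by_cases hPQ : P + pt k hk x0 y0 h0 = 0
  · rw [hPQ, ht_zero]; positivity
  rcases pt_cases k hk P with rfl | ⟨x, y, h, rfl⟩
  · rw [zero_add, ht_zero]; linarith
  by_cases hx : x = x0
  · have : pt k hk x y h = pt k hk x0 y0 h0 := by
      have hyy : (y - y0) * (y + y0) = 0 := by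
        have h' := h; rw [hx] at h'; linear_combination h' - h0
      rcases mul_eq_zero.1 hyy with e | e
      · exact pt_congr hx (by linarith)
      · exfalso; apply hPQ
        rw [add_eq_zero_iff_eq_neg, pt_neg]
        exact pt_congr hx (by linarith)
    rw [this]; linarith
  obtain ⟨s, hs, hsb⟩ := integ x y h
  obtain ⟨l, m, x3, y3, h3, hsum, ey1, ey2, ey3, e1, e2, e3⟩ := exists_line k hk _ _ _ _ _ _ hPQ
  rw [hsum, ht_pt, ht_pt]
  have hxx := sub_ne_zero.2 hx
  have hwq : (x.den : ℚ) ≠ 0 := by exact_mod_cast x.den_ne_zero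
  have hw0q : (x0.den : ℚ) ≠ 0 := by exact_mod_cast x0.den_ne_zero
  have hxe : x = (x.num : ℚ) / x.den := (Rat.num_div_den x).symm
  have hx0e : x0 = (x0.num : ℚ) / x0.den := (Rat.num_div_den x0).symm
  have hDq : (x.num : ℚ) * x0.den - x0.num * x.den ≠ 0 := by
    intro h; apply hxx
    rw [hxe, hx0e]
    field_simp; linear_combination h
  have hD : x.num * w0 - u0 * x.den ≠ 0 := by
    rw [hu0, hw0]; exact_mod_cast hDq
  have hx3 : x3 = ((x.num * u0 * (x.num * w0 + u0 * x.den) + 2 * k * (x.den : ℤ) ^ 2 * w0 ^ 2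
      - 2 * s * s0 : ℤ) : ℚ) / (((x.num * w0 - u0 * x.den) ^ 2 : ℤ) : ℚ) := by
    have a1 : x3 * (x - x0) ^ 2 = x * x0 * (x + x0) + 2 * k - 2 * y * y0 := by
      have hl : l * (x - x0) = y - y0 := by rw [ey1, ey2]; ring
      have : x3 = l ^ 2 - x - x0 := by linarith
      rw [this]
      linear_combination (l * (x - x0) + (y - y0)) * hl + h + h0
    rw [eq_div_iff (by exact_mod_cast pow_ne_zero 2 hD)]
    have b1 : (((x.num * w0 - u0 * x.den) ^ 2 : ℤ) : ℚ) =
        (x - x0) ^ 2 * (x.den : ℚ) ^ 2 * (x0.den : ℚ) ^ 2 := by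
      rw [hu0, hw0]; push_cast
      nth_rewrite 3 [hxe]; nth_rewrite 3 [hx0e]
      field_simp
    have b2 : ((x.num * u0 * (x.num * w0 + u0 * x.den) + 2 * k * (x.den : ℤ) ^ 2 * w0 ^ 2
      - 2 * s * s0 : ℤ) : ℚ) = (x * x0 * (x + x0) + 2 * k - 2 * y * y0) *
        (x.den : ℚ) ^ 2 * (x0.den : ℚ) ^ 2 := by
      rw [hu0, hw0]; push_cast
      rw [hs, hs0]
      have c1 : (x.num : ℚ) = x * x.den := (Rat.mul_den_eq_num _).symm
      have c2 : (x0.num : ℚ) = x0 * x0.den := (Rat.mul_den_eq_num _).symm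
      rw [c1, c2]; ring
    rw [b1, b2, ← a1]; ring
  have hb := Hq_le (x.num * u0 * (x.num * w0 + u0 * x.den) + 2 * k * (x.den : ℤ) ^ 2 * w0 ^ 2
      - 2 * s * s0) ((x.num * w0 - u0 * x.den) ^ 2) (pow_ne_zero 2 hD)
  rw [← hx3] at hb
  have hH := Hq_ge_one x
  have hH3 := Hq_ge_one x3
  have hu : |(x.num : ℝ)| ≤ Hq x := le_max_left _ _
  have hw : |(x.den : ℝ)| ≤ Hq x := by
    rw [abs_of_nonneg (by positivity)]; exact le_max_right _ _
  have hb2 : Hq x3 ≤ (1 + C1 + C2) * Hq x ^ 2 := by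
    refine hb.trans (max_le ?_ ?_)
    · have : |((x.num * u0 * (x.num * w0 + u0 * x.den) + 2 * k * (x.den : ℤ) ^ 2 * w0 ^ 2
        - 2 * s * s0 : ℤ) : ℝ)| ≤ C1 * Hq x ^ 2 := by
        push_cast
        calc _ ≤ |(x.num : ℝ)| * |(u0 : ℝ)| * (|(x.num : ℝ)| * |(w0 : ℝ)| + |(u0 : ℝ)| * |(x.den : ℝ)|)
              + 2 * |(k : ℝ)| * |(x.den : ℝ)| ^ 2 * |(w0 : ℝ)| ^ 2 + 2 * |(s : ℝ)| * |(s0 : ℝ)| := by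
              refine (abs_sub _ _).trans (add_le_add ((abs_add_le _ _).trans (add_le_add ?_ ?_)) ?_)
              · rw [abs_mul, abs_mul]
                refine mul_le_mul_of_nonneg_left ((abs_add_le _ _).trans ?_) (by positivity)
                rw [abs_mul, abs_mul]
              · rw [abs_mul, abs_mul, abs_mul, abs_pow, abs_pow]; simp
              · rw [abs_mul, abs_mul]; simp
          _ ≤ Hq x * |(u0 : ℝ)| * (Hq x * |(w0 : ℝ)| + |(u0 : ℝ)| * Hq x)
              + 2 * |(k : ℝ)| * Hq x ^ 2 * |(w0 : ℝ)| ^ 2 +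
                2 * ((1 + |(k : ℝ)|) * Hq x ^ 2) * |(s0 : ℝ)| := by
              gcongr
          _ = C1 * Hq x ^ 2 := by rw [hC1]; ring
      nlinarith [sq_nonneg (Hq x)]
    · have : |(((x.num * w0 - u0 * x.den) ^ 2 : ℤ) : ℝ)| ≤ C2 * Hq x ^ 2 := by
        push_cast
        rw [abs_pow]
        calc _ ≤ (|(x.num : ℝ)| * |(w0 : ℝ)| + |(u0 : ℝ)| * |(x.den : ℝ)|) ^ 2 := by
              gcongr
              refine (abs_sub _ _).trans ?_
              rw [abs_mul, abs_mul]
          _ ≤ (Hq x * |(w0 : ℝ)| + |(u0 : ℝ)| * Hq x) ^ 2 := by gcongr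
          _ = C2 * Hq x ^ 2 := by rw [hC2]; ring
      nlinarith [sq_nonneg (Hq x)]
  have := Real.log_le_log (by positivity) hb2
  rw [Real.log_mul (by positivity) (by positivity), Real.log_pow] at this
  push_cast at this
  linarith

end MW

namespace MW

theorem northcott_ht (k : ℤ) (hk : k ≠ 0) : Northcott (ht k) := by
  constructor
  intro B
  have hS : {x : ℚ | Hq x ≤ Real.exp B}.Finite := by
    obtain ⟨n, hn⟩ := exists_nat_ge (Real.exp B)
    have : {x : ℚ | Hq x ≤ Real.exp B} ⊆
        (fun p : ℤ × ℤ => (p.1 : ℚ) / p.2) '' (Set.Icc (-(n : ℤ)) n ×ˢ Set.Icc (-(n : ℤ)) n) := by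
      intro x hx
      have h1 : |(x.num : ℝ)| ≤ n := (le_max_left _ _).trans (le_trans hx hn)
      have h2 : (x.den : ℝ) ≤ n := (le_max_right _ _).trans (le_trans hx hn)
      have h1' : |x.num| ≤ (n : ℤ) := by exact_mod_cast h1
      have h2' : (x.den : ℤ) ≤ n := by exact_mod_cast h2
      refine ⟨(x.num, (x.den : ℤ)), ⟨?_, ?_⟩, ?_⟩
      · exact abs_le.1 h1'
      · exact ⟨by simp only; omega, h2'⟩
      · simp [Rat.num_div_den]
    exact (((Set.finite_Icc _ _).prod (Set.finite_Icc _ _)).image _).subset this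
  have hT : (⋃ x ∈ {x : ℚ | Hq x ≤ Real.exp B}, {p : ℚ × ℚ | p.1 = x ∧ p.2 ^ 2 = x ^ 3 + k}).Finite := by
    apply hS.biUnion
    intro x _
    have : {p : ℚ × ℚ | p.1 = x ∧ p.2 ^ 2 = x ^ 3 + k} ⊆ {x} ×ˢ {y : ℚ | y ^ 2 = x ^ 3 + k} := by
      rintro ⟨a, b⟩ ⟨h1, h2⟩; exact ⟨h1, h2⟩
    refine Set.Finite.subset ((Set.finite_singleton x).prod ?_) this
    by_cases hy : ∃ y : ℚ, y ^ 2 = x ^ 3 + k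
    · obtain ⟨y, hy⟩ := hy
      apply Set.Finite.subset (Set.toFinite {y, -y})
      intro z hz
      have : z ^ 2 = y ^ 2 := by rw [hy]; exact hz
      rcases sq_eq_sq_iff_eq_or_eq_neg.1 this with h | h <;> simp [h]
    · convert Set.finite_empty
      ext y; simp; intro h; exact hy ⟨y, h⟩
  classical
  have hU := hT.preimage (f := fun P : Pt k => (match P with
    | 0 => ((0 : ℚ), (0 : ℚ)) | .some x y _ => (x, y))) (s :=
      (⋃ x ∈ {x : ℚ | Hq x ≤ Real.exp B}, {p : ℚ × ℚ | p.1 = x ∧ p.2 ^ 2 = x ^ 3 + k})) (by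
    intro P hP Q hQ e
    have h0 : ¬ (0 : ℚ) ^ 2 = 0 ^ 3 + k := by
      intro h; apply hk
      have : (k : ℚ) = 0 := by linarith
      exact_mod_cast this
    rcases P with _ | ⟨x, y, h⟩
    · exfalso
      simp only [Set.mem_preimage, Set.mem_iUnion] at hP
      obtain ⟨x, _, hP⟩ := hP
      have h1 := hP.1
      have h2 := hP.2
      simp only at h1 h2
      rw [← h1] at h2
      exact h0 h2
    · rcases Q with _ | ⟨x', y', h'⟩
      · exfalso
        simp only [Set.mem_preimage, Set.mem_iUnion] at hQ
        obtain ⟨x, _, hP⟩ := hQ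
        have h1 := hP.1
        have h2 := hP.2
        simp only at h1 h2
        rw [← h1] at h2
        exact h0 h2
      · simp only [Prod.mk.injEq] at e
        obtain ⟨rfl, rfl⟩ := e
        rfl)
  refine (hU.union (Set.finite_singleton (0 : Pt k))).subset ?_
  intro P hP
  rcases pt_cases k hk P with rfl | ⟨x, y, h, rfl⟩
  · right; rfl
  · left
    simp only [Set.mem_preimage, Set.mem_iUnion]
    refine ⟨x, ?_, rfl, h⟩
    have hP' : Real.log (Hq x) ≤ B := hP
    have := Real.exp_le_exp.2 hP'
    rwa [Real.exp_log (by linarith [Hq_ge_one x])] at this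

theorem pow_finrank_le {G : Type*} [AddCommGroup G] [AddGroup.FG G]
    (h : (nsmulAddMonoidHom (α := G) 3).range.index ≠ 0) :
    3 ^ Module.finrank ℤ G ≤ (nsmulAddMonoidHom (α := G) 3).range.index := by
  haveI : Module.Finite ℤ G := Module.Finite.iff_addGroup_fg.2 inferInstance
  have hfr : Module.finrank ℤ (G ⧸ Submodule.torsion ℤ G) = Module.finrank ℤ G := by
    apply finrank_quotient_eq_of_le_torsion; exact le_refl _
  set r := Module.finrank ℤ G with hr
  haveI : Module.Free ℤ (G ⧸ Submodule.torsion ℤ G) := inferInstance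
  let b := Module.finBasisOfFinrankEq ℤ (G ⧸ Submodule.torsion ℤ G) hfr
  let e : (G ⧸ Submodule.torsion ℤ G) ≃ₗ[ℤ] (Fin r → ℤ) := b.equivFun
  let π : G →+ (Fin r → ZMod 3) :=
    ((Int.castAddHom (ZMod 3)).compLeft (Fin r)).comp
      ((e.toLinearMap.comp (Submodule.mkQ _)).toAddMonoidHom)
  have hπ : Function.Surjective π := by
    intro v
    have h1 : Function.Surjective ((Int.castAddHom (ZMod 3)).compLeft (Fin r)) := by
      intro v
      refine ⟨fun i => (v i).val, ?_⟩
      ext i; simp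
    obtain ⟨w, hw⟩ := h1 v
    obtain ⟨g, hg⟩ := Submodule.mkQ_surjective (Submodule.torsion ℤ G) (e.symm w)
    refine ⟨g, ?_⟩
    simp only [π, AddMonoidHom.comp_apply, LinearMap.toAddMonoidHom_coe, LinearMap.comp_apply, hg]
    simp [hw]
  have hle : (nsmulAddMonoidHom (α := G) 3).range ≤ π.ker := by
    rintro _ ⟨g, rfl⟩
    rw [AddMonoidHom.mem_ker]
    simp only [nsmulAddMonoidHom_apply, map_nsmul]
    ext i
    have : (3 : ZMod 3) = 0 := rfl
    simp [this]
  have hidx : π.ker.index = 3 ^ r := by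
    rw [AddSubgroup.index_ker, AddMonoidHom.range_eq_top.2 hπ]
    simp [Nat.card_eq_fintype_card]
  rw [← hidx]
  exact Nat.le_of_dvd (Nat.pos_of_ne_zero h) (AddSubgroup.index_dvd_of_le hle)

theorem index_pow3 {G : Type*} [AddCommGroup G] (H : AddSubgroup G) (hf : H.index ≠ 0)
    (h3 : ∀ g : G, 3 • g ∈ H) : ∃ s, H.index = 3 ^ s := by
  haveI : H.FiniteIndex := ⟨hf⟩
  haveI : Finite (G ⧸ H) := H.finite_quotient_of_finiteIndex
  letI : Module (ZMod 3) (G ⧸ H) := AddCommGroup.zmodModule (by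
    intro x
    obtain ⟨g, rfl⟩ := QuotientAddGroup.mk_surjective x
    rw [← QuotientAddGroup.mk_nsmul, QuotientAddGroup.eq_zero_iff]
    exact h3 g)
  haveI : Fact (Nat.Prime 3) := ⟨by norm_num⟩
  refine ⟨Module.finrank (ZMod 3) (G ⧸ H), ?_⟩
  haveI := Fintype.ofFinite (G ⧸ H)
  rw [AddSubgroup.index, Nat.card_eq_fintype_card, Module.card_eq_pow_finrank (K := ZMod 3)]
  simp

theorem two_mul_le_pow3 (s : ℕ) : 2 * s + 1 ≤ 3 ^ s := by
  induction s with
  | zero => simp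
  | succ n ih => rw [pow_succ]; omega

/-- abstract rank bound via a pair of dual isogenies -/
theorem rank_bound (k k' : ℤ) (c c' : ℤ) (hc : (c : ℚ) ≠ 0) (hkk hns) (hk' : k' ≠ 0)
    (hc' : (c' : ℚ) ≠ 0) (hkk' hns') (hk : k ≠ 0) (hcc : (c : ℚ) * c' = 3)
    (ha : (phi k' k c' hc' hkk' hns' hk).range.index ≠ 0)
    (hb : (phi k k' c hc hkk hns hk').range.index ≠ 0) :
    2 * mordellRank k + 2 ≤ (phi k' k c' hc' hkk' hns' hk).range.index +
      (phi k k' c hc hkk hns hk').range.index := by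
  set g := phi k' k c' hc' hkk' hns' hk with hg
  set f := phi k k' c hc hkk hns hk' with hf
  have hgf : ∀ P, g (f P) = 3 • P := fun P => phi_comp k k' c c' _ _ _ _ _ _ _ _ hcc P
  have hfg : ∀ P, f (g P) = 3 • P := fun P => phi_comp k' k c' c _ _ _ _ _ _ _ _ (by rw [mul_comm]; exact hcc) P
  have hr : (nsmulAddMonoidHom (α := Pt k) 3).range = f.range.map g := by
    ext P; constructor
    · rintro ⟨Q, rfl⟩; exact ⟨f Q, ⟨Q, rfl⟩, hgf Q⟩
    · rintro ⟨_, ⟨Q, rfl⟩, rfl⟩; exact ⟨Q, (hgf Q).symm⟩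
  have hi : (nsmulAddMonoidHom (α := Pt k) 3).range.index = (f.range ⊔ g.ker).index * g.range.index := by
    rw [hr, AddSubgroup.index_map]
  have hd : (f.range ⊔ g.ker).index ∣ f.range.index := AddSubgroup.index_dvd_of_le le_sup_left
  have hd0 : (f.range ⊔ g.ker).index ≠ 0 := fun h => hb (by rw [h] at hd; simpa using hd)
  have hne : (nsmulAddMonoidHom (α := Pt k) 3).range.index ≠ 0 := by
    rw [hi]; exact mul_ne_zero hd0 ha
  haveI : AddGroup.FG (Pt k) := by
    haveI := northcott_ht k hk
    obtain ⟨C1, h1⟩ := phi_ht k k' c hc hkk hns hk'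
    obtain ⟨C2, h2⟩ := phi_ht k' k c' hc' hkk' hns' hk
    choose C h3 using add_ht k hk
    refine AddCommGroup.fg_of_descent (n := 3) (h := ht k) (a := 2) (b := 9) (c₀ := 3 * C1 + C2)
      (c := fun Q => C (-Q)) (by norm_num) (by norm_num) ⟨hne⟩ ?_ ?_
    · intro Q P
      have := h3 (-Q) (Q + P)
      simpa using this
    · intro P
      have e1 := h1 P
      have e2 := h2 (f P)
      rw [← hg, hgf P] at e2
      rw [← hf] at e1
      linarith
  have h0 := pow_finrank_le hne
  obtain ⟨s, hs⟩ := index_pow3 g.range ha (fun P => ⟨f P, hgf P⟩)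
  obtain ⟨t, ht⟩ := index_pow3 f.range hb (fun P => ⟨g P, hfg P⟩)
  have h4 : 3 ^ Module.finrank ℤ (Pt k) ≤ 3 ^ (s + t) := by
    refine h0.trans ?_
    rw [hi, hs, pow_add, mul_comm]
    rw [ht] at hd
    exact Nat.mul_le_mul_left _ (Nat.le_of_dvd (by positivity) hd)
  have h5 : Module.finrank ℤ (Pt k) ≤ s + t := (Nat.pow_le_pow_iff_right (by norm_num)).1 h4
  rw [hs, ht]
  have := two_mul_le_pow3 s
  have := two_mul_le_pow3 t
  unfold mordellRank
  have h6 : Module.finrank ℤ (MordellCurve k).toAffine.Point ≤ s + t := h5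
  omega

end MW

namespace MW

/-- invariant `E` of a cubic form -/
def EE {R : Type*} [CommRing R] (σ a b c d : R) : R :=
  σ ^ 6 * a ^ 2 * d ^ 2 - 6 * σ ^ 4 * (a * b * c * d) - 3 * σ ^ 2 * (b ^ 2 * c ^ 2)
    + 4 * σ ^ 3 * (b ^ 3 * d) + 4 * σ ^ 3 * (a * c ^ 3)

theorem rat_int_of_sq (y : ℚ) (n : ℤ) (h : y ^ 2 = n) : ∃ m : ℤ, y = m := by
  have : IsIntegral ℤ y := by
    refine ⟨Polynomial.X ^ 2 - Polynomial.C n, Polynomial.monic_X_pow_sub_C n (by norm_num), ?_⟩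
    have e : (Polynomial.C n : Polynomial ℤ) = (n : Polynomial ℤ) := by simp
    rw [Polynomial.eval₂_sub, Polynomial.eval₂_C]; simp [h]
  obtain ⟨m, hm⟩ := IsIntegrallyClosed.isIntegral_iff.1 this
  exact ⟨m, by rw [← hm]; simp⟩

theorem point_int (k : ℤ) (x y : ℚ) (h : y ^ 2 = x ^ 3 + k) :
    ∃ u v t : ℤ, t ≠ 0 ∧ IsCoprime u t ∧ x = u / t ^ 2 ∧ y = v / t ^ 3 ∧
      v ^ 2 = u ^ 3 + k * t ^ 6 := by
  have hw0 : (x.den : ℚ) ≠ 0 := by exact_mod_cast x.den_nz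
  have hx : x = x.num / x.den := (Rat.num_div_den x).symm
  have hco : IsCoprime (x.num) (x.den : ℤ) := by
    rw [Int.isCoprime_iff_gcd_eq_one]; exact x.reduced
  obtain ⟨u, hu⟩ : ∃ u, u = x.num := ⟨_, rfl⟩
  obtain ⟨w, hw⟩ : ∃ w : ℤ, w = x.den := ⟨_, rfl⟩
  have hwp : 0 < w := by rw [hw]; exact_mod_cast x.den_pos
  rw [← hu, ← hw] at hco
  have hx' : x = u / w := by rw [hx, hu, hw]; push_cast; rfl
  have hwq : (w : ℚ) ≠ 0 := by exact_mod_cast hwp.ne'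
  have e1 : (y * w ^ 2) ^ 2 = ((w * (u ^ 3 + k * w ^ 3) : ℤ) : ℚ) := by
    rw [mul_pow, h, hx']; push_cast; field_simp
  obtain ⟨Y, hY⟩ := rat_int_of_sq _ _ e1
  have e2 : w * (u ^ 3 + k * w ^ 3) = Y ^ 2 := by
    rw [hY] at e1; exact_mod_cast e1.symm
  have hco2 : IsCoprime w (u ^ 3 + k * w ^ 3) := by
    have h1 : IsCoprime w (u ^ 3) := (hco.symm).pow_right
    have := h1.add_mul_left_right (k * w ^ 2)
    rwa [show w * (k * w ^ 2) = k * w ^ 3 by ring] at this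
  obtain ⟨t, ht⟩ := Int.sq_of_isCoprime hco2 e2
  have ht2 : w = t ^ 2 := by
    rcases ht with ht | ht
    · exact ht
    · nlinarith [sq_nonneg t]
  have ht0 : t ≠ 0 := by rintro rfl; simp at ht2; omega
  have htq : (t : ℚ) ≠ 0 := by exact_mod_cast ht0
  have e3 : (y * t ^ 3) ^ 2 = ((u ^ 3 + k * t ^ 6 : ℤ) : ℚ) := by
    rw [mul_pow, h, hx', ht2]; push_cast; field_simp
  obtain ⟨v, hv⟩ := rat_int_of_sq _ _ e3
  refine ⟨u, v, t, ht0, ?_, ?_, ?_, ?_⟩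
  · rw [ht2] at hco; exact (IsCoprime.pow_right_iff (by norm_num)).1 hco
  · rw [hx', ht2]; push_cast; rfl
  · rw [← hv]; field_simp
  · rw [hv] at e3; exact_mod_cast e3

theorem exists_r (N h u v : ℤ) (h1 : IsCoprime N h) (h2 : IsCoprime N u) :
    ∃ r, N ∣ r * u + v ∧ h ∣ r := by
  obtain ⟨α, β, hab⟩ := h1.mul_right h2
  refine ⟨h * (-(β * v)), ⟨α * v, ?_⟩, ⟨_, rfl⟩⟩
  linear_combination (-v) * hab

theorem r_dvd (N u v r K : ℤ) (h2 : IsCoprime N u) (hr : N ∣ r * u + v) (hK : N ∣ K)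
    (hv : v ^ 2 = u ^ 3 + K) : N ∣ r ^ 2 - u ∧ N ∣ r ^ 3 - 3 * u * r - 2 * v := by
  obtain ⟨l, hl⟩ := hr
  obtain ⟨K', rfl⟩ := hK
  constructor
  · have : N ∣ u ^ 2 * (r ^ 2 - u) := by
      refine ⟨l * (r * u - v) + K', ?_⟩
      linear_combination (r * u - v) * hl + hv
    exact (h2.pow_right).dvd_of_dvd_mul_left this
  · have : N ∣ u ^ 3 * (r ^ 3 - 3 * u * r - 2 * v) := by
      refine ⟨l * (r ^ 2 * u ^ 2 - r * u * v + v ^ 2 - 3 * u ^ 3) - v * K', ?_⟩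
      linear_combination (r ^ 2 * u ^ 2 - r * u * v + v ^ 2 - 3 * u ^ 3) * hl - v * hv
    exact (h2.pow_right).dvd_of_dvd_mul_left this

theorem g_sq_dvd (g v : ℤ) (hg : Squarefree g) (h : g ^ 3 ∣ v ^ 2) : g ^ 2 ∣ v := by
  have h1 : g ∣ v := by
    have : g ∣ v ^ 2 := (dvd_pow_self g (by norm_num)).trans h
    exact (hg.dvd_pow_iff_dvd (by norm_num)).1 this
  obtain ⟨w, rfl⟩ := h1
  have hg0 : g ≠ 0 := hg.ne_zero
  have h2 : g ∣ w ^ 2 := by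
    have : g ^ 2 * g ∣ g ^ 2 * w ^ 2 := by convert h using 1 <;> ring
    exact (mul_dvd_mul_iff_left (pow_ne_zero 2 hg0)).1 this
  have h3 : g ∣ w := (hg.dvd_pow_iff_dvd (by norm_num)).1 h2
  rw [sq]; exact mul_dvd_mul_left g h3

/-- common construction : `N1` carries the part away from `g` -/
theorem exists_split (D u v t K : ℤ) (hD : Squarefree D) (hut : IsCoprime u t)
    (hv : v ^ 2 = u ^ 3 + K * D ^ 3 * t ^ 6) :
    ∃ g D', D = g * D' ∧ IsCoprime g D' ∧ IsCoprime D' u ∧ g ∣ u ∧ g ^ 2 ∣ v := by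
  obtain ⟨D', hD'⟩ := Int.gcd_dvd_right (a := u) (b := D)
  obtain ⟨u', hu'⟩ := Int.gcd_dvd_left (a := u) (b := D)
  obtain ⟨g, hg⟩ : ∃ g : ℤ, g = (Int.gcd u D : ℤ) := ⟨_, rfl⟩
  rw [← hg] at hD' hu'
  have hsf : Squarefree (g * D') := hD' ▸ hD
  have hgD : IsCoprime g D' := (squarefree_mul_iff.1 hsf).1.isCoprime
  have hgs : Squarefree g := (squarefree_mul_iff.1 hsf).2.1
  have hg0 : g ≠ 0 := hgs.ne_zero
  refine ⟨g, D', hD', hgD, ?_, ⟨u', hu'⟩, ?_⟩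
  · have h1 : IsCoprime u' D' := by
      have hpos : 0 < Int.gcd u D := by
        rcases Nat.eq_zero_or_pos (Int.gcd u D) with h | h
        · rw [h] at hg; exact absurd hg hg0
        · exact h
      rw [Int.isCoprime_iff_gcd_eq_one]
      have : Int.gcd (g * u') (g * D') = g.natAbs * Int.gcd u' D' := Int.gcd_mul_left _ _ _
      rw [← hD', ← hu'] at this
      have e : g.natAbs = Int.gcd u D := by rw [hg]; rfl
      rw [e] at this
      exact (Nat.mul_left_cancel hpos (by rw [mul_one]; exact this)).symm
    rw [hu']
    exact (hgD.symm).mul_right h1.symm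
  · apply g_sq_dvd g v hgs
    rw [hv, hu', hD']
    exact ⟨u' ^ 3 + K * D' ^ 3 * t ^ 6, by ring⟩

/-- the integral form attached to a point, `σ = 1` -/
theorem form1 (A D u v t : ℤ) (hA : A ≠ 0) (hD : Squarefree D) (ht : t ≠ 0) (hut : IsCoprime u t)
    (hv : v ^ 2 = u ^ 3 + (-A) * D ^ 3 * t ^ 6) :
    ∃ b c d : ℤ, (t ^ 3 * D) ^ 2 * d - 3 * (t ^ 3 * D) * b * c + 2 * b ^ 3 = -2 * v ∧
      EE 1 (t ^ 3 * D) b c d = -4 * (A * D) := by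
  obtain ⟨g, D', hDD, hgD, hDu, hgu, hgv⟩ := exists_split D u v t (-A) hD hut hv
  have hD0 : D ≠ 0 := hD.ne_zero
  have hgt : IsCoprime g t := hut.of_isCoprime_of_dvd_left hgu
  have hN : IsCoprime (t ^ 6 * D' ^ 2) (g ^ 2) :=
    ((hgt.symm).pow).mul_left ((hgD.symm).pow)
  have hNu : IsCoprime (t ^ 6 * D' ^ 2) u :=
    (hut.symm.pow_left).mul_left hDu.pow_left
  obtain ⟨r, hr1, hr2⟩ := exists_r _ _ u v hN hNu
  obtain ⟨e1, e2⟩ := r_dvd _ u v r ((-A) * D ^ 3 * t ^ 6) hNu hr1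
    ⟨-A * D' * g ^ 3, by rw [hDD]; ring⟩ hv
  have f1 : t ^ 3 * D ∣ r ^ 2 - u := by
    have h1 : t ^ 3 * D' ∣ r ^ 2 - u := dvd_trans ⟨t ^ 3 * D', by ring⟩ e1
    have h2 : g ∣ r ^ 2 - u := dvd_sub ((dvd_pow_self g (by norm_num)).trans (hr2.trans (dvd_pow_self r (by norm_num)))) hgu
    have h3 : IsCoprime (t ^ 3 * D') g := (hgt.symm.pow_left).mul_left hgD.symm
    have := h3.mul_dvd h1 h2
    rw [hDD]; exact (dvd_of_eq (by ring)).trans this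
  have f2 : (t ^ 3 * D) ^ 2 ∣ r ^ 3 - 3 * u * r - 2 * v := by
    have h2 : g ^ 2 ∣ r ^ 3 - 3 * u * r - 2 * v :=
      dvd_sub (dvd_sub (hr2.trans (dvd_pow_self r (by norm_num))) (hr2.mul_left _)) (hgv.mul_left _)
    have := hN.mul_dvd e2 h2
    rw [hDD]; exact (dvd_of_eq (by ring)).trans this
  obtain ⟨c, hc⟩ := f1
  obtain ⟨d, hd⟩ := f2
  have hm0 : (t ^ 3 * D) ≠ 0 := mul_ne_zero (pow_ne_zero _ ht) hD0
  refine ⟨r, c, d, ?_, ?_⟩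
  · linear_combination (-1) * hd + (3 * r) * hc
  · apply mul_left_cancel₀ (pow_ne_zero 2 hm0)
    obtain ⟨m, hm⟩ : ∃ m, m = t ^ 3 * D := ⟨_, rfl⟩
    have hG : m ^ 2 * d - 3 * m * r * c + 2 * r ^ 3 = -2 * v := by
      rw [hm]; linear_combination (-1) * hd + (3 * r) * hc
    have hP : r ^ 2 - m * c = u := by rw [hm]; linear_combination hc
    have : m ^ 2 * EE 1 m r c d = 4 * v ^ 2 - 4 * u ^ 3 := by
      rw [← hP]
      have : 4 * v ^ 2 = (m ^ 2 * d - 3 * m * r * c + 2 * r ^ 3) ^ 2 := by rw [hG]; ring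
      rw [this]; unfold EE; ring
    rw [← hm, this, hv, hm]; ring

theorem mod9_cube (u : ℤ) : u ^ 3 % 9 = 0 ∨ u ^ 3 % 9 = 1 ∨ u ^ 3 % 9 = 8 := by
  have h : u % 9 = 0 ∨ u % 9 = 1 ∨ u % 9 = 2 ∨ u % 9 = 3 ∨ u % 9 = 4 ∨ u % 9 = 5 ∨ u % 9 = 6 ∨ u % 9 = 7 ∨ u % 9 = 8 := by omega
  rcases h with h | h | h | h | h | h | h | h | h <;> simp [pow_succ, Int.mul_emod, h]

theorem three_case (B u v : ℤ) (hB : B % 9 = 1 ∨ B % 9 = 7) (h3 : 3 ∣ u)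
    (hv : v ^ 2 = u ^ 3 + 27 * B) : 27 ∣ v := by
  obtain ⟨u', rfl⟩ := h3
  have hp : Prime (3 : ℤ) := Int.prime_three
  have h1 : (3 : ℤ) ∣ v := hp.dvd_of_dvd_pow (n := 2) ⟨9 * u' ^ 3 + 9 * B, by rw [hv]; ring⟩
  obtain ⟨v1, rfl⟩ := h1
  have h2 : v1 ^ 2 = 3 * (u' ^ 3 + B) := by linarith
  have h3 : (3 : ℤ) ∣ v1 := hp.dvd_of_dvd_pow (n := 2) ⟨_, h2⟩
  obtain ⟨v2, rfl⟩ := h3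
  have h4 : 3 * v2 ^ 2 = u' ^ 3 + B := by linarith
  have h5 := mod9_cube u'
  have h6 : v2 % 3 = 0 := by
    by_contra hne
    have h7 : v2 ^ 2 % 3 = 1 := by
      have : v2 % 3 = 1 ∨ v2 % 3 = 2 := by omega
      rcases this with h | h <;> simp [pow_succ, Int.mul_emod, h]
    omega
  obtain ⟨w, hw⟩ := Int.dvd_of_emod_eq_zero h6
  exact ⟨w, by rw [hw]; ring⟩

/-- the integral form attached to a point, `σ = 3` -/
theorem form3 (A D u v t : ℤ) (hA : A ≠ 0) (hD : Squarefree D) (ht : t ≠ 0) (hut : IsCoprime u t)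
    (hD3 : IsCoprime D 3) (hAD : (A * D ^ 3) % 9 = 1 ∨ (A * D ^ 3) % 9 = 7)
    (hv : v ^ 2 = u ^ 3 + (27 * A) * D ^ 3 * t ^ 6) :
    ∃ b c d : ℤ, 27 * (t ^ 3 * D) ^ 2 * d - 9 * (t ^ 3 * D) * b * c + 2 * b ^ 3 = -2 * v ∧
      EE 3 (t ^ 3 * D) b c d = 108 * (A * D) := by
  obtain ⟨g, D', hDD, hgD, hDu, hgu, hgv⟩ := exists_split D u v t (27 * A) hD hut hv
  have hD0 : D ≠ 0 := hD.ne_zero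
  have hgt : IsCoprime g t := hut.of_isCoprime_of_dvd_left hgu
  have hN : IsCoprime (t ^ 6 * D' ^ 2) (g ^ 2) :=
    ((hgt.symm).pow).mul_left ((hgD.symm).pow)
  have hNu : IsCoprime (t ^ 6 * D' ^ 2) u :=
    (hut.symm.pow_left).mul_left hDu.pow_left
  have hg3 : IsCoprime g 3 := by rw [hDD] at hD3; exact hD3.of_mul_left_left
  have hD'3 : IsCoprime D' 3 := by rw [hDD] at hD3; exact hD3.of_mul_left_right
  have key : ∃ r, 3 * (t ^ 3 * D) ∣ r ^ 2 - u ∧ 27 * (t ^ 3 * D) ^ 2 ∣ r ^ 3 - 3 * u * r - 2 * v := by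
    by_cases h3 : (3 : ℤ) ∣ u
    · have hu3t : IsCoprime 3 t := hut.of_isCoprime_of_dvd_left h3
      have ht9 : t ^ 6 % 9 = 1 := by
        have : t % 3 ≠ 0 := by
          intro h
          have h' : (3 : ℤ) ∣ t := Int.dvd_of_emod_eq_zero h
          have := hu3t.isUnit_of_dvd' dvd_rfl h'
          rw [Int.isUnit_iff] at this; omega
        have h : t % 9 = 1 ∨ t % 9 = 2 ∨ t % 9 = 4 ∨ t % 9 = 5 ∨ t % 9 = 7 ∨ t % 9 = 8 := by omega
        rcases h with h | h | h | h | h | h <;> simp [pow_succ, Int.mul_emod, h]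
      have h27 : 27 ∣ v := by
        apply three_case (A * D ^ 3 * t ^ 6) u v _ h3 (by rw [hv]; ring)
        rw [Int.mul_emod, ht9]; omega
      have hN' : IsCoprime (t ^ 6 * D' ^ 2) (3 * g ^ 2) :=
        ((hu3t.symm.pow_left).mul_left hD'3.pow_left).mul_right hN
      obtain ⟨r, hr1, hr2⟩ := exists_r _ _ u v hN' hNu
      obtain ⟨e1, e2⟩ := r_dvd _ u v r ((27 * A) * D ^ 3 * t ^ 6) hNu hr1
        ⟨27 * A * D' * g ^ 3, by rw [hDD]; ring⟩ hv
      have hr3 : (3 : ℤ) ∣ r := (dvd_mul_right _ _).trans hr2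
      have hrg : g ^ 2 ∣ r := (dvd_mul_left _ _).trans hr2
      refine ⟨r, ?_, ?_⟩
      · have h1 : t ^ 3 * D' ∣ r ^ 2 - u := dvd_trans ⟨t ^ 3 * D', by ring⟩ e1
        have h2 : g ∣ r ^ 2 - u := dvd_sub ((dvd_pow_self g (by norm_num)).trans (hrg.trans (dvd_pow_self r (by norm_num)))) hgu
        have h2' : 3 ∣ r ^ 2 - u := dvd_sub (hr3.trans (dvd_pow_self r (by norm_num))) h3
        have h3 : IsCoprime (t ^ 3 * D') g := (hgt.symm.pow_left).mul_left hgD.symm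
        have h5 := h3.mul_dvd h1 h2
        have h4 : IsCoprime (t ^ 3 * D' * g) 3 :=
          ((hu3t.symm.pow_left).mul_left hD'3).mul_left hg3
        have := h4.mul_dvd h5 h2'
        rw [hDD]; exact (dvd_of_eq (by ring)).trans this
      · have h2 : g ^ 2 ∣ r ^ 3 - 3 * u * r - 2 * v :=
          dvd_sub (dvd_sub (hrg.trans (dvd_pow_self r (by norm_num))) (hrg.mul_left _)) (hgv.mul_left _)
        have h2' : 27 ∣ r ^ 3 - 3 * u * r - 2 * v := by
          obtain ⟨r', rfl⟩ := hr3
          obtain ⟨u', hu'⟩ := h3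
          obtain ⟨v', hv'⟩ := h27
          exact ⟨r' ^ 3 - u' * r' - 2 * v', by rw [hu', hv']; ring⟩
        have h5 := hN.mul_dvd e2 h2
        have h4 : IsCoprime (t ^ 6 * D' ^ 2 * g ^ 2) (27 : ℤ) := by
          have : IsCoprime (t ^ 6 * D' ^ 2 * g ^ 2) (3 : ℤ) :=
            ((hu3t.symm.pow_left).mul_left hD'3.pow_left).mul_left hg3.pow_left
          have := this.pow_right (n := 3)
          norm_num at this; exact this
        have := h4.mul_dvd h5 h2'
        rw [hDD]; exact (dvd_of_eq (by ring)).trans this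
    · have h3u : IsCoprime (27 : ℤ) u := by
        have : IsCoprime (3 : ℤ) u := (Prime.coprime_iff_not_dvd Int.prime_three).2 h3
        have := this.pow_left (m := 3)
        norm_num at this; exact this
      have h27g : IsCoprime (27 : ℤ) (g ^ 2) := h3u.of_isCoprime_of_dvd_right hgu |>.pow_right
      have hN' : IsCoprime (27 * (t ^ 6 * D' ^ 2)) (g ^ 2) := h27g.mul_left hN
      have hNu' : IsCoprime (27 * (t ^ 6 * D' ^ 2)) u := h3u.mul_left hNu
      obtain ⟨r, hr1, hr2⟩ := exists_r _ _ u v hN' hNu'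
      obtain ⟨e1, e2⟩ := r_dvd _ u v r ((27 * A) * D ^ 3 * t ^ 6) hNu' hr1
        ⟨A * D' * g ^ 3, by rw [hDD]; ring⟩ hv
      refine ⟨r, ?_, ?_⟩
      · have h1 : 3 * (t ^ 3 * D') ∣ r ^ 2 - u := dvd_trans ⟨9 * t ^ 3 * D', by ring⟩ e1
        have h2 : g ∣ r ^ 2 - u := dvd_sub ((dvd_pow_self g (by norm_num)).trans (hr2.trans (dvd_pow_self r (by norm_num)))) hgu
        have h3 : IsCoprime (3 * (t ^ 3 * D')) g := (hg3.symm).mul_left ((hgt.symm.pow_left).mul_left hgD.symm)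
        have := h3.mul_dvd h1 h2
        rw [hDD]; exact (dvd_of_eq (by ring)).trans this
      · have h2 : g ^ 2 ∣ r ^ 3 - 3 * u * r - 2 * v :=
          dvd_sub (dvd_sub (hr2.trans (dvd_pow_self r (by norm_num))) (hr2.mul_left _)) (hgv.mul_left _)
        have := hN'.mul_dvd e2 h2
        rw [hDD]; exact (dvd_of_eq (by ring)).trans this
  obtain ⟨r, ⟨c, hc⟩, ⟨d, hd⟩⟩ := key
  have hm0 : (t ^ 3 * D) ≠ 0 := mul_ne_zero (pow_ne_zero _ ht) hD0
  have hG' : 27 * (t ^ 3 * D) ^ 2 * d - 9 * (t ^ 3 * D) * r * c + 2 * r ^ 3 = -2 * v := by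
    linear_combination (-1) * hd + (3 * r) * hc
  refine ⟨r, c, d, hG', ?_⟩
  · apply mul_left_cancel₀ (pow_ne_zero 2 hm0)
    obtain ⟨m, hm⟩ : ∃ m, m = t ^ 3 * D := ⟨_, rfl⟩
    rw [← hm] at hG' hc
    have hP : r ^ 2 - 3 * m * c = u := by linear_combination hc
    have : m ^ 2 * EE 3 m r c d = 4 * v ^ 2 - 4 * u ^ 3 := by
      rw [← hP]
      have : 4 * v ^ 2 = (27 * m ^ 2 * d - 9 * m * r * c + 2 * r ^ 3) ^ 2 := by rw [hG']; ring
      rw [this]; unfold EE; ring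
    rw [← hm, this, hv, hm]; ring

end MW

namespace MW

abbrev F4 := ℤ × ℤ × ℤ × ℤ

def Tf (κ σ : ℤ) (f : F4) : F4 :=
  (f.1, f.2.1 + σ * f.1, f.2.2.1 + 2 * f.2.1 + σ * f.1, f.2.2.2 + κ * f.2.2.1 + κ * f.2.1 + f.1)

def Sf (f : F4) : F4 := (f.2.2.2, -f.2.2.1, f.2.1, -f.1)

def Eqv (κ σ : ℤ) : F4 → F4 → Prop := Relation.EqvGen (fun f g => g = Tf κ σ f ∨ g = Sf f)

def EF (σ : ℤ) (f : F4) : ℤ := EE σ f.1 f.2.1 f.2.2.1 f.2.2.2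

def GF (σ : ℤ) (f : F4) : ℤ := σ ^ 3 * f.1 ^ 2 * f.2.2.2 - 3 * σ * (f.1 * f.2.1 * f.2.2.1) + 2 * f.2.1 ^ 3

def IsType (κ σ : ℤ) : Prop := (κ = 3 ∧ σ = 1) ∨ (κ = 1 ∧ σ = 3)

theorem EF_T {κ σ : ℤ} (h : IsType κ σ) (f : F4) : EF σ (Tf κ σ f) = EF σ f := by
  obtain ⟨a, b, c, d⟩ := f
  rcases h with ⟨rfl, rfl⟩ | ⟨rfl, rfl⟩ <;> simp only [EF, Tf, EE] <;> ring

theorem EF_S {κ σ : ℤ} (h : IsType κ σ) (f : F4) : EF σ (Sf f) = EF σ f := by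
  obtain ⟨a, b, c, d⟩ := f
  rcases h with ⟨rfl, rfl⟩ | ⟨rfl, rfl⟩ <;> simp only [EF, Sf, EE] <;> ring

theorem GF_T {κ σ : ℤ} (h : IsType κ σ) (f : F4) : GF σ (Tf κ σ f) = GF σ f := by
  obtain ⟨a, b, c, d⟩ := f
  rcases h with ⟨rfl, rfl⟩ | ⟨rfl, rfl⟩ <;> simp only [GF, Tf] <;> ring

theorem GF_EF {κ σ : ℤ} (h : IsType κ σ) (f : F4) :
    GF σ f ^ 2 - f.1 ^ 2 * EF σ f = 4 * (f.2.1 ^ 2 - σ * f.1 * f.2.2.1) ^ 3 := by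
  obtain ⟨a, b, c, d⟩ := f
  rcases h with ⟨rfl, rfl⟩ | ⟨rfl, rfl⟩ <;> simp only [GF, EF, EE] <;> ring

variable {K : Type} [Field K] [CharZero K]

def Th (σ : ℤ) (η : K) (f : F4) : K := -(GF σ f : K) + f.1 * η

theorem Th_S {κ σ : ℤ} (h : IsType κ σ) (f : F4) (η : K) (hη : η ^ 2 = EF σ f)
    (hind : ∀ p q : ℤ, (p : K) + q * η = 0 → p = 0 ∧ q = 0) :
    ∃ z : K, z ≠ 0 ∧ Th σ η (Sf f) = Th σ η f * z ^ 3 := by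
  have hP : f.2.1 ^ 2 - σ * f.1 * f.2.2.1 ≠ 0 := by
    intro hP
    have h1 := GF_EF h f
    rw [hP] at h1
    have h2 : ((GF σ f : K) + f.1 * η) * ((GF σ f : K) - f.1 * η) = 0 := by
      have : (GF σ f : K) ^ 2 - (f.1 : K) ^ 2 * (EF σ f : K) = 0 := by
        have := congrArg (Int.cast : ℤ → K) h1; push_cast at this; simpa using this
      rw [← hη] at this; linear_combination this
    have h3 : GF σ f = 0 ∧ f.1 = 0 := by
      rcases mul_eq_zero.1 h2 with h | h
      · exact hind _ _ h
      · have := hind (GF σ f) (-f.1) (by push_cast; linear_combination h)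
        exact ⟨this.1, by linarith [this.2]⟩
    have h4 : f.2.1 = 0 := by
      have := hP; rw [h3.2] at this; simpa using this
    have h5 : EF σ f = 0 := by simp [EF, EE, h3.2, h4]
    rw [h5] at hη
    have h6 : η = 0 := by simpa using hη
    have := hind 0 1 (by simp [h6])
    omega
  have hσ : (σ : K) ≠ 0 := by
    rcases h with ⟨_, rfl⟩ | ⟨_, rfl⟩ <;> norm_num
  have hPK : ((f.2.1 : K) ^ 2 - σ * f.1 * f.2.2.1) ≠ 0 := by exact_mod_cast hP
  refine ⟨(-(σ * f.2.1 * f.2.2.1 - σ ^ 3 * f.1 * f.2.2.2 : K) + η) * (-1) / (2 * σ * ((f.2.1 : K) ^ 2 - σ * f.1 * f.2.2.1)), ?_, ?_⟩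
  · apply div_ne_zero
    · intro h0
      have := hind (-(σ * f.2.1 * f.2.2.1 - σ ^ 3 * f.1 * f.2.2.2)) 1 (by
        push_cast; linear_combination (-1) * h0)
      omega
    · exact mul_ne_zero (mul_ne_zero two_ne_zero hσ) hPK
  · rw [div_pow, mul_div_assoc', eq_div_iff (pow_ne_zero 3 (mul_ne_zero (mul_ne_zero two_ne_zero hσ) hPK))]
    obtain ⟨a, b, c, d⟩ := f
    rcases h with ⟨rfl, rfl⟩ | ⟨rfl, rfl⟩
    · simp only [Th, GF, Sf, EF, EE] at hη ⊢
      push_cast at hη ⊢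
      linear_combination (3 * a * (1 * b * c - 1 * a * d) ^ 2 + 3 * (1 * a ^ 2 * d - 3 * (a * b * c) + 2 * b ^ 3) * (1 * b * c - 1 * a * d) + a * (1 * a ^ 2 * d ^ 2 - 6 * (a * b * c * d) - 3 * (b ^ 2 * c ^ 2) + 4 * (b ^ 3 * d) + 4 * (a * c ^ 3)) - (3 * a * (1 * b * c - 1 * a * d) + (1 * a ^ 2 * d - 3 * (a * b * c) + 2 * b ^ 3)) * η + a * η ^ 2 : K) * hη
    · simp only [Th, GF, Sf, EF, EE] at hη ⊢
      push_cast at hη ⊢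
      linear_combination (3 * a * (3 * b * c - 27 * a * d) ^ 2 + 3 * (27 * a ^ 2 * d - 9 * (a * b * c) + 2 * b ^ 3) * (3 * b * c - 27 * a * d) + a * (729 * a ^ 2 * d ^ 2 - 486 * (a * b * c * d) - 27 * (b ^ 2 * c ^ 2) + 108 * (b ^ 3 * d) + 108 * (a * c ^ 3)) - (3 * a * (3 * b * c - 27 * a * d) + (27 * a ^ 2 * d - 9 * (a * b * c) + 2 * b ^ 3)) * η + a * η ^ 2 : K) * hη

theorem Th_eqv {κ σ : ℤ} (h : IsType κ σ) (f g : F4) (hfg : Eqv κ σ f g) (η : K)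
    (hind : ∀ p q : ℤ, (p : K) + q * η = 0 → p = 0 ∧ q = 0) :
    EF σ f = EF σ g ∧ (η ^ 2 = EF σ f → ∃ z : K, z ≠ 0 ∧ Th σ η g = Th σ η f * z ^ 3) := by
  induction hfg with
  | rel f g hfg =>
    rcases hfg with rfl | rfl
    · refine ⟨(EF_T h f).symm, fun _ => ⟨1, one_ne_zero, ?_⟩⟩
      unfold Th; rw [GF_T h]; simp [Tf]
    · exact ⟨(EF_S h f).symm, fun hη => Th_S h f η hη hind⟩
  | refl f => exact ⟨rfl, fun _ => ⟨1, one_ne_zero, by simp⟩⟩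
  | symm f g _ ih =>
    refine ⟨ih.1.symm, fun hη => ?_⟩
    obtain ⟨z, hz, e⟩ := ih.2 (by rw [hη, ih.1])
    exact ⟨z⁻¹, inv_ne_zero hz, by rw [e]; field_simp⟩
  | trans f g k _ _ ih1 ih2 =>
    refine ⟨ih1.1.trans ih2.1, fun hη => ?_⟩
    obtain ⟨z, hz, e⟩ := ih1.2 hη
    obtain ⟨z', hz', e'⟩ := ih2.2 (by rw [hη, ih1.1])
    exact ⟨z * z', mul_ne_zero hz hz', by rw [e', e]; ring⟩

theorem index_bound {κ σ : ℤ} (hT : IsType κ σ) (k k' : ℤ) (c : ℚ) (hc : c ≠ 0)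
    (hkk : (k : ℚ) * c ^ 6 = -27 * k')
    (hns' : ∀ y : ℚ, y ^ 2 ≠ k') (hns : ∀ y : ℚ, y ^ 2 ≠ k) (hk : k ≠ 0)
    (D e : ℤ) (hD : D ≠ 0) (he : e * D ^ 2 = 4 * k)
    (hform : ∀ u v t : ℤ, t ≠ 0 → IsCoprime u t → v ^ 2 = u ^ 3 + k * t ^ 6 →
      ∃ b c d : ℤ, GF σ (t ^ 3 * D, b, c, d) = -2 * v ∧ EF σ (t ^ 3 * D, b, c, d) = e)
    (R : Set F4) (hneg : ∀ f ∈ R, -f ∈ R)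
    (hred : ∀ f : F4, f.1 ≠ 0 → EF σ f = e → ∃ g ∈ R, Eqv κ σ f g)
    (hfin : {f : F4 | f ∈ R ∧ f.1 ≠ 0 ∧ EF σ f = e}.Finite) :
    (phi k' k c hc hkk hns' hk).range.index ≠ 0 ∧
    2 * (phi k' k c hc hkk hns' hk).range.index ≤ {f : F4 | f ∈ R ∧ f.1 ≠ 0 ∧ EF σ f = e}.ncard + 2 := by
  obtain ⟨K, _, _, δ, hδ, hsp⟩ := exists_K k hns
  have hDK : (D : K) ≠ 0 := by exact_mod_cast hD
  obtain ⟨η, hηdef⟩ : ∃ η : K, η = 2 * δ / D := ⟨_, rfl⟩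
  have hη : η ^ 2 = (e : K) := by
    have : (e : K) * D ^ 2 = 4 * k := by exact_mod_cast congrArg (Int.cast : ℤ → K) he
    rw [hηdef, div_pow, mul_pow, hδ, div_eq_iff (pow_ne_zero 2 hDK), this]; norm_num
  have hind : ∀ p q : ℤ, (p : K) + q * η = 0 → p = 0 ∧ q = 0 := by
    intro p q hpq
    have := ind_of_ns k hns δ hδ p (q * 2 / D) (by
      rw [hηdef] at hpq; push_cast; rw [← hpq]; field_simp)
    have hDQ : (D : ℚ) ≠ 0 := by exact_mod_cast hD
    refine ⟨by exact_mod_cast this.1, ?_⟩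
    have h2 := this.2
    rw [div_eq_zero_iff] at h2
    rcases h2 with h2 | h2
    · have : (q : ℚ) = 0 := by linarith
      exact_mod_cast this
    · exact absurd h2 hDQ
  obtain ⟨H, hH⟩ : ∃ H, H = (phi k' k c hc hkk hns' hk).range := ⟨_, rfl⟩
  obtain ⟨N, hN⟩ : ∃ N, N = {f : F4 | f ∈ R ∧ f.1 ≠ 0 ∧ EF σ f = e} := ⟨_, rfl⟩
  rw [← hH, ← hN]
  rw [← hN] at hfin
  have key : ∀ P : Pt k, P ∉ H → ∃ g ∈ N, ∃ (x y : ℚ) (h : _) (z : K), z ≠ 0 ∧ P = pt k hk x y h ∧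
      Th σ η g = 2 * (y + δ) * z ^ 3 := by
    intro P hP
    rcases pt_cases k hk P with rfl | ⟨x, y, h, rfl⟩
    · exact absurd H.zero_mem hP
    obtain ⟨u, v, t, ht, hco, rfl, rfl, huv⟩ := point_int k x y h
    obtain ⟨b, c', d, hG, hE⟩ := hform u v t ht hco huv
    have htK : (t : K) ≠ 0 := by exact_mod_cast ht
    obtain ⟨g, hgR, hg⟩ := hred (t ^ 3 * D, b, c', d) (mul_ne_zero (pow_ne_zero _ ht) hD) hE
    have hth : Th σ η (t ^ 3 * D, b, c', d) = 2 * (((v / t ^ 3 : ℚ) : K) + δ) * t ^ 3 := by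
      unfold Th
      rw [hG, hηdef]; push_cast; field_simp
    have h1 := Th_eqv hT _ _ hg η hind
    obtain ⟨z, hz, hz2⟩ := h1.2 (by rw [hη, hE])
    rw [hth] at hz2
    refine ⟨g, ?_, _, _, h, t * z, mul_ne_zero htK hz, rfl, by rw [hz2]; ring⟩
    rw [hN]
    refine ⟨hgR, ?_, by rw [← h1.1]; exact hE⟩
    intro h0
    apply hP
    rw [hH]
    have h2 : Th σ η g = -2 * (g.2.1 : K) ^ 3 := by
      unfold Th GF; rw [h0]; push_cast; ring
    apply kernel_psi k k' c hc hkk hns' hns hk δ hδ hsp _ _ h (-g.2.1 / (t * z))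
    rw [hz2] at h2
    rw [div_pow, eq_div_iff (pow_ne_zero 3 (mul_ne_zero htK hz))]
    linear_combination (1 / 2 : K) * h2
  choose G hGN hG using key
  have hfinN : Finite N := hfin
  have hout : ∀ q : {q : Pt k ⧸ H // q ≠ 0}, q.1.out ∉ H := by
    intro q hq
    apply q.2
    rw [← QuotientAddGroup.out_eq' q.1]
    exact (QuotientAddGroup.eq_zero_iff _).2 hq
  have hThneg : ∀ g : F4, Th σ η (-g) = - Th σ η g := by
    intro g; unfold Th GF; simp; ring
  have hcos : ∀ (P P' : Pt k) (hP : P ∉ H) (hP' : P' ∉ H) (w : K),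
      Th σ η (G P hP) = w ^ 3 * Th σ η (G P' hP') → P - P' ∈ H := by
    intro P P' hP hP' w hw
    obtain ⟨x, y, h, z, hz, e1, e2⟩ := hG P hP
    obtain ⟨x', y', h', z', hz', e1', e2'⟩ := hG P' hP'
    rw [e2, e2'] at hw
    rw [e1, e1', hH]
    apply coset_psi k k' c hc hkk hns' hns hk δ hδ hsp _ _ h _ _ h' (w * z' / z)
    field_simp
    linear_combination (1 / 2 : K) * hw
  let Φ : {q : Pt k ⧸ H // q ≠ 0} × Bool → N := fun p =>
    ⟨if p.2 then G _ (hout p.1) else - G _ (hout p.1), by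
      have := hGN _ (hout p.1)
      rw [hN] at this ⊢
      split_ifs
      · exact this
      · refine ⟨hneg _ this.1, by simpa using this.2.1, ?_⟩
        rw [← this.2.2]; simp only [EF, EE, Prod.fst_neg, Prod.snd_neg]; ring⟩
  have hinj : Function.Injective Φ := by
    have aux : ∀ q q' : {q : Pt k ⧸ H // q ≠ 0}, q.1.out - q'.1.out ∈ H → q = q' := by
      intro q q' h
      apply Subtype.ext
      rw [← QuotientAddGroup.out_eq' q.1, ← QuotientAddGroup.out_eq' q'.1]
      rw [eq_comm, QuotientAddGroup.eq]
      rwa [neg_add_eq_sub]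
    rintro ⟨q, s⟩ ⟨q', s'⟩ h
    have h' := congrArg Subtype.val h
    simp only [Φ] at h'
    have hqq : q = q' := by
      apply aux
      have h'' := congrArg (Th σ η) h'
      cases s <;> cases s' <;> simp [hThneg] at h''
      · exact hcos _ _ _ _ 1 (by rw [h'']; ring)
      · exact hcos _ _ _ _ (-1) (by rw [← h'']; ring)
      · exact hcos _ _ _ _ (-1) (by rw [h'']; ring)
      · exact hcos _ _ _ _ 1 (by rw [h'']; ring)
    subst hqq
    have hne : (G _ (hout q)).1 ≠ 0 := by
      have := hGN _ (hout q)
      rw [hN] at this; exact this.2.1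
    cases s <;> cases s' <;> simp at h'
    · rfl
    · have := congrArg Prod.fst h'
      simp at this; omega
    · have := congrArg Prod.fst h'
      simp at this; omega
    · rfl
  haveI : Finite ({q : Pt k ⧸ H // q ≠ 0} × Bool) := Finite.of_injective Φ hinj
  haveI : Finite {q : Pt k ⧸ H // q ≠ 0} := Finite.of_injective (fun q => (q, true)) (by
    intro a b h; simpa using h)
  haveI : Finite (Pt k ⧸ H) := by
    have : (Set.univ : Set (Pt k ⧸ H)) = {q | q ≠ 0} ∪ {0} := by ext q; simp; exact em _
    rw [← Set.finite_univ_iff, this]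
    exact (show ({q : Pt k ⧸ H | q ≠ 0}).Finite from ‹Finite {q : Pt k ⧸ H // q ≠ 0}›).union (Set.finite_singleton _)
  have hc1 : Nat.card ({q : Pt k ⧸ H // q ≠ 0} × Bool) ≤ Nat.card N := Nat.card_le_card_of_injective Φ hinj
  rw [Nat.card_prod] at hc1
  have hc2 : Nat.card {q : Pt k ⧸ H // q ≠ 0} + 1 = Nat.card (Pt k ⧸ H) := by
    have := Set.ncard_compl_add_ncard ({0} : Set (Pt k ⧸ H))
    rw [Set.ncard_singleton] at this
    rw [← this]; rfl
  have hi : H.index = Nat.card (Pt k ⧸ H) := rfl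
  have hc3 : N.ncard = Nat.card N := rfl
  simp at hc1
  rw [hc3, hi]
  constructor
  · rw [← hc2]; omega
  · simp only [ne_eq] at hc2
    omega

end MW

namespace MW

def IsTy (κ σ ε : ℤ) : Prop := (κ = 3 ∧ σ = 1 ∧ ε = -1) ∨ (κ = 1 ∧ σ = 3 ∧ ε = 1)

theorem IsTy.isType {κ σ ε : ℤ} (h : IsTy κ σ ε) : IsType κ σ := by
  rcases h with ⟨h1, h2, _⟩ | ⟨h1, h2, _⟩
  · exact Or.inl ⟨h1, h2⟩
  · exact Or.inr ⟨h1, h2⟩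

/-- the parametrisation of real forms by leading coefficients and a point of the half plane -/
def par (κ σ ε a b0 x s : ℝ) : ℝ × ℝ × ℝ × ℝ :=
  (a, b0 + σ * x * a, ε * s * a + 2 * x * b0 + σ * x ^ 2 * a,
    ε * s * b0 + κ * x * (ε * s * a) + κ * x ^ 2 * b0 + x ^ 3 * a)

def toR (f : F4) : ℝ × ℝ × ℝ × ℝ := (f.1, f.2.1, f.2.2.1, f.2.2.2)

def Comp (κ σ ε : ℤ) (x s : ℝ) (f : F4) : Prop :=
  0 < s ∧ ∃ a b0 : ℝ, toR f = par κ σ ε a b0 x s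

/-- reduced forms -/
def Red (κ σ ε : ℤ) : Set F4 :=
  {f | ∃ x s : ℝ, |x| ≤ 1 / 2 ∧ 1 ≤ x ^ 2 + s ∧ Comp κ σ ε x s f}

theorem Red_neg (κ σ ε : ℤ) : ∀ f ∈ Red κ σ ε, -f ∈ Red κ σ ε := by
  rintro f ⟨x, s, hx, hs, h0, a, b0, h⟩
  refine ⟨x, s, hx, hs, h0, -a, -b0, ?_⟩
  have : toR (-f) = - toR f := by simp [toR]
  rw [this, h]
  simp only [par, Prod.neg_mk, Prod.mk.injEq]
  refine ⟨trivial, by ring, by ring, by ring⟩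

theorem par_EE {κ σ ε : ℤ} (h : IsTy κ σ ε) (a b0 x s : ℝ) :
    EE (σ : ℝ) (par κ σ ε a b0 x s).1 (par κ σ ε a b0 x s).2.1 (par κ σ ε a b0 x s).2.2.1
      (par κ σ ε a b0 x s).2.2.2 = 4 * ε * (σ : ℝ) ^ 3 * (s * (s * a ^ 2 + b0 ^ 2) ^ 2) := by
  rcases h with ⟨rfl, rfl, rfl⟩ | ⟨rfl, rfl, rfl⟩ <;> simp only [par, EE] <;> push_cast <;> ring

theorem Comp_EF {κ σ ε : ℤ} (h : IsTy κ σ ε) (f : F4) (a b0 x s : ℝ)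
    (hf : toR f = par κ σ ε a b0 x s) :
    (EF σ f : ℝ) = 4 * ε * (σ : ℝ) ^ 3 * (s * (s * a ^ 2 + b0 ^ 2) ^ 2) := by
  rw [← par_EE h a b0 x s, ← hf]
  simp [EF, EE, toR]

theorem Comp_T {κ σ ε : ℤ} (h : IsTy κ σ ε) (x s : ℝ) (f : F4) (hf : Comp κ σ ε x s f) :
    Comp κ σ ε (x + 1) s (Tf κ σ f) := by
  obtain ⟨hs, a, b0, hf⟩ := hf
  refine ⟨hs, a, b0, ?_⟩
  simp only [toR, par, Prod.mk.injEq, Tf] at hf ⊢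
  obtain ⟨h1, h2, h3, h4⟩ := hf
  push_cast
  rw [h1, h2, h3, h4]
  rcases h with ⟨rfl, rfl, rfl⟩ | ⟨rfl, rfl, rfl⟩ <;> push_cast <;>
    exact ⟨by trivial, by ring, by ring, by ring⟩

def Tfi (κ σ : ℤ) (f : F4) : F4 :=
  (f.1, f.2.1 - σ * f.1, f.2.2.1 - 2 * f.2.1 + σ * f.1, f.2.2.2 - κ * f.2.2.1 + κ * f.2.1 - f.1)

theorem Tf_Tfi {κ σ : ℤ} (h : IsType κ σ) (f : F4) : Tf κ σ (Tfi κ σ f) = f := by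
  obtain ⟨a, b, c, d⟩ := f
  rcases h with ⟨rfl, rfl⟩ | ⟨rfl, rfl⟩ <;> simp only [Tf, Tfi, Prod.mk.injEq] <;>
    exact ⟨by trivial, by ring, by ring, by ring⟩

theorem Comp_Ti {κ σ ε : ℤ} (h : IsTy κ σ ε) (x s : ℝ) (f : F4) (hf : Comp κ σ ε x s f) :
    Comp κ σ ε (x - 1) s (Tfi κ σ f) := by
  obtain ⟨hs, a, b0, hf⟩ := hf
  refine ⟨hs, a, b0, ?_⟩
  simp only [toR, par, Prod.mk.injEq, Tfi] at hf ⊢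
  obtain ⟨h1, h2, h3, h4⟩ := hf
  push_cast
  rw [h1, h2, h3, h4]
  rcases h with ⟨rfl, rfl, rfl⟩ | ⟨rfl, rfl, rfl⟩ <;> push_cast <;>
    exact ⟨by trivial, by ring, by ring, by ring⟩

theorem Comp_S {κ σ ε : ℤ} (h : IsTy κ σ ε) (x s : ℝ) (f : F4) (hf : Comp κ σ ε x s f) :
    Comp κ σ ε (-x / (x ^ 2 + s)) (s / (x ^ 2 + s) ^ 2) (Sf f) := by
  obtain ⟨hs, a, b0, hf⟩ := hf
  have hr : x ^ 2 + s ≠ 0 := by positivity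
  refine ⟨by positivity, f.2.2.2, -f.2.2.1 + σ * x / (x ^ 2 + s) * f.2.2.2, ?_⟩
  simp only [toR, par, Prod.mk.injEq, Sf] at hf ⊢
  obtain ⟨h1, h2, h3, h4⟩ := hf
  push_cast
  rw [h1, h2, h3, h4]
  rcases h with ⟨rfl, rfl, rfl⟩ | ⟨rfl, rfl, rfl⟩ <;> push_cast <;>
    refine ⟨trivial, by ring, by field_simp; ring, by field_simp; ring⟩

open UpperHalfPlane in
theorem Comp_act {κ σ ε : ℤ} (h : IsTy κ σ ε) (g : Matrix.SpecialLinearGroup (Fin 2) ℤ) :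
    ∀ (τ : UpperHalfPlane) (f : F4), Comp κ σ ε τ.re (τ.im ^ 2) f →
      ∃ f', Eqv κ σ f f' ∧ Comp κ σ ε (g • τ).re ((g • τ).im ^ 2) f' := by
  have hS : ∀ (τ : UpperHalfPlane) (f : F4), Comp κ σ ε τ.re (τ.im ^ 2) f →
      ∃ f', Eqv κ σ f f' ∧ Comp κ σ ε (ModularGroup.S • τ).re ((ModularGroup.S • τ).im ^ 2) f' := by
    intro τ f hf
    refine ⟨Sf f, Relation.EqvGen.rel _ _ (Or.inr rfl), ?_⟩
    have := Comp_S h _ _ _ hf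
    have e1 : (ModularGroup.S • τ).re = -τ.re / (τ.re ^ 2 + τ.im ^ 2) := by
      rw [modular_S_smul]
      change ((-τ : ℂ)⁻¹).re = _
      rw [Complex.inv_re]; simp [Complex.normSq_apply, sq]
    have e2 : (ModularGroup.S • τ).im = τ.im / (τ.re ^ 2 + τ.im ^ 2) := by
      rw [modular_S_smul]
      change ((-τ : ℂ)⁻¹).im = _
      rw [Complex.inv_im]; simp [Complex.normSq_apply, sq]
    rw [e1, e2, div_pow]; exact this
  have hSS : ∀ τ : UpperHalfPlane, ModularGroup.S • ModularGroup.S • τ = τ := by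
    intro τ
    apply UpperHalfPlane.ext
    rw [modular_S_smul, modular_S_smul]
    simp
  have main : (∀ (τ : UpperHalfPlane) (f : F4), Comp κ σ ε τ.re (τ.im ^ 2) f →
      ∃ f', Eqv κ σ f f' ∧ Comp κ σ ε (g • τ).re ((g • τ).im ^ 2) f') ∧
      (∀ (τ : UpperHalfPlane) (f : F4), Comp κ σ ε τ.re (τ.im ^ 2) f →
      ∃ f', Eqv κ σ f f' ∧ Comp κ σ ε (g⁻¹ • τ).re ((g⁻¹ • τ).im ^ 2) f') := by
    have hg : g ∈ Subgroup.closure {ModularGroup.S, ModularGroup.T} := by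
      rw [SpecialLinearGroup.SL2Z_generators]; trivial
    induction hg using Subgroup.closure_induction with
    | mem g hg =>
      rcases hg with rfl | rfl
      · refine ⟨hS, ?_⟩
        intro τ f hf
        have : ModularGroup.S⁻¹ • τ = ModularGroup.S • τ := by
          rw [inv_smul_eq_iff, hSS]
        rw [this]; exact hS τ f hf
      · constructor
        · intro τ f hf
          refine ⟨Tf κ σ f, Relation.EqvGen.rel _ _ (Or.inl rfl), ?_⟩
          rw [modular_T_smul]
          have := Comp_T h _ _ _ hf
          simpa [add_comm] using this
        · intro τ f hf
          refine ⟨Tfi κ σ f, Relation.EqvGen.symm _ _ (Relation.EqvGen.rel _ _ (Or.inl (Tf_Tfi h.isType f).symm)), ?_⟩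
          have e := modular_T_zpow_smul τ (-1)
          rw [zpow_neg_one] at e
          rw [e]
          have := Comp_Ti h _ _ _ hf
          simpa [sub_eq_add_neg, add_comm] using this
    | one =>
      constructor <;> intro τ f hf <;> exact ⟨f, Relation.EqvGen.refl _, by simpa using hf⟩
    | mul g g' _ _ ih ih' =>
      constructor
      · intro τ f hf
        obtain ⟨f1, e1, h1⟩ := ih'.1 τ f hf
        obtain ⟨f2, e2, h2⟩ := ih.1 _ f1 h1
        exact ⟨f2, e1.trans _ _ _ e2, by rw [mul_smul]; exact h2⟩
      · intro τ f hf
        obtain ⟨f1, e1, h1⟩ := ih.2 τ f hf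
        obtain ⟨f2, e2, h2⟩ := ih'.2 _ f1 h1
        exact ⟨f2, e1.trans _ _ _ e2, by rw [mul_inv_rev, mul_smul]; exact h2⟩
    | inv g _ ih => exact ⟨ih.2, by rw [inv_inv]; exact ih.1⟩
  exact main.1

theorem red_of_comp {κ σ ε : ℤ} (h : IsTy κ σ ε) (x s : ℝ) (f : F4) (hf : Comp κ σ ε x s f) :
    ∃ g ∈ Red κ σ ε, Eqv κ σ f g := by
  have hs := hf.1
  obtain ⟨γ, hγ⟩ := ModularGroup.exists_smul_mem_fd (⟨⟨x, Real.sqrt s⟩, Real.sqrt_pos.2 hs⟩ : UpperHalfPlane)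
  obtain ⟨f', e, h'⟩ := Comp_act h γ ⟨⟨x, Real.sqrt s⟩, Real.sqrt_pos.2 hs⟩ f (by
    change Comp κ σ ε x (Real.sqrt s ^ 2) f
    rw [Real.sq_sqrt hs.le]; exact hf)
  refine ⟨f', ⟨_, _, hγ.2, ?_, h'⟩, e⟩
  have := hγ.1
  rw [Complex.normSq_apply] at this
  have e3 := this
  simp only [UpperHalfPlane.coe_re, UpperHalfPlane.coe_im] at e3
  nlinarith

theorem cubic_root (a b c d : ℝ) (ha : a ≠ 0) : ∃ r, a * r ^ 3 + b * r ^ 2 + c * r + d = 0 := by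
  wlog hp : 0 < a with H
  · have hn : 0 < -a := by
      have := lt_of_le_of_ne (not_lt.1 hp) ha
      linarith
    obtain ⟨r, hr⟩ := H (-a) (-b) (-c) (-d) hn.ne' hn
    exact ⟨r, by linarith⟩
  obtain ⟨B, hB⟩ : ∃ B, B = (|b| + |c| + |d|) / a := ⟨_, rfl⟩
  have hB0 : 0 ≤ B := by rw [hB]; positivity
  have hBa : a * B = |b| + |c| + |d| := by rw [hB]; field_simp
  obtain ⟨M, hM⟩ : ∃ M, M = 1 + B := ⟨_, rfl⟩
  have hM1 : 1 ≤ M := by linarith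
  have key : |b| * M ^ 2 + |c| * M + |d| ≤ a * M ^ 3 := by
    have h1 : |c| * M ≤ |c| * M ^ 2 := by
      apply mul_le_mul_of_nonneg_left _ (abs_nonneg c); nlinarith
    have h2 : |d| ≤ |d| * M ^ 2 := by
      have := abs_nonneg d; nlinarith [mul_nonneg this (show 0 ≤ M ^ 2 - 1 by nlinarith)]
    have h3 : a * M ^ 3 = (a + (|b| + |c| + |d|)) * M ^ 2 := by
      rw [← hBa, hM]; ring
    rw [h3]; nlinarith [sq_nonneg M]
  have hcont : Continuous (fun r : ℝ => a * r ^ 3 + b * r ^ 2 + c * r + d) := by fun_prop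
  have := mem_range_of_exists_le_of_exists_ge hcont (c := 0) ⟨-M, ?_⟩ ⟨M, ?_⟩
  · obtain ⟨r, hr⟩ := this
    exact ⟨r, hr⟩
  · have h1 : b * M ^ 2 ≤ |b| * M ^ 2 := mul_le_mul_of_nonneg_right (le_abs_self b) (by positivity)
    have h2 : -c * M ≤ |c| * M := mul_le_mul_of_nonneg_right (neg_le_abs c) (by positivity)
    have h3 := le_abs_self d
    have : a * (-M) ^ 3 + b * (-M) ^ 2 + c * (-M) + d = - (a * M ^ 3) + b * M ^ 2 + -c * M + d := by ring
    change _ ≤ (0 : ℝ)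
    rw [this]; linarith
  · have h1 : -b * M ^ 2 ≤ |b| * M ^ 2 := mul_le_mul_of_nonneg_right (neg_le_abs b) (by positivity)
    have h2 : -c * M ≤ |c| * M := mul_le_mul_of_nonneg_right (neg_le_abs c) (by positivity)
    have h3 := neg_le_abs d
    change (0 : ℝ) ≤ _
    linarith

theorem exists_comp {κ σ ε : ℤ} (h : IsTy κ σ ε) (n : ℤ) (hn : 0 < n) (f : F4) (ha : f.1 ≠ 0)
    (hE : EF σ f = 4 * ε * σ ^ 3 * n) : ∃ x s, Comp κ σ ε x s f := by
  have h' := h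
  obtain ⟨a, b, c, d⟩ := f
  simp only at ha
  have haR : (a : ℝ) ≠ 0 := by exact_mod_cast ha
  have hnR : (0 : ℝ) < n := by exact_mod_cast hn
  rcases h with ⟨rfl, rfl, rfl⟩ | ⟨rfl, rfl, rfl⟩
  · have hG := GF_EF h'.isType (a, b, c, d)
    rw [hE] at hG
    simp only at hG
    have hP : 0 < b ^ 2 - 1 * a * c := by
      by_contra hP
      have h1 : (b ^ 2 - 1 * a * c) ^ 3 ≤ 0 := by
        apply Odd.pow_nonpos (by decide) (not_lt.1 hP)
      have h2 : 0 < a ^ 2 * n := by positivity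
      nlinarith [sq_nonneg (GF 1 (a, b, c, d))]
    obtain ⟨P, hPd⟩ : ∃ P : ℝ, P = (b : ℝ) ^ 2 - a * c := ⟨_, rfl⟩
    have hPR : 0 < P := by
      have : (0 : ℝ) < ((b ^ 2 - 1 * a * c : ℤ) : ℝ) := by exact_mod_cast hP
      push_cast at this; linarith
    have hER : (EE 1 a b c d : ℝ) = -4 * n := by
      have := congrArg (Int.cast : ℤ → ℝ) hE
      simp [EF, EE] at this ⊢; linarith
    obtain ⟨Q, hQ⟩ : ∃ Q : ℝ, Q = b * c - a * d := ⟨_, rfl⟩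
    obtain ⟨R, hR⟩ : ∃ R : ℝ, R = (c : ℝ) ^ 2 - b * d := ⟨_, rfl⟩
    have hn4 : (n : ℝ) = P * R - Q ^ 2 / 4 := by
      rw [hPd, hQ, hR]; simp only [EE] at hER; linarith
    have s1 : (a : ℝ) * R - b * Q + c * P = 0 := by rw [hPd, hQ, hR]; ring
    have s2 : (b : ℝ) * R - c * Q + d * P = 0 := by rw [hPd, hQ, hR]; ring
    refine ⟨Q / (2 * P), n / P ^ 2, by positivity, a, b - Q / (2 * P) * a, ?_⟩
    have hP0 := hPR.ne'
    simp only [toR, par, Prod.mk.injEq]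
    push_cast
    refine ⟨trivial, by ring, ?_, ?_⟩
    · rw [hn4]
      field_simp
      linear_combination (16 * P) * s1
    · rw [hn4]
      field_simp
      linear_combination (32 * P ^ 2) * s2 + 32 * P * Q * s1
  · obtain ⟨r, hr⟩ := cubic_root a b c d haR
    have hcomp : toR (a, b, c, d) = par (1 : ℤ) (3 : ℤ) (1 : ℤ) a (-a * (r + (b + a * r) / (2 * a)))
        ((b + a * r) / (2 * a)) ((c + r * (b + a * r)) / a - ((b + a * r) / (2 * a)) ^ 2) := by
      simp only [toR, par, Prod.mk.injEq]
      push_cast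
      refine ⟨trivial, by field_simp; ring, by field_simp; ring, ?_⟩
      have : (d : ℝ) = -(a * r ^ 3 + b * r ^ 2 + c * r) := by linarith
      rw [this]; field_simp; ring
    have hEc := Comp_EF h' _ _ _ _ _ hcomp
    refine ⟨_, _, ?_, _, _, hcomp⟩
    rw [hE] at hEc
    by_contra hs
    have hs' := not_lt.1 hs
    push_cast at hEc
    have := mul_nonpos_of_nonpos_of_nonneg hs' (sq_nonneg ((((c + r * (b + a * r)) / a - ((b + a * r) / (2 * a)) ^ 2) * a ^ 2 + (-a * (r + (b + a * r) / (2 * a))) ^ 2 : ℝ)))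
    linarith

theorem exists_red {κ σ ε : ℤ} (h : IsTy κ σ ε) (n : ℤ) (hn : 0 < n) (f : F4) (ha : f.1 ≠ 0)
    (hE : EF σ f = 4 * ε * σ ^ 3 * n) : ∃ g ∈ Red κ σ ε, Eqv κ σ f g := by
  obtain ⟨x, s, hf⟩ := exists_comp h n hn f ha hE
  exact red_of_comp h x s f hf

end MW

namespace MW

/-- the reduced forms of given discriminant -/
def NS (κ σ ε n : ℤ) : Set F4 := {f | f ∈ Red κ σ ε ∧ f.1 ≠ 0 ∧ EF σ f = 4 * ε * σ ^ 3 * n}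

theorem par_bounds {κ σ ε : ℤ} (h : IsTy κ σ ε) (a b0 x s α β : ℝ) (hx : |x| ≤ 1 / 2) (hs : 0 < s)
    (ha : |a| ≤ α) (hb : |b0| ≤ β) :
    |(par κ σ ε a b0 x s).1| ≤ α ∧ |(par κ σ ε a b0 x s).2.1| ≤ β + 3 / 2 * α ∧
    |(par κ σ ε a b0 x s).2.2.1| ≤ s * α + β + α ∧
    |(par κ σ ε a b0 x s).2.2.2| ≤ s * β + 2 * s * α + β + α := by
  have hα : 0 ≤ α := (abs_nonneg a).trans ha
  have hβ : 0 ≤ β := (abs_nonneg b0).trans hb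
  have hx2 : |x ^ 2| ≤ 1 / 4 := by rw [abs_pow]; nlinarith [abs_nonneg x]
  have hx3 : |x ^ 3| ≤ 1 / 8 := by
    rw [abs_pow]
    calc |x| ^ 3 ≤ (1 / 2) ^ 3 := by gcongr
    _ = 1 / 8 := by norm_num
  have e1 : |x * a| ≤ 1 / 2 * α := by rw [abs_mul]; gcongr
  have e2 : |s * a| ≤ s * α := by rw [abs_mul, abs_of_pos hs]; gcongr
  have e3 : |x * b0| ≤ 1 / 2 * β := by rw [abs_mul]; gcongr
  have e4 : |x ^ 2 * a| ≤ 1 / 4 * α := by rw [abs_mul]; gcongr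
  have e5 : |s * b0| ≤ s * β := by rw [abs_mul, abs_of_pos hs]; gcongr
  have e6 : |x * (s * a)| ≤ 1 / 2 * (s * α) := by rw [abs_mul]; gcongr
  have e7 : |x ^ 2 * b0| ≤ 1 / 4 * β := by rw [abs_mul]; gcongr
  have e8 : |x ^ 3 * a| ≤ 1 / 8 * α := by rw [abs_mul]; gcongr
  have hsα : 0 ≤ s * α := by positivity
  have hsβ : 0 ≤ s * β := by positivity
  rw [abs_le] at *
  rcases h with ⟨rfl, rfl, rfl⟩ | ⟨rfl, rfl, rfl⟩ <;> simp only [par, abs_le] <;> push_cast <;>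
    refine ⟨?_, ?_, ?_, ?_⟩ <;> constructor <;> linarith

theorem finite_box (B : ℤ) : {f : F4 | |f.1| ≤ B ∧ |f.2.1| ≤ B ∧ |f.2.2.1| ≤ B ∧ |f.2.2.2| ≤ B}.Finite := by
  refine ((Set.finite_Icc (-B) B).prod ((Set.finite_Icc (-B) B).prod
    ((Set.finite_Icc (-B) B).prod (Set.finite_Icc (-B) B)))).subset ?_
  rintro ⟨a, b, c, d⟩ ⟨h1, h2, h3, h4⟩
  exact ⟨abs_le.1 h1, abs_le.1 h2, abs_le.1 h3, abs_le.1 h4⟩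

theorem NS_box {κ σ ε : ℤ} (h : IsTy κ σ ε) (n : ℤ) (hn : 0 < n) (f : F4) (hf : f ∈ NS κ σ ε n) :
    |f.1| ≤ 100 * n ^ 2 ∧ |f.2.1| ≤ 100 * n ^ 2 ∧ |f.2.2.1| ≤ 100 * n ^ 2 ∧ |f.2.2.2| ≤ 100 * n ^ 2 := by
  obtain ⟨⟨x, s, hx, hs, h0, a, b0, hf⟩, hne, hE⟩ := hf
  have hc := Comp_EF h f a b0 x s hf
  have hn1 : (1 : ℝ) ≤ n := by exact_mod_cast hn
  have hsn : s * (s * a ^ 2 + b0 ^ 2) ^ 2 = n := by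
    rw [hE] at hc
    rcases h with ⟨rfl, rfl, rfl⟩ | ⟨rfl, rfl, rfl⟩ <;> push_cast at hc <;> linarith
  have hx2 : x ^ 2 ≤ 1 / 4 := by rw [← sq_abs]; nlinarith [abs_nonneg x]
  have hs34 : 3 / 4 ≤ s := by linarith
  have ha1 : 1 ≤ a ^ 2 := by
    have : a = f.1 := by have := congrArg Prod.fst hf; simpa [toR, par] using this.symm
    rw [this]
    have h2 : 1 ≤ f.1 ^ 2 := by
      have := sq_nonneg f.1
      rcases lt_or_gt_of_ne hne with h | h <;> nlinarith
    exact_mod_cast h2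
  obtain ⟨w, hw⟩ : ∃ w, w = s * a ^ 2 + b0 ^ 2 := ⟨_, rfl⟩
  have hws : s ≤ w := by rw [hw]; nlinarith [sq_nonneg b0]
  rw [← hw] at hsn
  have hw2 : w ≤ 2 * n := by
    by_contra hcon
    have h1 : 2 * (n : ℝ) < w := not_le.1 hcon
    have h2 : w * (2 * n) ≤ w ^ 2 := by nlinarith
    have h3 : 3 / 4 * w ^ 2 ≤ s * w ^ 2 := by nlinarith [sq_nonneg w]
    nlinarith
  have hs2 : s ≤ 2 * n := hws.trans hw2
  have ha : |a| ≤ 3 * n := by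
    apply abs_le_of_sq_le_sq _ (by linarith)
    have : 3 / 4 * a ^ 2 ≤ w := by rw [hw]; nlinarith [sq_nonneg b0, sq_nonneg a]
    nlinarith
  have hb : |b0| ≤ 2 * n := by
    apply abs_le_of_sq_le_sq _ (by linarith)
    have : b0 ^ 2 ≤ w := by rw [hw]; nlinarith [sq_nonneg b0, sq_nonneg a]
    nlinarith
  obtain ⟨b1, b2, b3, b4⟩ := par_bounds h a b0 x s _ _ hx h0 ha hb
  rw [← hf] at b1 b2 b3 b4
  have hsn2 : s * n ≤ 2 * n ^ 2 := by nlinarith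
  have hnn : (n : ℝ) ≤ n ^ 2 := by nlinarith
  have cast : ∀ m : ℤ, |(m : ℝ)| ≤ 100 * n ^ 2 → |m| ≤ 100 * n ^ 2 := by
    intro m hm; exact_mod_cast hm
  refine ⟨cast _ (b1.trans ?_), cast _ (b2.trans ?_), cast _ (b3.trans ?_), cast _ (b4.trans ?_)⟩ <;>
    nlinarith

theorem NS_finite {κ σ ε : ℤ} (h : IsTy κ σ ε) (n : ℤ) (hn : 0 < n) : (NS κ σ ε n).Finite :=
  (finite_box (100 * n ^ 2)).subset fun f hf => NS_box h n hn f hf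

theorem ty1 : IsTy 3 1 (-1) := Or.inl ⟨rfl, rfl, rfl⟩
theorem ty2 : IsTy 1 3 1 := Or.inr ⟨rfl, rfl, rfl⟩

theorem rank_le (A D : ℤ) (hA : 0 < A) (hD : 0 < D) (hDs : Squarefree D)
    (hD3 : IsCoprime D 3) (hAD : (A * D ^ 3) % 9 = 1 ∨ (A * D ^ 3) % 9 = 7) :
    4 * mordellRank (-(A * D ^ 3)) ≤ (NS 3 1 (-1) (A * D)).ncard + (NS 1 3 1 (A * D)).ncard := by
  obtain ⟨k, hk⟩ : ∃ k, k = -(A * D ^ 3) := ⟨_, rfl⟩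
  obtain ⟨k', hk'⟩ : ∃ k', k' = 27 * (A * D ^ 3) := ⟨_, rfl⟩
  have hpos : 0 < A * D ^ 3 := by positivity
  have hnn : 0 < A * D := by positivity
  have hk0 : k ≠ 0 := by omega
  have hk0' : k' ≠ 0 := by omega
  have hns : ∀ y : ℚ, y ^ 2 ≠ k := by
    intro y hy
    have h1 := sq_nonneg y
    rw [hy] at h1
    have : 0 ≤ k := by exact_mod_cast h1
    omega
  have hns' : ∀ y : ℚ, y ^ 2 ≠ k' := by
    intro y hy
    obtain ⟨m, rfl⟩ := rat_int_of_sq y k' hy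
    have h1 : m ^ 2 = 27 * (A * D ^ 3) := by rw [← hk']; exact_mod_cast hy
    have hp : Prime (3 : ℤ) := Int.prime_three
    obtain ⟨m1, rfl⟩ := hp.dvd_of_dvd_pow (n := 2) (a := m) ⟨9 * (A * D ^ 3), by rw [h1]; ring⟩
    have h2 : m1 ^ 2 = 3 * (A * D ^ 3) := by linarith
    obtain ⟨m2, rfl⟩ := hp.dvd_of_dvd_pow (n := 2) (a := m1) ⟨_, h2⟩
    have h3 : 3 * m2 ^ 2 = A * D ^ 3 := by linarith
    omega
  have hkk : (k' : ℚ) * ((1 : ℤ) : ℚ) ^ 6 = -27 * k := by rw [hk, hk']; push_cast; ring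
  have hkk' : (k : ℚ) * ((3 : ℤ) : ℚ) ^ 6 = -27 * k' := by rw [hk, hk']; push_cast; ring
  have b1 := index_bound ty1.isType k k' ((3 : ℤ) : ℚ) (by norm_num) hkk' hns' hns hk0 D
    (4 * (-1) * 1 ^ 3 * (A * D)) hD.ne' (by rw [hk]; ring) (by
      intro u v t ht hco huv
      obtain ⟨b, c, d, h1, h2⟩ := form1 A D u v t hA.ne' hDs ht hco (by rw [huv, hk]; ring)
      refine ⟨b, c, d, ?_, ?_⟩
      · simp only [GF]; linarith
      · simp only [EF]; linarith) (Red 3 1 (-1)) (Red_neg _ _ _)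
    (fun f hf hE => exists_red ty1 (A * D) hnn f hf hE) (NS_finite ty1 _ hnn)
  have b2 := index_bound ty2.isType k' k ((1 : ℤ) : ℚ) (by norm_num) hkk hns hns' hk0' D
    (4 * 1 * 3 ^ 3 * (A * D)) hD.ne' (by rw [hk']; ring) (by
      intro u v t ht hco huv
      obtain ⟨b, c, d, h1, h2⟩ := form3 A D u v t hA.ne' hDs ht hco hD3 hAD (by rw [huv, hk']; ring)
      refine ⟨b, c, d, ?_, ?_⟩
      · simp only [GF]; linarith
      · simp only [EF]; linarith) (Red 1 3 1) (Red_neg _ _ _)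
    (fun f hf hE => exists_red ty2 (A * D) hnn f hf hE) (NS_finite ty2 _ hnn)
  have := rank_bound k k' 1 3 (by norm_num) hkk hns hk0' (by norm_num) hkk' hns' hk0 (by norm_num) b1.1 b2.1
  have c1 := b1.2
  have c2 := b2.2
  rw [← hk]
  change _ ≤ (NS 3 1 (-1) (A * D)).ncard + 2 at c1
  change _ ≤ (NS 1 3 1 (A * D)).ncard + 2 at c2
  omega

end MW

namespace MW

open MeasureTheory

/-- the radial integral -/
theorem radial (s : ℝ) (hs : 0 < s) :
    ∫⁻ r in Set.Ioi (0:ℝ), ENNReal.ofReal r * (if s * (r ^ 2) ^ 2 ≤ 1 then ENNReal.ofReal (2 * r ^ 2) else 0)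
      ≤ ENNReal.ofReal (1 / (2 * s)) := by
  obtain ⟨R, hR0, hR⟩ : ∃ R : ℝ, 0 ≤ R ∧ R ^ 4 = 1 / s := by
    refine ⟨Real.sqrt (Real.sqrt (1 / s)), Real.sqrt_nonneg _, ?_⟩
    have h1 := Real.sq_sqrt (Real.sqrt_nonneg (1 / s))
    have h2 := Real.sq_sqrt (show (0:ℝ) ≤ 1 / s by positivity)
    calc (Real.sqrt (Real.sqrt (1 / s))) ^ 4 = ((Real.sqrt (Real.sqrt (1 / s))) ^ 2) ^ 2 := by ring
      _ = 1 / s := by rw [h1, h2]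
  have hle : ∀ r ∈ Set.Ioi (0:ℝ), ENNReal.ofReal r * (if s * (r ^ 2) ^ 2 ≤ 1 then ENNReal.ofReal (2 * r ^ 2) else 0)
      ≤ (Set.Ioc 0 R).indicator (fun r => ENNReal.ofReal (2 * r ^ 3)) r := by
    intro r hr
    have hr' : 0 < r := hr
    split_ifs with h
    · have : r ≤ R := by
        have : r ^ 4 ≤ R ^ 4 := by
          rw [hR, le_div_iff₀ hs]; nlinarith
        exact le_of_pow_le_pow_left₀ (by norm_num) hR0 this
      rw [Set.indicator_of_mem (show r ∈ Set.Ioc 0 R from ⟨hr', this⟩), ← ENNReal.ofReal_mul hr'.le]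
      apply ENNReal.ofReal_le_ofReal
      apply le_of_eq; ring
    · simp
  calc _ ≤ ∫⁻ r in Set.Ioi (0:ℝ), (Set.Ioc 0 R).indicator (fun r => ENNReal.ofReal (2 * r ^ 3)) r :=
        setLIntegral_mono' measurableSet_Ioi hle
    _ ≤ ∫⁻ r, (Set.Ioc 0 R).indicator (fun r => ENNReal.ofReal (2 * r ^ 3)) r := setLIntegral_le_lintegral _ _
    _ = ∫⁻ r in Set.Ioc 0 R, ENNReal.ofReal (2 * r ^ 3) := lintegral_indicator measurableSet_Ioc _
    _ = ENNReal.ofReal (∫ r in Set.Ioc 0 R, 2 * r ^ 3) := by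
        rw [ofReal_integral_eq_lintegral_ofReal]
        · exact (Continuous.integrableOn_Icc (by fun_prop)).mono_set Set.Ioc_subset_Icc_self
        · filter_upwards [ae_restrict_mem measurableSet_Ioc] with r hr
          have : 0 < r := hr.1
          positivity
    _ = ENNReal.ofReal (1 / (2 * s)) := by
        congr 1
        rw [← intervalIntegral.integral_of_le hR0, intervalIntegral.integral_const_mul, integral_pow]
        norm_num
        rw [hR]; field_simp; norm_num

/-- integrals of functions of the quadratic form -/
theorem inner_int (s y : ℝ) (hs : 0 < s) :
    ∫⁻ p : ℝ × ℝ, (if s * (s * p.1 ^ 2 + (p.2 - y * p.1) ^ 2) ^ 2 ≤ 1 then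
        ENNReal.ofReal (2 * (s * p.1 ^ 2 + (p.2 - y * p.1) ^ 2)) else 0)
      ≤ ENNReal.ofReal (Real.pi * (s * Real.sqrt s)⁻¹) := by
  obtain ⟨G, hG⟩ : ∃ G : ℝ → ENNReal, G = fun w => if s * w ^ 2 ≤ 1 then ENNReal.ofReal (2 * w) else 0 := ⟨_, rfl⟩
  have hGm : Measurable G := by
    rw [hG]
    refine Measurable.ite (measurableSet_le (by fun_prop) (by fun_prop)) (by fun_prop) (by fun_prop)
  have e0 : ∀ w, (if s * w ^ 2 ≤ 1 then ENNReal.ofReal (2 * w) else 0) = G w := by intro w; rw [hG]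
  simp_rw [e0]
  have hs' : 0 < Real.sqrt s := Real.sqrt_pos.2 hs
  have e1 : ∫⁻ p : ℝ × ℝ, G (s * p.1 ^ 2 + (p.2 - y * p.1) ^ 2)
      = ∫⁻ a : ℝ, ∫⁻ b : ℝ, G ((Real.sqrt s * a) ^ 2 + b ^ 2) := by
    rw [Measure.volume_eq_prod, lintegral_prod _ (by fun_prop)]
    refine lintegral_congr fun a => ?_
    rw [← lintegral_sub_right_eq_self (fun b => G ((Real.sqrt s * a) ^ 2 + b ^ 2)) (y * a)]
    refine lintegral_congr fun b => ?_
    rw [mul_pow, Real.sq_sqrt hs.le]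
  have e2 : ∫⁻ a : ℝ, ∫⁻ b : ℝ, G ((Real.sqrt s * a) ^ 2 + b ^ 2)
      = ENNReal.ofReal (Real.sqrt s)⁻¹ * ∫⁻ a : ℝ, ∫⁻ b : ℝ, G (a ^ 2 + b ^ 2) := by
    have hm : Measurable (fun a : ℝ => ∫⁻ b : ℝ, G (a ^ 2 + b ^ 2)) := by
      exact Measurable.lintegral_prod_right' (f := fun p : ℝ × ℝ => G (p.1 ^ 2 + p.2 ^ 2)) (by fun_prop)
    have := lintegral_map (μ := volume) hm (measurable_const_mul (Real.sqrt s))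
    rw [← this, Real.map_volume_mul_left hs'.ne', lintegral_smul_measure, abs_of_pos (by positivity)]
    rfl
  have e3 : ∫⁻ a : ℝ, ∫⁻ b : ℝ, G (a ^ 2 + b ^ 2) ≤ ENNReal.ofReal (Real.pi / s) := by
    rw [← lintegral_prod (fun p : ℝ × ℝ => G (p.1 ^ 2 + p.2 ^ 2)) (by fun_prop), ← Measure.volume_eq_prod,
      ← lintegral_comp_polarCoord_symm]
    have e4 : ∀ p : ℝ × ℝ, ENNReal.ofReal p.1 • G ((polarCoord.symm p).1 ^ 2 + (polarCoord.symm p).2 ^ 2)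
        = ENNReal.ofReal p.1 * G (p.1 ^ 2) := by
      intro p
      rw [smul_eq_mul, polarCoord_symm_apply]
      congr 2
      have := Real.cos_sq_add_sin_sq p.2
      simp only
      linear_combination p.1 ^ 2 * this
    simp_rw [e4]
    rw [polarCoord_target, Measure.volume_eq_prod, ← Measure.prod_restrict,
      lintegral_prod _ (by fun_prop)]
    simp only [lintegral_const, Measure.restrict_apply_univ, Real.volume_Ioo]
    rw [lintegral_mul_const _ (by fun_prop)]
    have := radial s hs
    simp_rw [e0] at this
    calc _ ≤ ENNReal.ofReal (1 / (2 * s)) * ENNReal.ofReal (Real.pi - -Real.pi) := by gcongr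
      _ = ENNReal.ofReal (Real.pi / s) := by
        rw [← ENNReal.ofReal_mul (by positivity)]
        congr 1; field_simp; ring
  rw [e1, e2]
  calc _ ≤ ENNReal.ofReal (Real.sqrt s)⁻¹ * ENNReal.ofReal (Real.pi / s) := by gcongr
    _ = _ := by
      rw [← ENNReal.ofReal_mul (by positivity)]
      congr 1; field_simp

/-- the integral over the fundamental domain -/
theorem outer_int :
    ∫⁻ p : ℝ × ℝ, (if |p.1| ≤ 1 / 2 ∧ 1 ≤ p.1 ^ 2 + p.2 then
      ENNReal.ofReal (Real.pi * (p.2 * Real.sqrt p.2)⁻¹) else 0) ≤ ENNReal.ofReal (2 * Real.pi ^ 2 / 3) := by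
  have hm : Measurable (fun p : ℝ × ℝ => (if |p.1| ≤ 1 / 2 ∧ 1 ≤ p.1 ^ 2 + p.2 then
      ENNReal.ofReal (Real.pi * (p.2 * Real.sqrt p.2)⁻¹) else 0)) := by
    refine Measurable.ite ?_ (by fun_prop) (by fun_prop)
    have m1 : MeasurableSet {p : ℝ × ℝ | |p.1| ≤ 1 / 2} := measurableSet_le (by fun_prop) (by fun_prop)
    have m2 : MeasurableSet {p : ℝ × ℝ | 1 ≤ p.1 ^ 2 + p.2} := measurableSet_le (by fun_prop) (by fun_prop)
    exact m1.inter m2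
  rw [Measure.volume_eq_prod, lintegral_prod _ hm.aemeasurable]
  have h1 : ∀ x : ℝ, ∫⁻ s : ℝ, (if |x| ≤ 1 / 2 ∧ 1 ≤ x ^ 2 + s then
      ENNReal.ofReal (Real.pi * (s * Real.sqrt s)⁻¹) else 0) ≤
      (Set.Icc (-(1/2)) (1/2 : ℝ)).indicator (fun x => ENNReal.ofReal (2 * Real.pi * (1 / Real.sqrt (1 - x ^ 2)))) x := by
    intro x
    by_cases hx : |x| ≤ 1 / 2
    · have hx2 : x ∈ Set.Icc (-(1/2)) (1/2 : ℝ) := abs_le.1 hx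
      have hc : 0 < 1 - x ^ 2 := by nlinarith [hx2.1, hx2.2]
      rw [Set.indicator_of_mem hx2]
      calc _ = ∫⁻ s : ℝ, (Set.Ici (1 - x ^ 2)).indicator (fun s => ENNReal.ofReal (Real.pi * (s * Real.sqrt s)⁻¹)) s := by
            refine lintegral_congr fun s => ?_
            by_cases hs : 1 ≤ x ^ 2 + s
            · rw [Set.indicator_of_mem (show s ∈ Set.Ici _ by simp; linarith), if_pos ⟨hx, hs⟩]
            · rw [Set.indicator_of_notMem (show s ∉ Set.Ici _ by simp; linarith), if_neg (by tauto)]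
        _ = ∫⁻ s in Set.Ioi (1 - x ^ 2), ENNReal.ofReal (Real.pi * s ^ (-(3/2) : ℝ)) := by
            rw [lintegral_indicator measurableSet_Ici, setLIntegral_congr Ioi_ae_eq_Ici.symm]
            refine setLIntegral_congr_fun measurableSet_Ioi fun s hs => ?_
            have hs0 : 0 < s := hc.trans hs
            congr 2
            rw [Real.sqrt_eq_rpow, Real.rpow_neg hs0.le]
            congr 1
            nth_rewrite 1 [← Real.rpow_one s]
            rw [← Real.rpow_add hs0]; norm_num
        _ = ENNReal.ofReal (∫ s in Set.Ioi (1 - x ^ 2), Real.pi * s ^ (-(3/2) : ℝ)) := by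
            rw [ofReal_integral_eq_lintegral_ofReal]
            · exact (integrableOn_Ioi_rpow_of_lt (by norm_num) hc).const_mul _
            · filter_upwards [ae_restrict_mem measurableSet_Ioi] with s hs
              have : 0 < s := hc.trans hs
              have := Real.pi_pos
              positivity
        _ ≤ _ := by
            apply ENNReal.ofReal_le_ofReal
            rw [integral_const_mul, integral_Ioi_rpow_of_lt (by norm_num) hc]
            have : (1 - x ^ 2) ^ (-(3/2) + 1 : ℝ) = 1 / Real.sqrt (1 - x ^ 2) := by
              rw [Real.sqrt_eq_rpow, one_div, ← Real.rpow_neg hc.le]; norm_num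
            rw [this]
            apply le_of_eq; ring
    · rw [Set.indicator_of_notMem (by rwa [Set.mem_Icc, ← abs_le])]
      simp only [hx, false_and, if_false, lintegral_zero, le_refl]
  refine (lintegral_mono h1).trans ?_
  rw [lintegral_indicator measurableSet_Icc]
  have hd : ∀ x ∈ Set.uIcc (-(1/2)) (1/2 : ℝ), HasDerivAt Real.arcsin (1 / Real.sqrt (1 - x ^ 2)) x := by
    intro x hx
    rw [Set.uIcc_of_le (by norm_num)] at hx
    exact Real.hasDerivAt_arcsin (by linarith [hx.1]) (by linarith [hx.2])
  have hcont : ContinuousOn (fun x : ℝ => 1 / Real.sqrt (1 - x ^ 2)) (Set.Icc (-(1/2)) (1/2 : ℝ)) := by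
    refine ContinuousOn.div (by fun_prop) (by fun_prop) ?_
    intro x hx
    have : 0 < 1 - x ^ 2 := by nlinarith [hx.1, hx.2]
    positivity
  have hIn1 : IntervalIntegrable (fun x : ℝ => 1 / Real.sqrt (1 - x ^ 2)) volume (-(1/2)) (1/2) := by
    apply ContinuousOn.intervalIntegrable
    rwa [Set.uIcc_of_le (by norm_num)]
  have key := intervalIntegral.integral_eq_sub_of_hasDerivAt hd hIn1
  have has : Real.arcsin (1/2) = Real.pi / 6 := by
    rw [Real.arcsin_eq_iff_eq_sin ⟨by linarith [Real.pi_pos], by linarith [Real.pi_pos]⟩, Real.sin_pi_div_six]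
  rw [Real.arcsin_neg, has] at key
  rw [← ofReal_integral_eq_lintegral_ofReal]
  · apply ENNReal.ofReal_le_ofReal
    rw [integral_const_mul, integral_Icc_eq_integral_Ioc, ← intervalIntegral.integral_of_le (by norm_num), key]
    apply le_of_eq; ring
  · exact (hcont.integrableOn_Icc).const_mul _
  · filter_upwards with x
    have := Real.pi_pos
    positivity

end MW

namespace MW

open MeasureTheory

/-- the second half of the coordinates of a form, given `(a, b)` and `(x, s)` -/
def phr (κ σ ε : ℝ) (p q : ℝ × ℝ) : ℝ × ℝ :=
  (ε * q.2 * p.1 + 2 * q.1 * p.2 - σ * q.1 ^ 2 * p.1,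
    ε * q.2 * p.2 + (κ - σ) * ε * q.1 * q.2 * p.1 + κ * q.1 ^ 2 * p.2 - 2 * q.1 ^ 3 * p.1)

def qf (σ : ℝ) (p q : ℝ × ℝ) : ℝ := q.2 * p.1 ^ 2 + (p.2 - σ * q.1 * p.1) ^ 2

def Wset (σ T : ℝ) : Set ((ℝ × ℝ) × (ℝ × ℝ)) :=
  {v | |v.2.1| ≤ 1 / 2 ∧ 1 ≤ v.2.1 ^ 2 + v.2.2 ∧ v.2.2 ≤ T ∧ v.2.2 * (qf σ v.1 v.2) ^ 2 ≤ 1}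

def Kset (κ σ ε T : ℝ) : Set ((ℝ × ℝ) × (ℝ × ℝ)) :=
  (fun v : (ℝ × ℝ) × (ℝ × ℝ) => (v.1, phr κ σ ε v.1 v.2)) '' Wset σ T

theorem Wset_closed (σ T : ℝ) : IsClosed (Wset σ T) := by
  have m1 : IsClosed {v : (ℝ × ℝ) × (ℝ × ℝ) | |v.2.1| ≤ 1 / 2} := isClosed_le (by fun_prop) (by fun_prop)
  have m2 : IsClosed {v : (ℝ × ℝ) × (ℝ × ℝ) | 1 ≤ v.2.1 ^ 2 + v.2.2} := isClosed_le (by fun_prop) (by fun_prop)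
  have m3 : IsClosed {v : (ℝ × ℝ) × (ℝ × ℝ) | v.2.2 ≤ T} := isClosed_le (by fun_prop) (by fun_prop)
  have m4 : IsClosed {v : (ℝ × ℝ) × (ℝ × ℝ) | v.2.2 * (qf σ v.1 v.2) ^ 2 ≤ 1} :=
    isClosed_le (by unfold qf; fun_prop) (by fun_prop)
  exact m1.inter (m2.inter (m3.inter m4))

theorem Wset_compact (σ T : ℝ) : IsCompact (Wset σ T) := by
  refine IsCompact.of_isClosed_subset
    (isCompact_Icc (a := ((-2, -(2 + |σ|)), (-1, 0))) (b := ((2, 2 + |σ|), (1, T)))) (Wset_closed σ T) ?_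
  rintro ⟨⟨a, b⟩, ⟨x, s⟩⟩ ⟨hx, hs, hT, hq⟩
  simp only [qf] at hx hs hT hq
  have hx' := abs_le.1 hx
  have hs3 : 3 / 4 ≤ s := by nlinarith
  have hw : s * a ^ 2 + (b - σ * x * a) ^ 2 ≤ 2 := by
    by_contra hc
    push Not at hc
    nlinarith
  have ha : |a| ≤ 2 := by
    apply abs_le_of_sq_le_sq _ (by norm_num)
    nlinarith [sq_nonneg (b - σ * x * a), sq_nonneg a]
  have hb : |b - σ * x * a| ≤ 2 := by
    apply abs_le_of_sq_le_sq _ (by norm_num)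
    nlinarith [sq_nonneg a]
  have hsx : |σ * x * a| ≤ |σ| := by
    rw [abs_mul, abs_mul]
    have : |x| * |a| ≤ 1 := by nlinarith [abs_nonneg x, abs_nonneg a]
    nlinarith [abs_nonneg σ]
  have hb' : |b| ≤ 2 + |σ| := by
    have := abs_add_le (b - σ * x * a) (σ * x * a)
    rw [sub_add_cancel] at this
    linarith
  have ha' := abs_le.1 ha
  have hb'' := abs_le.1 hb'
  simp only [Set.mem_Icc, Prod.mk_le_mk]
  refine ⟨⟨⟨ha'.1, hb''.1⟩, by linarith, by linarith⟩, ⟨ha'.2, hb''.2⟩, by linarith, by linarith⟩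

theorem Kset_compact (κ σ ε T : ℝ) : IsCompact (Kset κ σ ε T) := by
  apply (Wset_compact σ T).image
  unfold phr
  fun_prop

noncomputable def phr' (κ σ ε : ℝ) (p q : ℝ × ℝ) : ℝ × ℝ →L[ℝ] ℝ × ℝ :=
  (Matrix.toLin (.finTwoProd ℝ) (.finTwoProd ℝ)
    !![2 * p.2 - 2 * σ * q.1 * p.1, ε * p.1;
      (κ - σ) * ε * q.2 * p.1 + 2 * κ * q.1 * p.2 - 6 * q.1 ^ 2 * p.1,
      ε * p.2 + (κ - σ) * ε * q.1 * p.1]).toContinuousLinearMap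

theorem phr_deriv (κ σ ε : ℝ) (p q : ℝ × ℝ) : HasFDerivAt (phr κ σ ε p) (phr' κ σ ε p q) q := by
  unfold phr'
  rw [Matrix.toLin_finTwoProd_toContinuousLinearMap]
  have h1 : HasFDerivAt (fun q : ℝ × ℝ => q.1) (ContinuousLinearMap.fst ℝ ℝ ℝ) q := hasFDerivAt_fst
  have h2 : HasFDerivAt (fun q : ℝ × ℝ => q.2) (ContinuousLinearMap.snd ℝ ℝ ℝ) q := hasFDerivAt_snd
  have c : HasFDerivAt (fun q : ℝ × ℝ => ε * q.2 * p.1 + 2 * q.1 * p.2 - σ * q.1 ^ 2 * p.1)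
    ((2 * p.2 - 2 * σ * q.1 * p.1) • ContinuousLinearMap.fst ℝ ℝ ℝ + (ε * p.1) • ContinuousLinearMap.snd ℝ ℝ ℝ) q := by
    refine ((((h2.const_mul ε).mul_const p.1).add ((h1.const_mul 2).mul_const p.2)).sub
      (((h1.pow 2).const_mul σ).mul_const p.1)).congr_fderiv ?_
    ext <;> simp <;> ring
  have d : HasFDerivAt (fun q : ℝ × ℝ => ε * q.2 * p.2 + (κ - σ) * ε * q.1 * q.2 * p.1 + κ * q.1 ^ 2 * p.2 - 2 * q.1 ^ 3 * p.1)
    (((κ - σ) * ε * q.2 * p.1 + 2 * κ * q.1 * p.2 - 6 * q.1 ^ 2 * p.1) • ContinuousLinearMap.fst ℝ ℝ ℝ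
      + (ε * p.2 + (κ - σ) * ε * q.1 * p.1) • ContinuousLinearMap.snd ℝ ℝ ℝ) q := by
    refine (((((h2.const_mul ε).mul_const p.2).add (((h1.const_mul ((κ - σ) * ε)).mul h2).mul_const p.1)).add
      (((h1.pow 2).const_mul κ).mul_const p.2)).sub
      (((h1.pow 3).const_mul 2).mul_const p.1)).congr_fderiv ?_
    ext <;> simp <;> ring
  exact c.prodMk d

theorem phr_det {κ σ ε : ℤ} (h : IsTy κ σ ε) (p q : ℝ × ℝ) (hq : 0 ≤ q.2) :
    |(phr' κ σ ε p q).det| = 2 * qf σ p q := by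
  have hn : 0 ≤ 2 * qf σ p q := by unfold qf; positivity
  unfold phr'
  simp only [LinearMap.det_toContinuousLinearMap, LinearMap.det_toLin, Matrix.det_fin_two_of]
  rw [← abs_of_nonneg hn]
  rcases h with ⟨rfl, rfl, rfl⟩ | ⟨rfl, rfl, rfl⟩
  · rw [← abs_neg]
    congr 1; unfold qf; push_cast; ring
  · congr 1; unfold qf; push_cast; ring

theorem vol_K {κ σ ε : ℤ} (h : IsTy κ σ ε) (T : ℝ) :
    volume (Kset κ σ ε T) ≤ ENNReal.ofReal (2 * Real.pi ^ 2 / 3) := by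
  have hKm : MeasurableSet (Kset κ σ ε T) := (Kset_compact _ _ _ _).isClosed.measurableSet
  have hWm : MeasurableSet (Wset σ T) := (Wset_closed _ _).measurableSet
  rw [Measure.volume_eq_prod, Measure.prod_apply hKm]
  obtain ⟨g, hg⟩ : ∃ g : (ℝ × ℝ) × (ℝ × ℝ) → ENNReal,
      g = (Wset σ T).indicator (fun v => ENNReal.ofReal (2 * qf σ v.1 v.2)) := ⟨_, rfl⟩
  have hgm : Measurable g := by
    rw [hg]
    refine Measurable.indicator ?_ hWm
    unfold qf; fun_prop
  have s1 : ∀ p : ℝ × ℝ, volume (Prod.mk p ⁻¹' Kset κ σ ε T) ≤ ∫⁻ q, g (p, q) := by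
    intro p
    have hWp : MeasurableSet (Prod.mk p ⁻¹' Wset σ T) := measurable_prodMk_left hWm
    have : Prod.mk p ⁻¹' Kset κ σ ε T = phr κ σ ε p '' (Prod.mk p ⁻¹' Wset σ T) := by
      ext q
      simp only [Set.mem_preimage, Kset, Set.mem_image, Prod.mk.injEq, Prod.exists]
      constructor
      · rintro ⟨a, b, c, d, h1, h2, h3⟩
        subst h2
        exact ⟨c, d, h1, h3⟩
      · rintro ⟨c, d, h1, h3⟩
        exact ⟨p.1, p.2, c, d, h1, rfl, h3⟩
    rw [this]
    refine (addHaar_image_le_lintegral_abs_det_fderiv volume hWp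
      (fun q hq => (phr_deriv κ σ ε p q).hasFDerivWithinAt)).trans ?_
    rw [← lintegral_indicator hWp]
    refine lintegral_mono fun q => ?_
    by_cases hq : q ∈ Prod.mk p ⁻¹' Wset σ T
    · rw [Set.indicator_of_mem hq, hg, Set.indicator_of_mem (show (p, q) ∈ Wset σ T from hq), phr_det h]
      obtain ⟨h1, h2, h3, h4⟩ := hq
      have := abs_le.1 h1
      simp only at this h2
      nlinarith
    · rw [Set.indicator_of_notMem hq]; exact zero_le
  refine (lintegral_mono s1).trans ?_
  rw [lintegral_lintegral_swap (by exact hgm.aemeasurable)]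
  refine le_trans (lintegral_mono fun q => ?_) outer_int
  split_ifs with hq
  · have hq' := abs_le.1 hq.1
    have hs : 0 < q.2 := by nlinarith [hq.2]
    refine le_trans (lintegral_mono fun p => ?_) (inner_int q.2 (σ * q.1) hs)
    rw [hg]
    by_cases hv : (p, q) ∈ Wset σ T
    · rw [Set.indicator_of_mem hv, if_pos (by have := hv.2.2.2; exact this)]
      exact le_refl _
    · rw [Set.indicator_of_notMem hv]; exact zero_le
  · rw [nonpos_iff_eq_zero, lintegral_eq_zero_iff (by fun_prop)]
    refine Eventually.of_forall fun p => ?_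
    have hv : (p, q) ∉ Wset σ T := fun hv => hq ⟨hv.1, hv.2.1⟩
    simp only [hg, Pi.zero_apply]
    exact Set.indicator_of_notMem hv _

end MW

namespace MW

open MeasureTheory

/-- reduction of a form mod `M` -/
def rM (M : ℕ) (f : F4) : ZMod M × ZMod M × ZMod M × ZMod M := (f.1, f.2.1, f.2.2.1, f.2.2.2)

def cube (M : ℕ) (l : ℝ) (f : F4) : Set ((ℝ × ℝ) × (ℝ × ℝ)) :=
  (Set.Ico (f.1 / l) ((f.1 + M) / l) ×ˢ Set.Ico (f.2.1 / l) ((f.2.1 + M) / l)) ×ˢ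
    (Set.Ico (f.2.2.1 / l) ((f.2.2.1 + M) / l) ×ˢ Set.Ico (f.2.2.2 / l) ((f.2.2.2 + M) / l))

theorem cube_vol (M : ℕ) (l : ℝ) (f : F4) (hl : 0 < l) :
    volume (cube M l f) = ENNReal.ofReal ((M / l) ^ 4) := by
  have h0 : (0:ℝ) ≤ M / l := by positivity
  have h1 : ∀ t : ℝ, (t + M) / l - t / l = M / l := by intro t; ring
  simp only [cube, Measure.volume_eq_prod, Measure.prod_prod, Real.volume_Ico, h1]
  rw [← ENNReal.ofReal_mul h0, ← ENNReal.ofReal_mul (by positivity)]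
  congr 1; ring

theorem cube_coord (M : ℕ) (l : ℝ) (hl : 0 < l) (a a' : ℤ) (h : ((a : ℤ) : ZMod M) = a') (t : ℝ)
    (h1 : t ∈ Set.Ico (a / l) ((a + M) / l)) (h2 : t ∈ Set.Ico (a' / l) ((a' + M) / l)) : a = a' := by
  rw [ZMod.intCast_eq_intCast_iff_dvd_sub] at h
  simp only [Set.mem_Ico, div_le_iff₀ hl, lt_div_iff₀ hl] at h1 h2
  have h3 : a < a' + M := by exact_mod_cast h1.1.trans_lt h2.2
  have h4 : a' < a + M := by exact_mod_cast h2.1.trans_lt h1.2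
  have := Int.eq_zero_of_abs_lt_dvd h (by rw [abs_lt]; constructor <;> linarith)
  linarith

theorem count_one (K : Set ((ℝ × ℝ) × (ℝ × ℝ))) (M : ℕ) (l : ℝ) (hl : 0 < l)
    (P : Finset F4) (r) (hr : ∀ f ∈ P, rM M f = r)
    (hK : ∀ f ∈ P, (((f.1 / l, f.2.1 / l), (f.2.2.1 / l, f.2.2.2 / l)) : (ℝ × ℝ) × (ℝ × ℝ)) ∈ K) :
    (P.card : ENNReal) * ENNReal.ofReal ((M / l) ^ 4) ≤ volume (Metric.cthickening (M / l) K) := by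
  have h0 : (0:ℝ) ≤ M / l := by positivity
  have hdis : (P : Set F4).PairwiseDisjoint (cube M l) := by
    rintro ⟨a, b, c, d⟩ hf ⟨a', b', c', d'⟩ hg hne
    rw [Function.onFun, Set.disjoint_left]
    rintro ⟨⟨t1, t2⟩, ⟨t3, t4⟩⟩ ⟨⟨h1, h2⟩, ⟨h3, h4⟩⟩ ⟨⟨g1, g2⟩, ⟨g3, g4⟩⟩
    have := (hr _ hf).trans (hr _ hg).symm
    simp only [rM, Prod.mk.injEq] at this
    apply hne
    rw [cube_coord M l hl a a' this.1 t1 h1 g1, cube_coord M l hl b b' this.2.1 t2 h2 g2,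
      cube_coord M l hl c c' this.2.2.1 t3 h3 g3, cube_coord M l hl d d' this.2.2.2 t4 h4 g4]
  have hmeas : ∀ f ∈ P, MeasurableSet (cube M l f) := fun f _ =>
    (measurableSet_Ico.prod measurableSet_Ico).prod (measurableSet_Ico.prod measurableSet_Ico)
  have hsum := measure_biUnion_finset (μ := volume) hdis hmeas
  simp only [cube_vol M l _ hl, Finset.sum_const, nsmul_eq_mul] at hsum
  rw [← hsum]
  apply measure_mono
  intro v hv
  simp only [Set.mem_iUnion] at hv
  obtain ⟨f, hf, hv⟩ := hv
  refine Metric.mem_cthickening_of_dist_le v _ _ _ (hK f hf) ?_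
  obtain ⟨⟨t1, t2⟩, ⟨t3, t4⟩⟩ := v
  obtain ⟨⟨h1, h2⟩, ⟨h3, h4⟩⟩ := hv
  have hc : ∀ (t : ℝ) (a : ℤ), t ∈ Set.Ico (a / l) ((a + M) / l) → dist t (a / l) ≤ M / l := by
    intro t a h
    have := h.2
    rw [add_div] at this
    rw [Real.dist_eq, abs_of_nonneg (by linarith [h.1])]
    linarith
  simp only [Prod.dist_eq, max_le_iff]
  exact ⟨⟨hc _ _ h1, hc _ _ h2⟩, hc _ _ h3, hc _ _ h4⟩

/-- reduced forms with bounded discriminant and cusp parameter in a given set -/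
def RZ (κ σ ε : ℤ) (I : Set ℝ) (Z : ℝ) : Set F4 :=
  {f | f.1 ≠ 0 ∧ ∃ x s a b0 : ℝ, |x| ≤ 1 / 2 ∧ 1 ≤ x ^ 2 + s ∧ s ∈ I ∧ toR f = par κ σ ε a b0 x s ∧
    s * (s * a ^ 2 + b0 ^ 2) ^ 2 ≤ Z}

theorem RZ_mem_K {κ σ ε : ℤ} (h : IsTy κ σ ε) (T l : ℝ) (hl : 0 < l) (f : F4) (hf : f ∈ RZ κ σ ε (Set.Iic T) (l ^ 4)) :
    (((f.1 / l, f.2.1 / l), (f.2.2.1 / l, f.2.2.2 / l)) : (ℝ × ℝ) × (ℝ × ℝ)) ∈ Kset κ σ ε T := by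
  obtain ⟨_, x, s, a, b0, hx, hs, hT, hf, hZ⟩ := hf
  obtain ⟨f1, f2, f3, f4⟩ := f
  simp only [toR, par, Prod.mk.injEq] at hf
  obtain ⟨e1, e2, e3, e4⟩ := hf
  refine ⟨((a / l, (b0 + σ * x * a) / l), (x, s)), ⟨hx, hs, hT, ?_⟩, ?_⟩
  · simp only [qf]
    have : s * (s * (a / l) ^ 2 + ((b0 + σ * x * a) / l - σ * x * (a / l)) ^ 2) ^ 2
        = s * (s * a ^ 2 + b0 ^ 2) ^ 2 / l ^ 4 := by
      field_simp; ring
    rw [this, div_le_one (by positivity)]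
    exact hZ
  · simp only [phr, Prod.mk.injEq, e1, e2, e3, e4, true_and]
    rcases h with ⟨rfl, rfl, rfl⟩ | ⟨rfl, rfl, rfl⟩
    all_goals
      push_cast
      constructor <;> field_simp <;> ring

theorem main_count {κ σ ε : ℤ} (h : IsTy κ σ ε) (T : ℝ) (M : ℕ) (hM : 0 < M)
    (S : Finset (ZMod M × ZMod M × ZMod M × ZMod M)) (δ : ℝ) (hδ : 0 < δ) :
    ∀ᶠ Z : ℝ in atTop, ∀ P : Finset F4, (∀ f ∈ P, f ∈ RZ κ σ ε (Set.Iic T) Z ∧ rM M f ∈ S) →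
      (P.card : ℝ) ≤ (S.card / M ^ 4 * (2 * Real.pi ^ 2 / 3) + δ) * Z := by
  classical
  have hlim : Tendsto (fun l : ℝ => volume (Metric.cthickening (M / l) (Kset κ σ ε T))) atTop
      (nhds (volume (Kset κ σ ε T))) :=
    (tendsto_measure_cthickening_of_isCompact (Kset_compact κ σ ε T)).comp
      (tendsto_const_nhds.div_atTop tendsto_id)
  have hM' : (0:ℝ) < M := by exact_mod_cast hM
  obtain ⟨η, hη, hη2⟩ : ∃ η : ℝ, 0 < η ∧ S.card / (M:ℝ) ^ 4 * η ≤ δ := by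
    refine ⟨δ / (S.card / (M:ℝ) ^ 4 + 1), by positivity, ?_⟩
    rw [mul_div_assoc', div_le_iff₀ (by positivity)]
    nlinarith
  have hlt : volume (Kset κ σ ε T) < ENNReal.ofReal (2 * Real.pi ^ 2 / 3 + η) := by
    refine (vol_K h T).trans_lt ?_
    rw [ENNReal.ofReal_lt_ofReal_iff (by positivity)]
    linarith
  have hev := hlim.eventually_lt_const hlt
  have hroot : Tendsto (fun Z : ℝ => Z ^ (1 / 4 : ℝ)) atTop atTop := tendsto_rpow_atTop (by norm_num)
  filter_upwards [hroot.eventually hev, eventually_gt_atTop 0] with Z hZ hZ0 P hP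
  obtain ⟨l, hl, hlZ⟩ : ∃ l : ℝ, l = Z ^ (1 / 4 : ℝ) ∧ l ^ 4 = Z := by
    refine ⟨_, rfl, ?_⟩
    rw [← Real.rpow_natCast, ← Real.rpow_mul hZ0.le]; norm_num
  have hl0 : 0 < l := by rw [hl]; positivity
  rw [← hl] at hZ
  have hone : ∀ r ∈ S, ((P.filter (fun f => rM M f = r)).card : ℝ) ≤ (l ^ 4 / M ^ 4) * (2 * Real.pi ^ 2 / 3 + η) := by
    intro r _
    have := count_one (Kset κ σ ε T) M l hl0 (P.filter (fun f => rM M f = r)) r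
      (fun f hf => (Finset.mem_filter.1 hf).2)
      (fun f hf => RZ_mem_K h T l hl0 f (by rw [hlZ]; exact (hP f (Finset.mem_filter.1 hf).1).1))
    have h2 := this.trans hZ.le
    rw [← ENNReal.ofReal_natCast, ← ENNReal.ofReal_mul (by positivity),
      ENNReal.ofReal_le_ofReal_iff (by positivity), div_pow] at h2
    rw [div_mul_eq_mul_div, le_div_iff₀ (by positivity)]
    rw [mul_div_assoc', div_le_iff₀ (by positivity)] at h2
    linarith
  have hcard : (P.card : ℝ) = ∑ r ∈ S, ((P.filter (fun f => rM M f = r)).card : ℝ) := by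
    rw [Finset.card_eq_sum_card_fiberwise (f := rM M) (t := S) (fun f hf => (hP f hf).2)]
    push_cast; rfl
  rw [hcard]
  refine (Finset.sum_le_sum hone).trans ?_
  rw [Finset.sum_const, nsmul_eq_mul, hlZ]
  calc _ = (S.card / (M:ℝ) ^ 4 * (2 * Real.pi ^ 2 / 3) + S.card / (M:ℝ) ^ 4 * η) * Z := by ring
    _ ≤ _ := by gcongr

end MW

namespace MW

theorem int_card (P : Finset ℤ) (m r : ℝ) (hr : 1 ≤ r) (h : ∀ d ∈ P, |(d:ℝ) - m| ≤ r) : (P.card : ℝ) ≤ 3 * r := by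
  have hsub : P ⊆ Finset.Icc ⌈m - r⌉ ⌊m + r⌋ := by
    intro d hd
    have := abs_le.1 (h d hd)
    rw [Finset.mem_Icc]
    exact ⟨Int.ceil_le.2 (by linarith), Int.le_floor.2 (by linarith)⟩
  have h1 := Finset.card_le_card hsub
  rw [Int.card_Icc] at h1
  have h2 : ((⌊m + r⌋ + 1 - ⌈m - r⌉).toNat : ℝ) ≤ 3 * r := by
    rcases le_total 0 (⌊m + r⌋ + 1 - ⌈m - r⌉) with h0 | h0
    · have : (((⌊m + r⌋ + 1 - ⌈m - r⌉).toNat : ℤ) : ℝ) = ((⌊m + r⌋ + 1 - ⌈m - r⌉ : ℤ) : ℝ) := by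
        rw [Int.toNat_of_nonneg h0]
      rw [Int.cast_natCast] at this
      rw [this]; push_cast
      linarith [Int.floor_le (m + r), Int.le_ceil (m - r)]
    · rw [Int.toNat_of_nonpos h0]; push_cast; linarith
  exact le_trans (by exact_mod_cast h1) h2

theorem fib {α β : Type*} [DecidableEq β] (P : Finset α) (g : α → β) (k N : ℝ) (hk : 0 ≤ k)
    (h : ∀ y ∈ P.image g, ((P.filter (fun f => g f = y)).card : ℝ) ≤ k) (hN : ((P.image g).card : ℝ) ≤ N) :
    (P.card : ℝ) ≤ N * k := by
  rw [Finset.card_eq_sum_card_image g P]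
  push_cast
  refine (Finset.sum_le_sum h).trans ?_
  rw [Finset.sum_const, nsmul_eq_mul]
  gcongr

theorem sum_inv_sqrt (n : ℕ) : ∑ k ∈ Finset.range (n + 1), 1 / Real.sqrt k ≤ 2 * Real.sqrt n := by
  induction n with
  | zero => simp
  | succ n ih =>
    rw [Finset.sum_range_succ]
    have h1 : 1 / Real.sqrt ((n + 1 : ℕ) : ℝ) ≤ 2 * Real.sqrt ((n + 1 : ℕ) : ℝ) - 2 * Real.sqrt n := by
      have hp : 0 < Real.sqrt ((n + 1 : ℕ) : ℝ) := Real.sqrt_pos.2 (by positivity)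
      rw [div_le_iff₀ hp]
      have e1 := Real.sq_sqrt (show (0:ℝ) ≤ ((n + 1 : ℕ) : ℝ) by positivity)
      have e2 := Real.sq_sqrt (show (0:ℝ) ≤ n by positivity)
      push_cast at *
      nlinarith [sq_nonneg (Real.sqrt ((n:ℝ) + 1) - Real.sqrt n)]
    linarith

theorem sum_a_half (Q : Finset ℤ) (N : ℝ) (hN : 0 ≤ N) (hinj : Set.InjOn Int.natAbs Q)
    (hb : ∀ a ∈ Q, |(a:ℝ)| ≤ N) :
    ∑ a ∈ Q, 1 / Real.sqrt |(a:ℝ)| ≤ 2 * Real.sqrt N := by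
  have h1 : ∑ a ∈ Q, 1 / Real.sqrt |(a:ℝ)| = ∑ k ∈ Q.image Int.natAbs, 1 / Real.sqrt (k:ℝ) := by
    rw [Finset.sum_image hinj]
    refine Finset.sum_congr rfl fun a _ => ?_
    rw [Nat.cast_natAbs, Int.cast_abs]
  rw [h1]
  have h2 : Q.image Int.natAbs ⊆ Finset.range (⌊N⌋₊ + 1) := by
    intro k hk
    obtain ⟨a, ha, rfl⟩ := Finset.mem_image.1 hk
    rw [Finset.mem_range, Nat.lt_succ_iff]
    apply Nat.le_floor
    rw [Nat.cast_natAbs, Int.cast_abs]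
    exact hb a ha
  refine (Finset.sum_le_sum_of_subset_of_nonneg h2 fun _ _ _ => by positivity).trans ?_
  refine (sum_inv_sqrt _).trans ?_
  gcongr
  exact Nat.floor_le hN

theorem sum_a (Q : Finset ℤ) (N : ℝ) (hN : 0 ≤ N) (hb : ∀ a ∈ Q, |(a:ℝ)| ≤ N) :
    ∑ a ∈ Q, 1 / Real.sqrt |(a:ℝ)| ≤ 4 * Real.sqrt N := by
  rw [← Finset.sum_filter_add_sum_filter_not Q (fun a => 0 ≤ a)]
  have h1 := sum_a_half (Q.filter (fun a => 0 ≤ a)) N hN (by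
    intro a ha b hb hab
    simp only [Finset.coe_filter, Set.mem_setOf_eq] at ha hb
    omega) (fun a ha => hb a (Finset.mem_filter.1 ha).1)
  have h2 := sum_a_half (Q.filter (fun a => ¬ 0 ≤ a)) N hN (by
    intro a ha b hb hab
    simp only [Finset.coe_filter, Set.mem_setOf_eq] at ha hb
    omega) (fun a ha => hb a (Finset.mem_filter.1 ha).1)
  linarith

theorem adbc_bound {κ σ ε : ℤ} (h : IsTy κ σ ε) (a b0 x s : ℝ) (hx : |x| ≤ 1 / 2) (hs : 1 ≤ s) :
    |a * (ε * s * b0 + κ * x * (ε * s * a) + κ * x ^ 2 * b0 + x ^ 3 * a)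
      - (b0 + σ * x * a) * (ε * s * a + 2 * x * b0 + σ * x ^ 2 * a)| ≤ 3 * (s * a ^ 2 + b0 ^ 2) := by
  have ha2 : a ^ 2 ≤ s * a ^ 2 := le_mul_of_one_le_left (sq_nonneg a) hs
  have hb2 := sq_nonneg b0
  have ha0 := sq_nonneg a
  obtain ⟨hx1, hx2⟩ := abs_le.1 hx
  have hw : 0 ≤ s * a ^ 2 + b0 ^ 2 := by positivity
  have k3 : |2 * x * (s * a ^ 2 + b0 ^ 2)| ≤ s * a ^ 2 + b0 ^ 2 := by
    rw [abs_mul, abs_of_nonneg hw]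
    have : |2 * x| ≤ 1 := by rw [abs_le]; constructor <;> linarith
    exact mul_le_of_le_one_left hw this
  rcases h with ⟨rfl, rfl, rfl⟩ | ⟨rfl, rfl, rfl⟩
  · have : a * (((-1 : ℤ) : ℝ) * s * b0 + ((3 : ℤ) : ℝ) * x * (((-1 : ℤ) : ℝ) * s * a) + ((3 : ℤ) : ℝ) * x ^ 2 * b0 + x ^ 3 * a)
        - (b0 + ((1 : ℤ) : ℝ) * x * a) * (((-1 : ℤ) : ℝ) * s * a + 2 * x * b0 + ((1 : ℤ) : ℝ) * x ^ 2 * a)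
        = -(2 * x * (s * a ^ 2 + b0 ^ 2)) := by push_cast; ring
    rw [this, abs_neg]
    linarith
  · have : a * (((1 : ℤ) : ℝ) * s * b0 + ((1 : ℤ) : ℝ) * x * (((1 : ℤ) : ℝ) * s * a) + ((1 : ℤ) : ℝ) * x ^ 2 * b0 + x ^ 3 * a)
        - (b0 + ((3 : ℤ) : ℝ) * x * a) * (((1 : ℤ) : ℝ) * s * a + 2 * x * b0 + ((3 : ℤ) : ℝ) * x ^ 2 * a)
        = -(2 * x * (s * a ^ 2 + b0 ^ 2)) - (8 * x ^ 2 * (a * b0) + 8 * x ^ 3 * a ^ 2) := by push_cast; ring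
    rw [this]
    have x2 : x ^ 2 ≤ 1 / 4 := by nlinarith
    have k1 : |8 * x ^ 2 * (a * b0)| ≤ a ^ 2 + b0 ^ 2 := by
      have q1 : |8 * x ^ 2| ≤ 2 := by rw [abs_of_nonneg (by positivity)]; linarith
      have q2 : 2 * |a * b0| ≤ a ^ 2 + b0 ^ 2 := by
        rw [abs_mul, ← sq_abs a, ← sq_abs b0]; linarith [sq_nonneg (|a| - |b0|)]
      rw [abs_mul]
      exact (mul_le_mul_of_nonneg_right q1 (abs_nonneg _)).trans q2
    have k2 : |8 * x ^ 3 * a ^ 2| ≤ a ^ 2 := by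
      rw [abs_mul, abs_of_nonneg (sq_nonneg a)]
      have : |8 * x ^ 3| ≤ 1 := by
        rw [show 8 * x ^ 3 = (8 * x ^ 2) * x by ring, abs_mul, abs_of_nonneg (show 0 ≤ 8 * x ^ 2 by positivity)]
        nlinarith [abs_nonneg x]
      exact mul_le_of_le_one_left (by positivity) this
    obtain ⟨q1, q1'⟩ := abs_le.1 k1
    obtain ⟨q2, q2'⟩ := abs_le.1 k2
    obtain ⟨q3, q3'⟩ := abs_le.1 k3
    rw [abs_le]
    constructor <;> linarith

theorem block_bounds {κ σ ε : ℤ} (h : IsTy κ σ ε) (l μ : ℝ) (hl : 0 < l) (hμ : 1 ≤ μ) (f : F4)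
    (hf : f ∈ RZ κ σ ε (Set.Ico (μ ^ 4) (16 * μ ^ 4)) (l ^ 4)) :
    1 ≤ |(f.1:ℝ)| ∧ |(f.1:ℝ)| ≤ l / μ ^ 3 ∧ |(f.2.1 : ℝ)| ≤ 3 * (l / μ) ∧ |(f.2.2.1:ℝ)| ≤ 18 * (l * μ) ∧
      |(f.2.2.2:ℝ)| ≤ 50 * (l * μ ^ 3) ∧ |(f.1:ℝ) * f.2.2.2 - f.2.1 * f.2.2.1| ≤ 3 * (l ^ 2 / μ ^ 2) := by
  obtain ⟨h0, x, s, a, b0, hx, hs, ⟨hs1, hs2⟩, hp, hZ⟩ := hf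
  have hμ0 : 0 < μ := by linarith
  have hμ4 : 1 ≤ μ ^ 4 := one_le_pow₀ hμ
  have hs0 : 1 ≤ s := hμ4.trans hs1
  have hw : s * a ^ 2 + b0 ^ 2 ≤ l ^ 2 / μ ^ 2 := by
    apply le_of_sq_le_sq _ (by positivity)
    rw [div_pow, le_div_iff₀ (by positivity)]
    calc _ = μ ^ 4 * (s * a ^ 2 + b0 ^ 2) ^ 2 := by ring
      _ ≤ s * (s * a ^ 2 + b0 ^ 2) ^ 2 := by gcongr
      _ ≤ l ^ 4 := hZ
      _ = _ := by ring
  have ha : |a| ≤ l / μ ^ 3 := by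
    apply abs_le_of_sq_le_sq _ (by positivity)
    rw [div_pow, le_div_iff₀ (by positivity)]
    rw [le_div_iff₀ (by positivity)] at hw
    calc a ^ 2 * (μ ^ 3) ^ 2 = (μ ^ 4 * a ^ 2) * μ ^ 2 := by ring
      _ ≤ (s * a ^ 2 + b0 ^ 2) * μ ^ 2 := by
        gcongr
        have : μ ^ 4 * a ^ 2 ≤ s * a ^ 2 := by gcongr
        nlinarith [sq_nonneg b0]
      _ ≤ _ := hw
  have hb : |b0| ≤ l / μ := by
    apply abs_le_of_sq_le_sq _ (by positivity)
    rw [div_pow]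
    nlinarith [mul_nonneg (show 0 ≤ s by linarith) (sq_nonneg a)]
  have hpb := par_bounds h a b0 x s _ _ hx (by linarith) ha hb
  obtain ⟨f1, f2, f3, f4⟩ := f
  rw [← hp] at hpb
  simp only [toR] at hpb
  obtain ⟨c1, c2, c3, c4⟩ := hpb
  have r1 : l / μ ^ 3 ≤ l / μ := by
    apply div_le_div_of_nonneg_left hl.le hμ0
    calc μ = μ ^ 1 := (pow_one _).symm
      _ ≤ μ ^ 3 := pow_le_pow_right₀ hμ (by norm_num)
  have r2 : l / μ ≤ l := div_le_self hl.le hμ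
  have r3 : l ≤ l * μ := by nlinarith
  have r4 : l * μ ≤ l * μ ^ 3 := by
    gcongr
    calc μ = μ ^ 1 := (pow_one _).symm
      _ ≤ μ ^ 3 := pow_le_pow_right₀ hμ (by norm_num)
  have r5 : s * (l / μ ^ 3) ≤ 16 * (l * μ) := by
    calc _ ≤ (16 * μ ^ 4) * (l / μ ^ 3) := by gcongr
      _ = _ := by field_simp
  have r6 : s * (l / μ) ≤ 16 * (l * μ ^ 3) := by
    calc _ ≤ (16 * μ ^ 4) * (l / μ) := by gcongr
      _ = _ := by field_simp
  have r0 : 0 ≤ l / μ := by positivity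
  refine ⟨?_, c1, ?_, ?_, ?_, ?_⟩
  · have : 1 ≤ |f1| := Int.one_le_abs h0
    simp only
    exact_mod_cast this
  · simp only; linarith
  · simp only; linarith
  · simp only; linarith
  · simp only [toR, par, Prod.mk.injEq] at hp
    simp only
    obtain ⟨e1, e2, e3, e4⟩ := hp
    rw [e1, e2, e3, e4]
    have := adbc_bound h a b0 x s hx hs0
    linarith

end MW

namespace MW

theorem block {κ σ ε : ℤ} (h : IsTy κ σ ε) (l μ : ℝ) (hl : 0 < l) (hμ : 1 ≤ μ) (P : Finset F4)
    (hP : ∀ f ∈ P, f ∈ RZ κ σ ε (Set.Ico (μ ^ 4) (16 * μ ^ 4)) (l ^ 4)) :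
    (P.card : ℝ) ≤ 100000 * (l ^ 4 / μ) := by
  classical
  have hμ0 : 0 < μ := by linarith
  rcases P.eq_empty_or_nonempty with rfl | ⟨f0, hf0⟩
  · simp only [Finset.card_empty, Nat.cast_zero]; positivity
  have hB := fun f hf => block_bounds h l μ hl hμ f (hP f hf)
  have hN1 : 1 ≤ l / μ ^ 3 := (hB f0 hf0).1.trans (hB f0 hf0).2.1
  have hlμ : μ ^ 3 ≤ l := by rwa [le_div_iff₀ (by positivity), one_mul] at hN1
  have hμ3 : μ ≤ μ ^ 3 := by
    calc μ = μ ^ 1 := (pow_one _).symm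
      _ ≤ μ ^ 3 := pow_le_pow_right₀ hμ (by norm_num)
  have h1b : 1 ≤ l / μ := by rw [le_div_iff₀ hμ0]; linarith
  have h1l : 1 ≤ l := by linarith
  have h1c : 1 ≤ l * μ := by nlinarith
  have h1d : 1 ≤ l * μ ^ 3 := by nlinarith
  obtain ⟨R, hR0, hR⟩ : ∃ R : ℝ, 0 ≤ R ∧ R ^ 2 = l ^ 3 * μ :=
    ⟨Real.sqrt (l ^ 3 * μ), Real.sqrt_nonneg _, Real.sq_sqrt (by positivity)⟩
  have hfa : ∀ a ∈ P.image (fun f : F4 => f.1), ((P.filter (fun f => f.1 = a)).card : ℝ) ≤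
      (3 * (3 * (l / μ))) * ((3 * (18 * (l * μ))) * (37 * R * (1 / Real.sqrt |(a:ℝ)|))) := by
    intro a ha
    obtain ⟨fa, hfa, rfl⟩ := Finset.mem_image.1 ha
    have ha1 := (hB fa hfa).1
    have haN := (hB fa hfa).2.1
    obtain ⟨a, haa⟩ : ∃ a, a = fa.1 := ⟨_, rfl⟩
    simp only [← haa] at ha1 haN ⊢
    have ha0 : 0 < |(a:ℝ)| := by linarith
    have hsa : 0 < Real.sqrt |(a:ℝ)| := Real.sqrt_pos.2 ha0
    apply fib _ (fun f : F4 => f.2.1) _ _ (by positivity)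
    · intro b hb
      apply fib _ (fun f : F4 => f.2.2.1) _ _ (by positivity)
      · intro c hc
        rw [Finset.filter_filter, Finset.filter_filter]
        obtain ⟨P', hP'⟩ : ∃ P', P' = P.filter (fun f : F4 => f.1 = a ∧ f.2.1 = b ∧ f.2.2.1 = c) := ⟨_, rfl⟩
        rw [← hP']
        have hmem : ∀ f ∈ P', f ∈ P ∧ f.1 = a ∧ f.2.1 = b ∧ f.2.2.1 = c := by
          intro f hf
          rw [hP', Finset.mem_filter] at hf
          tauto
        have hcard : P'.card = (P'.image (fun f : F4 => f.2.2.2)).card := by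
          rw [Finset.card_image_of_injOn]
          intro f hf g hg hfg
          obtain ⟨_, f1, f2, f3⟩ := hmem f hf
          obtain ⟨_, g1, g2, g3⟩ := hmem g hg
          exact Prod.ext (f1.trans g1.symm) (Prod.ext (f2.trans g2.symm) (Prod.ext (f3.trans g3.symm) hfg))
        rw [hcard]
        have d1 := int_card (P'.image (fun f : F4 => f.2.2.2)) 0 (50 * (l * μ ^ 3)) (by linarith) (by
          intro d hd
          obtain ⟨f, hf, rfl⟩ := Finset.mem_image.1 hd
          rw [sub_zero]
          exact (hB f (hmem f hf).1).2.2.2.2.1)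
        have hy : 1 ≤ 3 * (l ^ 2 / μ ^ 2) / |(a:ℝ)| := by
          rw [le_div_iff₀ ha0, one_mul]
          refine haN.trans ?_
          have : l / μ ^ 3 ≤ l := div_le_self hl.le (by linarith)
          have : l ^ 2 / μ ^ 2 = (l / μ) ^ 2 := (div_pow _ _ _).symm
          rw [this]
          have : l / μ ^ 3 ≤ l / μ := div_le_div_of_nonneg_left hl.le hμ0 hμ3
          nlinarith
        have d2 := int_card (P'.image (fun f : F4 => f.2.2.2)) ((b:ℝ) * c / a) (3 * (l ^ 2 / μ ^ 2) / |(a:ℝ)|) hy (by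
          intro d hd
          obtain ⟨f, hf, rfl⟩ := Finset.mem_image.1 hd
          obtain ⟨hfP, f1, f2, f3⟩ := hmem f hf
          have := (hB f hfP).2.2.2.2.2
          rw [f1, f2, f3] at this
          have ha00 : (a:ℝ) ≠ 0 := abs_pos.1 ha0
          rw [le_div_iff₀ ha0, ← abs_mul]
          have e : ((f.2.2.2:ℝ) - b * c / a) * a = a * f.2.2.2 - b * c := by field_simp
          rw [e]; exact this)
        obtain ⟨n, hn⟩ : ∃ n : ℝ, n = ((P'.image (fun f : F4 => f.2.2.2)).card : ℝ) := ⟨_, rfl⟩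
        rw [← hn] at d1 d2 ⊢
        have hn0 : 0 ≤ n := by rw [hn]; positivity
        rw [mul_one_div, le_div_iff₀ hsa]
        apply le_of_sq_le_sq _ (by positivity)
        rw [mul_pow, Real.sq_sqrt ha0.le, mul_pow, hR]
        calc n ^ 2 * |(a:ℝ)| = (n * n) * |(a:ℝ)| := by ring
          _ ≤ ((3 * (50 * (l * μ ^ 3))) * (3 * (3 * (l ^ 2 / μ ^ 2) / |(a:ℝ)|))) * |(a:ℝ)| := by gcongr
          _ = 1350 * (l ^ 3 * μ) := by field_simp; ring
          _ ≤ _ := by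
            have : 0 ≤ l ^ 3 * μ := by positivity
            linarith
      · apply int_card _ 0 _ (by linarith)
        intro d hd
        obtain ⟨f, hf, rfl⟩ := Finset.mem_image.1 hd
        rw [sub_zero]
        exact (hB f (Finset.mem_filter.1 (Finset.mem_filter.1 hf).1).1).2.2.2.1
    · apply int_card _ 0 _ (by linarith)
      intro d hd
      obtain ⟨f, hf, rfl⟩ := Finset.mem_image.1 hd
      rw [sub_zero]
      exact (hB f (Finset.mem_filter.1 hf).1).2.2.1
  have hcard : (P.card : ℝ) = ∑ a ∈ P.image (fun f : F4 => f.1), ((P.filter (fun f => f.1 = a)).card : ℝ) := by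
    rw [Finset.card_eq_sum_card_image (fun f : F4 => f.1) P]; push_cast; rfl
  rw [hcard]
  refine (Finset.sum_le_sum hfa).trans ?_
  rw [← Finset.mul_sum, ← Finset.mul_sum, ← Finset.mul_sum]
  have hs := sum_a (P.image (fun f : F4 => f.1)) (l / μ ^ 3) (by positivity) (by
    intro d hd
    obtain ⟨f, hf, rfl⟩ := Finset.mem_image.1 hd
    exact (hB f hf).2.1)
  have hRN : R * Real.sqrt (l / μ ^ 3) = l ^ 2 / μ := by
    rw [← sq_eq_sq₀ (by positivity) (by positivity), mul_pow, hR, Real.sq_sqrt (by positivity)]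
    field_simp
  calc _ ≤ (3 * (3 * (l / μ))) * ((3 * (18 * (l * μ))) * (37 * R * (4 * Real.sqrt (l / μ ^ 3)))) := by gcongr
    _ = (3 * (3 * (l / μ))) * ((3 * (18 * (l * μ))) * (148 * (l ^ 2 / μ))) := by rw [← hRN]; ring
    _ = 71928 * (l ^ 4 / μ) := by field_simp; ring
    _ ≤ _ := by
      have : 0 ≤ l ^ 4 / μ := by positivity
      linarith

theorem geom_tail (J : ℕ) (F : Finset ℕ) (hF : ∀ j ∈ F, J ≤ j) : ∑ j ∈ F, (1 / 2 : ℝ) ^ j ≤ 2 * (1 / 2) ^ J := by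
  have h1 : ∑ j ∈ F, (1 / 2 : ℝ) ^ j = (1 / 2) ^ J * ∑ i ∈ F.image (fun j => j - J), (1 / 2 : ℝ) ^ i := by
    rw [Finset.sum_image, Finset.mul_sum]
    · refine Finset.sum_congr rfl fun j hj => ?_
      rw [← pow_add, Nat.add_sub_cancel' (hF j hj)]
    · intro i hi j hj hij
      have := hF i hi
      have := hF j hj
      simp only at hij
      omega
  rw [h1]
  have := summable_geometric_two.sum_le_tsum (F.image (fun j => j - J)) (fun i _ => by positivity)
  rw [tsum_geometric_two] at this
  nlinarith [show (0:ℝ) < (1 / 2) ^ J by positivity]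

theorem tail {κ σ ε : ℤ} (h : IsTy κ σ ε) (J : ℕ) (Z : ℝ) (hZ : 0 < Z) (P : Finset F4)
    (hP : ∀ f ∈ P, f ∈ RZ κ σ ε (Set.Ici (16 ^ J)) Z) :
    (P.card : ℝ) ≤ 200000 * (1 / 2) ^ J * Z := by
  classical
  obtain ⟨l, hl, hlZ⟩ : ∃ l : ℝ, 0 < l ∧ l ^ 4 = Z := by
    refine ⟨Z ^ (1 / 4 : ℝ), by positivity, ?_⟩
    rw [← Real.rpow_natCast, ← Real.rpow_mul hZ.le]; norm_num
  have hj : ∀ f : F4, ∃ j : ℕ, f ∈ P → J ≤ j ∧ f ∈ RZ κ σ ε (Set.Ico (((2:ℝ) ^ j) ^ 4) (16 * ((2:ℝ) ^ j) ^ 4)) (l ^ 4) := by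
    intro f
    by_cases hf : f ∈ P
    · obtain ⟨h0, x, s, a, b0, hx, hs, hI, hp, hz⟩ := hP f hf
      have h1 : (1:ℝ) ≤ s := le_trans (one_le_pow₀ (by norm_num)) hI
      obtain ⟨j, hj1, hj2⟩ := exists_nat_pow_near h1 (show (1:ℝ) < 16 by norm_num)
      refine ⟨j, fun _ => ⟨?_, h0, x, s, a, b0, hx, hs, ⟨?_, ?_⟩, hp, by rw [hlZ]; exact hz⟩⟩
      · by_contra hc
        push Not at hc
        have : (16:ℝ) ^ (j + 1) ≤ 16 ^ J := pow_le_pow_right₀ (by norm_num) hc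
        have hI' : (16:ℝ) ^ J ≤ s := hI
        linarith
      · rw [← pow_mul, mul_comm, pow_mul]; norm_num; exact hj1
      · rw [← pow_mul, mul_comm j, pow_mul]; norm_num; rw [pow_succ] at hj2; linarith
    · exact ⟨0, fun h => absurd h hf⟩
  choose j hj using hj
  have hcard : (P.card : ℝ) = ∑ i ∈ P.image j, ((P.filter (fun f => j f = i)).card : ℝ) := by
    rw [Finset.card_eq_sum_card_image j P]; push_cast; rfl
  rw [hcard]
  have hle : ∀ i ∈ P.image j, ((P.filter (fun f => j f = i)).card : ℝ) ≤ 100000 * Z * (1 / 2) ^ i := by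
    intro i _
    refine (block h l (2 ^ i) hl (one_le_pow₀ (by norm_num)) _ (fun f hf => ?_)).trans ?_
    · obtain ⟨hf1, hf2⟩ := Finset.mem_filter.1 hf
      rw [← hf2]; exact (hj f hf1).2
    · rw [hlZ, one_div, inv_pow]
      apply le_of_eq; ring
  refine (Finset.sum_le_sum hle).trans ?_
  rw [← Finset.mul_sum]
  have := geom_tail J (P.image j) (by
    intro i hi
    obtain ⟨f, hf, rfl⟩ := Finset.mem_image.1 hi
    exact (hj f hf).1)
  calc _ ≤ 100000 * Z * (2 * (1 / 2) ^ J) := by gcongr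
    _ = _ := by ring

/-- Final geometry-of-numbers bound. -/
theorem full_count {κ σ ε : ℤ} (h : IsTy κ σ ε) (M : ℕ) (hM : 0 < M)
    (S : Finset (ZMod M × ZMod M × ZMod M × ZMod M)) (δ : ℝ) (hδ : 0 < δ) :
    ∀ᶠ Z : ℝ in atTop, ∀ P : Finset F4, (∀ f ∈ P, f ∈ RZ κ σ ε Set.univ Z ∧ rM M f ∈ S) →
      (P.card : ℝ) ≤ (S.card / M ^ 4 * (2 * Real.pi ^ 2 / 3) + δ) * Z := by
  classical
  obtain ⟨J, hJ⟩ : ∃ J : ℕ, (1 / 2 : ℝ) ^ J < δ / 400000 := exists_pow_lt_of_lt_one (by positivity) (by norm_num)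
  filter_upwards [main_count h (16 ^ J) M hM S (δ / 2) (by positivity), eventually_gt_atTop 0] with Z hZ hZ0 P hP
  have h1 := hZ (P.filter (fun f => f ∈ RZ κ σ ε (Set.Iic (16 ^ J)) Z)) (by
    intro f hf
    obtain ⟨hf1, hf2⟩ := Finset.mem_filter.1 hf
    exact ⟨hf2, (hP f hf1).2⟩)
  have h2 := tail h J Z hZ0 (P.filter (fun f => ¬ f ∈ RZ κ σ ε (Set.Iic (16 ^ J)) Z)) (by
    intro f hf
    obtain ⟨hf1, hf2⟩ := Finset.mem_filter.1 hf
    obtain ⟨h0, x, s, a, b0, hx, hs, _, hp, hz⟩ := (hP f hf1).1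
    refine ⟨h0, x, s, a, b0, hx, hs, ?_, hp, hz⟩
    by_contra hc
    have hc' : s ≤ 16 ^ J := (not_le.1 hc).le
    exact hf2 ⟨h0, x, s, a, b0, hx, hs, hc', hp, hz⟩)
  have h3 := Finset.card_filter_add_card_filter_not (s := P) (fun f => f ∈ RZ κ σ ε (Set.Iic (16 ^ J)) Z)
  have h3' := congrArg (Nat.cast : ℕ → ℝ) h3.symm
  rw [Nat.cast_add] at h3'
  rw [h3']
  have : 200000 * (1 / 2) ^ J * Z ≤ δ / 2 * Z := by
    gcongr; linarith
  calc _ ≤ _ + _ := add_le_add h1 (h2.trans this)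
    _ = _ := by ring

end MW

namespace MW

/-- classical discriminant of a binary cubic form -/
def DD {R : Type*} [CommRing R] (f : R × R × R × R) : R :=
  f.2.1 ^ 2 * f.2.2.1 ^ 2 - 4 * f.1 * f.2.2.1 ^ 3 - 4 * f.2.1 ^ 3 * f.2.2.2 - 27 * f.1 ^ 2 * f.2.2.2 ^ 2
    + 18 * f.1 * f.2.1 * f.2.2.1 * f.2.2.2

def tau {R : Type*} [CommRing R] (t : R) (f : R × R × R × R) : R × R × R × R :=
  (f.1, f.2.1 + 3 * f.1 * t, f.2.2.1 + 2 * f.2.1 * t + 3 * f.1 * t ^ 2,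
    f.2.2.2 + f.2.2.1 * t + f.2.1 * t ^ 2 + f.1 * t ^ 3)

def sw {R : Type*} (f : R × R × R × R) : R × R × R × R := (f.2.2.2, f.2.2.1, f.2.1, f.1)

theorem DD_tau {R : Type*} [CommRing R] (t : R) (f : R × R × R × R) : DD (tau t f) = DD f := by
  simp only [DD, tau]; ring

theorem DD_sw {R : Type*} [CommRing R] (f : R × R × R × R) : DD (sw f) = DD f := by
  simp only [DD, sw]; ring

theorem tau_tau {R : Type*} [CommRing R] (t u : R) (f : R × R × R × R) : tau u (tau t f) = tau (t + u) f := by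
  simp only [tau, Prod.mk.injEq]
  refine ⟨trivial, ?_, ?_, ?_⟩ <;> ring

theorem tau_zero {R : Type*} [CommRing R] (f : R × R × R × R) : tau 0 f = f := by
  simp [tau]

def act {R F : Type*} [CommRing R] (s : F → R) (ρ : Option F) (f : R × R × R × R) : R × R × R × R :=
  match ρ with
  | none => sw f
  | some t => tau (s t) f

def iact {R F : Type*} [CommRing R] (s : F → R) (ρ : Option F) (f : R × R × R × R) : R × R × R × R :=
  match ρ with
  | none => sw f
  | some t => tau (-(s t)) f

theorem act_iact {R F : Type*} [CommRing R] (s : F → R) (ρ : Option F) (f : R × R × R × R) :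
    act s ρ (iact s ρ f) = f := by
  cases ρ with
  | none => rfl
  | some t => simp only [act, iact, tau_tau, neg_add_cancel, tau_zero]

theorem iact_act {R F : Type*} [CommRing R] (s : F → R) (ρ : Option F) (f : R × R × R × R) :
    iact s ρ (act s ρ f) = f := by
  cases ρ with
  | none => rfl
  | some t => simp only [act, iact, tau_tau, add_neg_cancel, tau_zero]

theorem DD_act {R F : Type*} [CommRing R] (s : F → R) (ρ : Option F) (f : R × R × R × R) :
    DD (act s ρ f) = DD f := by
  cases ρ with
  | none => exact DD_sw f
  | some t => exact DD_tau _ f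

/-- a cubic form with vanishing discriminant has a rational double root -/
theorem double_root {F : Type*} [Field F] (h2 : (2:F) ≠ 0) (h3 : (3:F) ≠ 0) (f : F × F × F × F) (hf : DD f = 0) :
    ∃ ρ : Option F, (act id ρ f).2.2.1 = 0 ∧ (act id ρ f).2.2.2 = 0 := by
  obtain ⟨a, b, c, d⟩ := f
  simp only [DD] at hf
  by_cases ha : a = 0
  · subst ha
    by_cases hb : b = 0
    · subst hb
      exact ⟨none, rfl, rfl⟩
    · have hc : c ^ 2 = 4 * b * d := by
        have : b ^ 2 * (c ^ 2 - 4 * b * d) = 0 := by linear_combination hf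
        rcases mul_eq_zero.1 this with h | h
        · exact absurd (pow_eq_zero_iff (two_ne_zero) |>.1 h) hb
        · linear_combination h
      refine ⟨some (-c / (2 * b)), ?_, ?_⟩
      · simp only [act, tau, id]; field_simp; ring
      · simp only [act, tau, id]; field_simp; linear_combination (-2 * b ^ 2) * hc
  · by_cases hP : b ^ 2 - 3 * a * c = 0
    · refine ⟨some (-b / (3 * a)), ?_, ?_⟩
      · simp only [act, tau, id]; field_simp; linear_combination -hP
      · have h1 : DD (tau (-b / (3 * a)) (a, b, c, d)) = 0 := by rw [DD_tau]; exact hf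
        have hb' : (tau (-b / (3 * a)) (a, b, c, d)).2.1 = 0 := by
          simp only [tau]; field_simp; ring
        have hc' : (tau (-b / (3 * a)) (a, b, c, d)).2.2.1 = 0 := by
          simp only [tau]; field_simp; linear_combination -hP
        simp only [act, id]
        simp only [DD, hb', hc'] at h1
        have h4 : (3:F) ^ 3 * a ^ 2 * (tau (-b / (3 * a)) (a, b, c, d)).2.2.2 ^ 2 = 0 := by
          have e : (tau (-b / (3 * a)) (a, b, c, d)).1 = a := rfl
          rw [e] at h1
          linear_combination -h1
        have h5 : (3:F) ^ 3 * a ^ 2 ≠ 0 := by positivity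
        exact (pow_eq_zero_iff two_ne_zero).1 ((mul_eq_zero.1 h4).resolve_left h5)
    · obtain ⟨P, hPd⟩ : ∃ P, P = b ^ 2 - 3 * a * c := ⟨_, rfl⟩
      rw [← hPd] at hP
      refine ⟨some (-(b * c - 9 * a * d) / (2 * P)), ?_, ?_⟩
      · simp only [act, tau, id]; field_simp
        rw [hPd]
        linear_combination (-9 * a) * hf
      · simp only [act, tau, id]; field_simp
        rw [hPd]
        linear_combination (3 * a * (b * c - 9 * a * d) - 2 * b * (b ^ 2 - 3 * a * c)) * hf

/-- double roots are unique for nonzero forms -/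
theorem double_root_unique {F : Type*} [Field F] (f : F × F × F × F) (ρ ρ' : Option F) (hne : ρ ≠ ρ')
    (h1 : (act id ρ f).2.2.1 = 0 ∧ (act id ρ f).2.2.2 = 0)
    (h2 : (act id ρ' f).2.2.1 = 0 ∧ (act id ρ' f).2.2.2 = 0) : f = 0 := by
  obtain ⟨a, b, c, d⟩ := f
  have key : ∀ t : F, a = 0 → b = 0 → c + 2 * b * t + 3 * a * t ^ 2 = 0 → d + c * t + b * t ^ 2 + a * t ^ 3 = 0 →
      ((a, b, c, d) : F × F × F × F) = 0 := by
    rintro t rfl rfl hc hd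
    have hc0 : c = 0 := by linear_combination hc
    subst hc0
    have hd0 : d = 0 := by linear_combination hd
    subst hd0
    rfl
  cases ρ with
  | none =>
    cases ρ' with
    | none => exact absurd rfl hne
    | some t => exact key t h1.2 h1.1 h2.1 h2.2
  | some t =>
    cases ρ' with
    | none => exact key t h2.2 h2.1 h1.1 h1.2
    | some u =>
      simp only [act, tau, id] at h1 h2
      obtain ⟨c1, d1⟩ := h1
      obtain ⟨c2, d2⟩ := h2
      have hut : u - t ≠ 0 := fun h => hne (by rw [sub_eq_zero.1 h])
      have e1 : a * (u - t) ^ 3 = 0 := by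
        linear_combination (u - t) * c2 - 2 * d2 + (u - t) * c1 + 2 * d1
      have ha : a = 0 := (mul_eq_zero.1 e1).resolve_right (pow_ne_zero _ hut)
      subst ha
      have e2 : b * (u - t) ^ 2 = 0 := by
        linear_combination d2 - d1 - (u - t) * c1
      have hb : b = 0 := (mul_eq_zero.1 e2).resolve_right (pow_ne_zero _ hut)
      exact key t rfl hb (by linear_combination c1) (by linear_combination d1)

end MW

namespace MW

structure Loc {R F : Type*} [CommRing R] [Field F] (π : R →+* F) (s : F → R) (p : ℕ) : Prop where
  sec : ∀ t, π (s t) = t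
  mul0 : ∀ x y, π x = 0 → π y = 0 → x * y = 0
  unit : ∀ x, π x ≠ 0 → IsUnit x
  two : (2:F) ≠ 0
  three : (3:F) ≠ 0
  cardF : Nat.card F = p
  cardR : Nat.card R = p ^ 2
  cardK : Nat.card {x : R // π x = 0} = p

def mp4 {R F : Type*} [CommRing R] [Field F] (π : R →+* F) (f : R × R × R × R) : F × F × F × F :=
  (π f.1, π f.2.1, π f.2.2.1, π f.2.2.2)

theorem mp4_act {R F : Type*} [CommRing R] [Field F] {π : R →+* F} {s : F → R} {p : ℕ} (h : Loc π s p)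
    (ρ : Option F) (f : R × R × R × R) : mp4 π (act s ρ f) = act id ρ (mp4 π f) := by
  cases ρ with
  | none => rfl
  | some t => simp only [act, tau, mp4, map_add, map_mul, map_pow, map_ofNat, h.sec, id]

theorem mp4_DD {R F : Type*} [CommRing R] [Field F] (π : R →+* F) (f : R × R × R × R) : DD (mp4 π f) = π (DD f) := by
  simp only [DD, mp4, map_add, map_sub, map_mul, map_pow, map_ofNat]

/-- the discriminant when `c`, `d` are in the maximal ideal -/
theorem DD_spec {R F : Type*} [CommRing R] [Field F] {π : R →+* F} {s : F → R} {p : ℕ} (h : Loc π s p)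
    (f : R × R × R × R) (hc : π f.2.2.1 = 0) (hd : π f.2.2.2 = 0) : DD f = -4 * f.2.1 ^ 3 * f.2.2.2 := by
  have h1 := h.mul0 _ _ hc hc
  have h2 := h.mul0 _ _ hc hd
  have h3 := h.mul0 _ _ hd hd
  unfold DD
  linear_combination (f.2.1 ^ 2 - 4 * f.1 * f.2.2.1) * h1 - 27 * f.1 ^ 2 * h3 + 18 * f.1 * f.2.1 * h2

section
variable {R F : Type*} [CommRing R] [Field F] [Fintype R] [Fintype F] [DecidableEq R] [DecidableEq F]

theorem cK {π : R →+* F} {s : F → R} {p : ℕ} (h : Loc π s p) :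
    (Finset.univ.filter (fun x : R => π x = 0)).card = p := by
  rw [← h.cardK, Nat.card_eq_fintype_card, Fintype.card_subtype]

theorem cU {π : R →+* F} {s : F → R} {p : ℕ} (h : Loc π s p) :
    (Finset.univ.filter (fun x : R => ¬ π x = 0)).card = p ^ 2 - p := by
  have h1 := Finset.card_filter_add_card_filter_not (s := (Finset.univ : Finset R)) (fun x : R => π x = 0)
  rw [cK h, Finset.card_univ, ← Nat.card_eq_fintype_card, h.cardR] at h1
  omega

theorem two_unit {π : R →+* F} {s : F → R} {p : ℕ} (h : Loc π s p) : IsUnit (2 : R) := by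
  apply h.unit
  rw [map_ofNat]; exact h.two

theorem local_m {π : R →+* F} {s : F → R} {p : ℕ} (h : Loc π s p) (m : R) (hm : π m = 0) (hm0 : m ≠ 0) :
    (Finset.univ.filter (fun f : R × R × R × R => DD f = m)).card ≤ (p + 1) * (p ^ 2 * ((p ^ 2 - p) * p)) := by
  have hsub : Finset.univ.filter (fun f : R × R × R × R => DD f = m) ⊆
      (Finset.univ : Finset (Option F)).biUnion (fun ρ => Finset.univ.filter (fun f : R × R × R × R =>
        DD f = m ∧ π (act s ρ f).2.2.1 = 0 ∧ π (act s ρ f).2.2.2 = 0)) := by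
    intro f hf
    have hf' := (Finset.mem_filter.1 hf).2
    obtain ⟨ρ, h1, h2⟩ := double_root h.two h.three (mp4 π f) (by rw [mp4_DD, hf', hm])
    rw [← mp4_act h] at h1 h2
    refine Finset.mem_biUnion.2 ⟨ρ, Finset.mem_univ _, Finset.mem_filter.2 ⟨Finset.mem_univ _, hf', h1, h2⟩⟩
  refine (Finset.card_le_card hsub).trans ?_
  refine Finset.card_biUnion_le.trans ?_
  have hone : ∀ ρ ∈ (Finset.univ : Finset (Option F)), (Finset.univ.filter (fun f : R × R × R × R =>
        DD f = m ∧ π (act s ρ f).2.2.1 = 0 ∧ π (act s ρ f).2.2.2 = 0)).card ≤ p ^ 2 * ((p ^ 2 - p) * p) := by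
    intro ρ _
    have hT : ((Finset.univ : Finset R) ×ˢ ((Finset.univ.filter (fun x : R => ¬ π x = 0)) ×ˢ
      (Finset.univ.filter (fun x : R => π x = 0)))).card = p ^ 2 * ((p ^ 2 - p) * p) := by
      rw [Finset.card_product, Finset.card_product, cK h, cU h, Finset.card_univ, ← Nat.card_eq_fintype_card, h.cardR]
    rw [← hT]
    have hprop : ∀ f : R × R × R × R, DD f = m → π (act s ρ f).2.2.1 = 0 → π (act s ρ f).2.2.2 = 0 →
        π (act s ρ f).2.1 ≠ 0 ∧ -4 * (act s ρ f).2.1 ^ 3 * (act s ρ f).2.2.2 = m := by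
      intro f h1 h2 h3
      have h4 := DD_spec h (act s ρ f) h2 h3
      rw [DD_act, h1] at h4
      refine ⟨fun h5 => hm0 ?_, h4.symm⟩
      have h6 := h.mul0 _ _ h5 h3
      rw [h4]
      linear_combination (-4 * (act s ρ f).2.1 ^ 2) * h6
    refine Finset.card_le_card_of_injOn (fun f => ((act s ρ f).1, (act s ρ f).2.1, (act s ρ f).2.2.1)) ?_ ?_
    · intro f hf
      have hf' := (Finset.mem_filter.1 hf).2
      simp only [Finset.coe_product, Set.mem_prod, Finset.mem_coe, Finset.mem_univ, Finset.mem_filter, true_and]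
      exact ⟨(hprop f hf'.1 hf'.2.1 hf'.2.2).1, hf'.2.1⟩
    · intro f hf g hg hfg
      have hf' := (Finset.mem_filter.1 hf).2
      have hg' := (Finset.mem_filter.1 hg).2
      simp only [Prod.mk.injEq] at hfg
      obtain ⟨e1, e2, e3⟩ := hfg
      obtain ⟨u1, v1⟩ := hprop f hf'.1 hf'.2.1 hf'.2.2
      obtain ⟨u2, v2⟩ := hprop g hg'.1 hg'.2.1 hg'.2.2
      rw [← e2] at v2
      have hu : IsUnit (-4 * (act s ρ f).2.1 ^ 3) := by
        have : IsUnit (-4 : R) := by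
          have := ((two_unit h).pow 2).neg
          rwa [show -(2:R) ^ 2 = -4 by norm_num] at this
        exact this.mul ((h.unit _ u1).pow 3)
      have e4 := hu.mul_left_cancel (v1.trans v2.symm)
      have : act s ρ f = act s ρ g := Prod.ext e1 (Prod.ext e2 (Prod.ext e3 e4))
      rw [← iact_act s ρ f, this, iact_act]
  refine (Finset.sum_le_sum hone).trans ?_
  rw [Finset.sum_const, smul_eq_mul, Finset.card_univ, Fintype.card_option, ← Nat.card_eq_fintype_card, h.cardF]

theorem local_0 {π : R →+* F} {s : F → R} {p : ℕ} (h : Loc π s p) :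
    p ^ 4 + (p + 1) * (p ^ 2 * ((p ^ 2 - p) * (p * 1)) + (p ^ 2 - p) * (p * (p * p))) ≤
    (Finset.univ.filter (fun f : R × R × R × R => DD f = 0)).card := by
  obtain ⟨K, hK⟩ : ∃ K, K = Finset.univ.filter (fun x : R => π x = 0) := ⟨_, rfl⟩
  obtain ⟨U, hU⟩ : ∃ U, U = Finset.univ.filter (fun x : R => ¬ π x = 0) := ⟨_, rfl⟩
  have cK' := cK h
  have cU' := cU h
  rw [← hK] at cK'
  rw [← hU] at cU'
  have mK : ∀ x, x ∈ K ↔ π x = 0 := by intro x; rw [hK]; simp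
  have mU : ∀ x, x ∈ U ↔ ¬ π x = 0 := by intro x; rw [hU]; simp
  obtain ⟨B, hB⟩ : ∃ B : Finset (R × R × R × R), B = ((Finset.univ : Finset R) ×ˢ (U ×ˢ (K ×ˢ {0}))) ∪ (U ×ˢ (K ×ˢ (K ×ˢ K))) := ⟨_, rfl⟩
  have hBmem : ∀ f ∈ B, (π f.2.2.1 = 0 ∧ π f.2.2.2 = 0) ∧ DD f = 0 ∧ mp4 π f ≠ 0 := by
    intro f hf
    rw [hB, Finset.mem_union] at hf
    simp only [Finset.mem_product, Finset.mem_univ, mK, mU, Finset.mem_singleton, true_and] at hf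
    rcases hf with ⟨h1, h2, h3⟩ | ⟨h1, h2, h3, h4⟩
    · have hd : π f.2.2.2 = 0 := by rw [h3, map_zero]
      refine ⟨⟨h2, hd⟩, ?_, ?_⟩
      · rw [DD_spec h f h2 hd, h3, mul_zero]
      · intro h0; exact h1 (congrArg (fun g => g.2.1) h0)
    · refine ⟨⟨h3, h4⟩, ?_, ?_⟩
      · rw [DD_spec h f h3 h4]
        linear_combination (-4 * f.2.1 ^ 2) * (h.mul0 _ _ h2 h4)
      · intro h0; exact h1 (congrArg (fun g => g.1) h0)
  have hBcard : B.card = p ^ 2 * ((p ^ 2 - p) * (p * 1)) + (p ^ 2 - p) * (p * (p * p)) := by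
    rw [hB, Finset.card_union_of_disjoint]
    · simp only [Finset.card_product, cK', cU', Finset.card_singleton, Finset.card_univ]
      rw [← Nat.card_eq_fintype_card, h.cardR]
    · rw [Finset.disjoint_left]
      intro f hf hg
      simp only [Finset.mem_product, mK, mU] at hf hg
      exact hf.2.1 hg.2.1
  obtain ⟨Z, hZ⟩ : ∃ Z : Finset (R × R × R × R), Z = K ×ˢ (K ×ˢ (K ×ˢ K)) := ⟨_, rfl⟩
  have hZcard : Z.card = p ^ 4 := by
    rw [hZ]; simp only [Finset.card_product, cK']; ring
  have hZmem : ∀ f ∈ Z, DD f = 0 ∧ mp4 π f = 0 := by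
    intro f hf
    rw [hZ] at hf
    simp only [Finset.mem_product, mK] at hf
    obtain ⟨h1, h2, h3, h4⟩ := hf
    refine ⟨?_, by simp [mp4, h1, h2, h3, h4]⟩
    rw [DD_spec h f h3 h4]
    linear_combination (-4 * f.2.1 ^ 2) * (h.mul0 _ _ h2 h4)
  have hnz : ∀ ρ f, f ∈ B.image (iact s ρ) → mp4 π f ≠ 0 ∧ DD f = 0 ∧
      (act id ρ (mp4 π f)).2.2.1 = 0 ∧ (act id ρ (mp4 π f)).2.2.2 = 0 := by
    intro ρ f hf
    obtain ⟨g, hg, rfl⟩ := Finset.mem_image.1 hf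
    obtain ⟨h1, h2, h3⟩ := hBmem g hg
    rw [← mp4_act h, act_iact]
    refine ⟨?_, ?_, h1⟩
    · intro h0
      have := mp4_act h ρ (iact s ρ g)
      rw [act_iact, h0] at this
      apply h3
      rw [this]
      cases ρ with
      | none => rfl
      | some t => simp [act, tau]
    · rw [← DD_act s ρ, act_iact]; exact h2
  have hdis : ((Finset.univ : Finset (Option F)) : Set (Option F)).PairwiseDisjoint (fun ρ => B.image (iact s ρ)) := by
    intro ρ _ ρ' _ hne
    rw [Function.onFun, Finset.disjoint_left]
    intro f hf hg
    have a1 := hnz ρ f hf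
    have a2 := hnz ρ' f hg
    exact a1.1 (double_root_unique _ ρ ρ' hne a1.2.2 a2.2.2)
  have hsub : Z ∪ (Finset.univ : Finset (Option F)).biUnion (fun ρ => B.image (iact s ρ)) ⊆
      Finset.univ.filter (fun f : R × R × R × R => DD f = 0) := by
    intro f hf
    rw [Finset.mem_filter]
    refine ⟨Finset.mem_univ _, ?_⟩
    rcases Finset.mem_union.1 hf with h1 | h1
    · exact (hZmem f h1).1
    · obtain ⟨ρ, _, h2⟩ := Finset.mem_biUnion.1 h1
      exact (hnz ρ f h2).2.1
  refine le_trans (le_of_eq ?_) (Finset.card_le_card hsub)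
  rw [Finset.card_union_of_disjoint, Finset.card_biUnion hdis, hZcard]
  · congr 1
    have : ∀ ρ ∈ (Finset.univ : Finset (Option F)), (B.image (iact s ρ)).card
        = p ^ 2 * ((p ^ 2 - p) * (p * 1)) + (p ^ 2 - p) * (p * (p * p)) := by
      intro ρ _
      rw [Finset.card_image_of_injective, hBcard]
      intro f g hfg
      rw [← act_iact s ρ f, hfg, act_iact]
    rw [Finset.sum_congr rfl this, Finset.sum_const, smul_eq_mul, Finset.card_univ, Fintype.card_option,
      ← Nat.card_eq_fintype_card, h.cardF]
  · rw [Finset.disjoint_left]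
    intro f hf hg
    obtain ⟨ρ, _, h2⟩ := Finset.mem_biUnion.1 hg
    exact (hnz ρ f h2).1 (hZmem f hf).2

theorem card_R4 {π : R →+* F} {s : F → R} {p : ℕ} (h : Loc π s p) : Fintype.card (R × R × R × R) = p ^ 8 := by
  simp only [Fintype.card_prod]
  rw [← Nat.card_eq_fintype_card, h.cardR]; ring

end

theorem local_m_real {R F : Type*} [CommRing R] [Field F] [Fintype R] [Fintype F] [DecidableEq R] [DecidableEq F]
    {π : R →+* F} {s : F → R} {p : ℕ} (hp : 0 < p) (h : Loc π s p) (m : R) (hm : π m = 0) (hm0 : m ≠ 0) :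
    ((Finset.univ.filter (fun f : R × R × R × R => DD f = m)).card : ℝ) ≤
      (((p:ℝ) ^ 2)⁻¹ * (1 - ((p:ℝ) ^ 2)⁻¹)) * ((p ^ 2 : ℕ) : ℝ) ^ 4 := by
  have h1 := local_m h m hm hm0
  have h2 : p ≤ p ^ 2 := Nat.le_self_pow two_ne_zero p
  have h1' : ((Finset.univ.filter (fun f : R × R × R × R => DD f = m)).card : ℝ) ≤
      (((p + 1) * (p ^ 2 * ((p ^ 2 - p) * p)) : ℕ) : ℝ) := by exact_mod_cast h1
  refine h1'.trans (le_of_eq ?_)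
  have hp' : (p:ℝ) ≠ 0 := by positivity
  push_cast [Nat.cast_sub h2]
  field_simp; ring

theorem local_0_real {R F : Type*} [CommRing R] [Field F] [Fintype R] [Fintype F] [DecidableEq R] [DecidableEq F]
    {π : R →+* F} {s : F → R} {p : ℕ} (hp : 0 < p) (h : Loc π s p) :
    ((Finset.univ.filter (fun f : R × R × R × R => ¬ DD f = 0)).card : ℝ) ≤
      (1 - ((p:ℝ) ^ 2)⁻¹) ^ 2 * ((p ^ 2 : ℕ) : ℝ) ^ 4 := by
  have h1 := local_0 h
  have h2 : p ≤ p ^ 2 := Nat.le_self_pow two_ne_zero p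
  have h3 := Finset.card_filter_add_card_filter_not (s := (Finset.univ : Finset (R × R × R × R))) (fun f => DD f = 0)
  rw [Finset.card_univ, card_R4 h] at h3
  have h1' : ((p ^ 4 + (p + 1) * (p ^ 2 * ((p ^ 2 - p) * (p * 1)) + (p ^ 2 - p) * (p * (p * p))) : ℕ) : ℝ) ≤
    ((Finset.univ.filter (fun f : R × R × R × R => DD f = 0)).card : ℝ) := by exact_mod_cast h1
  have h3' := congrArg (Nat.cast : ℕ → ℝ) h3
  push_cast [Nat.cast_sub h2] at h1' h3'
  have hp' : (p:ℝ) ≠ 0 := by positivity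
  have e : (1 - ((p:ℝ) ^ 2)⁻¹) ^ 2 * ((p ^ 2 : ℕ) : ℝ) ^ 4 = (p:ℝ) ^ 8 - (2 * p ^ 6 - p ^ 4) := by
    push_cast; field_simp; ring
  rw [e]
  nlinarith

end MW

namespace MW

theorem loc_zmod (p : ℕ) [Fact p.Prime] (hp : 5 ≤ p) :
    Loc (ZMod.castHom (dvd_pow_self p two_ne_zero) (ZMod p) : ZMod (p ^ 2) →+* ZMod p)
      (fun t => ((t.val : ℕ) : ZMod (p ^ 2))) p := by
  have hpp : p.Prime := Fact.out
  have : NeZero (p ^ 2) := ⟨by positivity⟩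
  have hz : ∀ n : ℕ, n < p → 0 < n → ((n : ℕ) : ZMod p) ≠ 0 := by
    intro n h1 h2 h3
    rw [ZMod.natCast_eq_zero_iff] at h3
    exact absurd (Nat.le_of_dvd h2 h3) (by omega)
  have hx : ∀ x : ZMod (p ^ 2), ((x.val : ℕ) : ZMod (p ^ 2)) = x := fun x => ZMod.natCast_zmod_val x
  have hdv : ∀ x : ZMod (p ^ 2), (ZMod.castHom (dvd_pow_self p two_ne_zero) (ZMod p)) x = 0 ↔ p ∣ x.val := by
    intro x
    conv_lhs => rw [← hx x]
    rw [map_natCast, ZMod.natCast_eq_zero_iff]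
  refine ⟨?_, ?_, ?_, ?_, ?_, ?_, ?_, ?_⟩
  · intro t
    rw [map_natCast, ZMod.natCast_zmod_val]
  · intro x y h1 h2
    rw [hdv] at h1 h2
    rw [← hx x, ← hx y, ← Nat.cast_mul, ZMod.natCast_eq_zero_iff]
    exact (dvd_of_eq (pow_two p)).trans (mul_dvd_mul h1 h2)
  · intro x h1
    rw [Ne, hdv] at h1
    rw [← hx x, ZMod.isUnit_iff_coprime]
    exact (Nat.Coprime.pow_left 2 ((Nat.Prime.coprime_iff_not_dvd hpp).2 h1)).symm
  · exact_mod_cast hz 2 (by omega) (by omega)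
  · exact_mod_cast hz 3 (by omega) (by omega)
  · rw [Nat.card_zmod]
  · rw [Nat.card_zmod]
  · obtain ⟨π, hπ⟩ : ∃ π : ZMod (p ^ 2) →+ ZMod p, π = (ZMod.castHom (dvd_pow_self p two_ne_zero) (ZMod p)).toAddMonoidHom := ⟨_, rfl⟩
    have h1 := AddSubgroup.card_mul_index π.ker
    rw [AddSubgroup.index_ker, Nat.card_zmod] at h1
    have hs : Function.Surjective π := by
      rw [hπ]; exact ZMod.castHom_surjective (dvd_pow_self p two_ne_zero)
    have h2 : π.range = ⊤ := AddMonoidHom.range_eq_top.2 hs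
    rw [h2, AddSubgroup.card_top, Nat.card_zmod] at h1
    have h3 : Nat.card π.ker = p := Nat.eq_of_mul_eq_mul_right hpp.pos (by rw [h1, pow_two])
    rw [hπ] at h3
    exact h3

noncomputable def wt (A : ℤ) (p : ℕ) : ℝ :=
  if (p : ℤ) ∣ A then ((p:ℝ) ^ 2)⁻¹ * (1 - ((p:ℝ) ^ 2)⁻¹) else (1 - ((p:ℝ) ^ 2)⁻¹) ^ 2

def sc {R : Type*} [CommRing R] (g : R) (f : R × R × R × R) : R × R × R × R := (f.1, g * f.2.1, g * f.2.2.1, f.2.2.2)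

/-- condition at `p` -/
def condp (A : ℤ) (p : ℕ) (n : ℤ) : Prop :=
  if (p : ℤ) ∣ A then (p:ℤ) ^ 2 ∣ n - A else ¬ (p:ℤ) ^ 2 ∣ n

theorem Sp (p : ℕ) (hpp : p.Prime) (hp : 5 ≤ p) (A : ℤ) (hA : Squarefree A) (k g : ℤ)
    (hk : IsCoprime k p) (hg : IsCoprime g p) :
    ∃ S : Finset (ZMod (p ^ 2) × ZMod (p ^ 2) × ZMod (p ^ 2) × ZMod (p ^ 2)),
      (S.card : ℝ) ≤ wt A p * ((p ^ 2 : ℕ) : ℝ) ^ 4 ∧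
      ∀ (f : F4) (n : ℤ), DD (sc g f) = k * n → condp A p n → rM (p ^ 2) f ∈ S := by
  classical
  haveI : Fact p.Prime := ⟨hpp⟩
  haveI : NeZero (p ^ 2) := ⟨by positivity⟩
  have hL := loc_zmod p hp
  have hk2 : IsUnit ((k : ℤ) : ZMod (p ^ 2)) := by
    rw [ZMod.coe_int_isUnit_iff_isCoprime]; push_cast
    exact (IsCoprime.pow_right hk).symm
  have hg2 : IsUnit ((g : ℤ) : ZMod (p ^ 2)) := by
    rw [ZMod.coe_int_isUnit_iff_isCoprime]; push_cast
    exact (IsCoprime.pow_right hg).symm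
  have hinj : Function.Injective (sc ((g : ℤ) : ZMod (p ^ 2))) := by
    rintro ⟨a, b, c, d⟩ ⟨a', b', c', d'⟩ h
    simp only [sc, Prod.mk.injEq] at h
    obtain ⟨h1, h2, h3, h4⟩ := h
    rw [h1, h4, hg2.mul_left_cancel h2, hg2.mul_left_cancel h3]
  have hcast : ∀ f : F4, DD (sc ((g : ℤ) : ZMod (p ^ 2)) (rM (p ^ 2) f)) = ((DD (sc g f) : ℤ) : ZMod (p ^ 2)) := by
    intro f
    simp only [DD, sc, rM]; push_cast; ring
  have hcard : ∀ (Q : ZMod (p ^ 2) → Prop) [DecidablePred Q], ((Finset.univ.filter (fun r : ZMod (p ^ 2) × ZMod (p ^ 2) × ZMod (p ^ 2) × ZMod (p ^ 2) =>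
      Q (DD (sc ((g : ℤ) : ZMod (p ^ 2)) r)))).card : ℝ) ≤
      ((Finset.univ.filter (fun r : ZMod (p ^ 2) × ZMod (p ^ 2) × ZMod (p ^ 2) × ZMod (p ^ 2) => Q (DD r))).card : ℝ) := by
    intro Q _
    have := Finset.card_le_card_of_injOn (s := Finset.univ.filter (fun r : ZMod (p ^ 2) × ZMod (p ^ 2) × ZMod (p ^ 2) × ZMod (p ^ 2) =>
      Q (DD (sc ((g : ℤ) : ZMod (p ^ 2)) r)))) (t := Finset.univ.filter (fun r : ZMod (p ^ 2) × ZMod (p ^ 2) × ZMod (p ^ 2) × ZMod (p ^ 2) => Q (DD r)))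
      (sc ((g : ℤ) : ZMod (p ^ 2))) (by
        intro r hr
        have hr' := (Finset.mem_filter.1 hr).2
        simp only [Finset.coe_filter, Finset.mem_univ, true_and, Set.mem_setOf_eq]
        exact hr') hinj.injOn
    exact_mod_cast this
  by_cases hpA : (p : ℤ) ∣ A
  · refine ⟨Finset.univ.filter (fun r => DD (sc ((g : ℤ) : ZMod (p ^ 2)) r) = ((k * A : ℤ) : ZMod (p ^ 2))), ?_, ?_⟩
    · refine (hcard (fun x => x = ((k * A : ℤ) : ZMod (p ^ 2)))).trans ?_
      rw [wt, if_pos hpA]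
      apply local_m_real hpp.pos hL
      · rw [map_intCast, ZMod.intCast_zmod_eq_zero_iff_dvd]
        exact hpA.mul_left _
      · intro h0
        rw [Int.cast_mul] at h0
        have h1 := hk2.mul_left_cancel (h0.trans (mul_zero _).symm)
        rw [ZMod.intCast_zmod_eq_zero_iff_dvd] at h1
        push_cast at h1
        rw [pow_two] at h1
        have := hA _ h1
        rw [Int.isUnit_iff] at this
        omega
    · intro f n h1 h2
      rw [condp, if_pos hpA] at h2
      rw [Finset.mem_filter]
      refine ⟨Finset.mem_univ _, ?_⟩
      rw [hcast, h1]
      rw [← sub_eq_zero, ← Int.cast_sub, ZMod.intCast_zmod_eq_zero_iff_dvd]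
      push_cast
      exact (h2.mul_left k).trans (dvd_of_eq (by ring))
  · refine ⟨Finset.univ.filter (fun r => ¬ DD (sc ((g : ℤ) : ZMod (p ^ 2)) r) = 0), ?_, ?_⟩
    · refine (hcard (fun x => ¬ x = 0)).trans ?_
      rw [wt, if_neg hpA]
      exact local_0_real hpp.pos hL
    · intro f n h1 h2
      rw [condp, if_neg hpA] at h2
      rw [Finset.mem_filter]
      refine ⟨Finset.mem_univ _, ?_⟩
      rw [hcast, h1]
      intro h0
      rw [Int.cast_mul] at h0
      have h1 := hk2.mul_left_cancel (h0.trans (mul_zero _).symm)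
      rw [ZMod.intCast_zmod_eq_zero_iff_dvd] at h1
      push_cast at h1
      exact h2 h1

/-- conditions at 2 -/
def S4a : Finset (ZMod 4 × ZMod 4 × ZMod 4 × ZMod 4) := Finset.univ.filter (fun r =>
  (r.1 * r.2.2.2 + r.2.1 * r.2.2.1 = 0 ∧ (r.2.1 * r.2.2.1) ^ 2 + r.2.1 ^ 3 * r.2.2.2 + r.1 * r.2.2.1 ^ 3 = 3) ∨
  (r.1 * r.2.2.2 + r.2.1 * r.2.2.1 = 2 ∧ (r.2.1 * r.2.2.1) ^ 2 + r.2.1 ^ 3 * r.2.2.2 + r.1 * r.2.2.1 ^ 3 = 2))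

def S4b : Finset (ZMod 4 × ZMod 4 × ZMod 4 × ZMod 4) := Finset.univ.filter (fun r =>
  (r.1 * r.2.2.2 + r.2.1 * r.2.2.1 = 0 ∧ r.2.1 ^ 3 * r.2.2.2 + r.1 * r.2.2.1 ^ 3 = (r.1 * r.2.2.2) ^ 2 + 1) ∨
  (r.1 * r.2.2.2 + r.2.1 * r.2.2.1 = 2 ∧ r.2.1 ^ 3 * r.2.2.2 + r.1 * r.2.2.1 ^ 3 = (r.1 * r.2.2.2) ^ 2 + 2))

def S3a : Finset (ZMod 3 × ZMod 3 × ZMod 3 × ZMod 3) := Finset.univ.filter (fun r =>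
  r.1 ^ 2 * r.2.2.2 ^ 2 + r.2.1 ^ 3 * r.2.2.2 + r.1 * r.2.2.1 ^ 3 = 2)

def S3b : Finset (ZMod 3 × ZMod 3 × ZMod 3 × ZMod 3) := Finset.univ.filter (fun r =>
  r.2.1 ^ 2 * r.2.2.1 ^ 2 - r.2.1 ^ 3 * r.2.2.2 - r.1 * r.2.2.1 ^ 3 = 2)

set_option maxRecDepth 100000 in
theorem S4a_card : S4a.card = 24 := by decide +kernel
set_option maxRecDepth 100000 in
theorem S4b_card : S4b.card = 24 := by decide +kernel
theorem S3a_card : S3a.card = 24 := by decide +kernel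
theorem S3b_card : S3b.card = 24 := by decide +kernel

theorem k_cases (k w : ℤ) (hw : w = 2 * k) : (((w : ℤ) : ZMod 4) = 0 ∧ ((k : ℤ) : ZMod 4) ^ 2 = 0) ∨
    (((w : ℤ) : ZMod 4) = 2 ∧ ((k : ℤ) : ZMod 4) ^ 2 = 1) := by
  rw [hw]; push_cast
  generalize ((k : ℤ) : ZMod 4) = z
  revert z; decide

theorem even_of_sq (w m : ℤ) (h : w ^ 2 = 4 * m) : ∃ k, w = 2 * k ∧ k ^ 2 = m := by
  have : Even w := by
    rw [← Int.even_pow' (n := 2) two_ne_zero, h]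
    exact ⟨2 * m, by ring⟩
  obtain ⟨k, hk⟩ := this
  refine ⟨k, by linarith, ?_⟩
  rw [hk] at h
  linarith [show (k + k) ^ 2 = 4 * k ^ 2 by ring]

theorem mem_S4a (f : F4) (n : ℤ) (hn : n % 12 = 1) (hf : EF 1 f = -4 * n) : rM 4 f ∈ S4a := by
  obtain ⟨a, b, c, d⟩ := f
  simp only [EF, EE] at hf
  obtain ⟨k, hw, hk⟩ := even_of_sq (a * d - 3 * (b * c)) (3 * (b * c) ^ 2 - (b ^ 3 * d + a * c ^ 3) - n) (by linarith)
  have hk4 := congrArg (Int.cast : ℤ → ZMod 4) hk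
  have hn4 : ((n : ℤ) : ZMod 4) = 1 := by
    have : ((n : ℤ) : ZMod 4) = ((1 : ℤ) : ZMod 4) := by
      rw [ZMod.intCast_eq_intCast_iff]; unfold Int.ModEq; push_cast; omega
    rw [this]; norm_num
  have h4 : (4 : ZMod 4) = 0 := by decide
  push_cast at hk4
  rw [hn4] at hk4
  simp only [S4a, rM, Finset.mem_filter, Finset.mem_univ, true_and]
  rcases k_cases k _ hw with ⟨h1, h2⟩ | ⟨h1, h2⟩
  · left
    push_cast at h1
    rw [h2] at hk4
    constructor
    · linear_combination h1 + (b * c : ZMod 4) * h4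
    · linear_combination hk4 + (((b:ZMod 4) * c) ^ 2 - 1) * h4
  · right
    push_cast at h1
    rw [h2] at hk4
    constructor
    · linear_combination h1 + (b * c : ZMod 4) * h4
    · linear_combination hk4 + (((b:ZMod 4) * c) ^ 2 - 1) * h4

theorem mem_S4b (f : F4) (n : ℤ) (hn : n % 12 = 1) (hf : DD f = -4 * n) : rM 4 f ∈ S4b := by
  obtain ⟨a, b, c, d⟩ := f
  simp only [DD] at hf
  obtain ⟨k, hw, hk⟩ := even_of_sq (b * c + 9 * (a * d)) (27 * (a * d) ^ 2 + (b ^ 3 * d + a * c ^ 3) - n) (by linarith)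
  have hk4 := congrArg (Int.cast : ℤ → ZMod 4) hk
  have hn4 : ((n : ℤ) : ZMod 4) = 1 := by
    have : ((n : ℤ) : ZMod 4) = ((1 : ℤ) : ZMod 4) := by
      rw [ZMod.intCast_eq_intCast_iff]; unfold Int.ModEq; push_cast; omega
    rw [this]; norm_num
  have h4 : (4 : ZMod 4) = 0 := by decide
  push_cast at hk4
  rw [hn4] at hk4
  simp only [S4b, rM, Finset.mem_filter, Finset.mem_univ, true_and]
  rcases k_cases k _ hw with ⟨h1, h2⟩ | ⟨h1, h2⟩
  · left
    push_cast at h1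
    rw [h2] at hk4
    constructor
    · linear_combination h1 - (2 * a * d : ZMod 4) * h4
    · linear_combination -hk4 - (7 * ((a:ZMod 4) * d) ^ 2) * h4
  · right
    push_cast at h1
    rw [h2] at hk4
    constructor
    · linear_combination h1 - (2 * a * d : ZMod 4) * h4
    · linear_combination -hk4 - (7 * ((a:ZMod 4) * d) ^ 2) * h4

theorem mem_S3a (f : F4) (n : ℤ) (hn : n % 12 = 1) (hf : EF 1 f = -4 * n) : rM 3 f ∈ S3a := by
  obtain ⟨a, b, c, d⟩ := f
  simp only [EF, EE] at hf
  have hf3 := congrArg (Int.cast : ℤ → ZMod 3) hf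
  have hn3 : ((n : ℤ) : ZMod 3) = 1 := by
    have : ((n : ℤ) : ZMod 3) = ((1 : ℤ) : ZMod 3) := by
      rw [ZMod.intCast_eq_intCast_iff]; unfold Int.ModEq; push_cast; omega
    rw [this]; norm_num
  have h3 : (3 : ZMod 3) = 0 := by decide
  push_cast at hf3
  rw [hn3] at hf3
  simp only [S3a, rM, Finset.mem_filter, Finset.mem_univ, true_and]
  linear_combination hf3 + (2 * a * b * c * d + b ^ 2 * c ^ 2 - b ^ 3 * d - a * c ^ 3 - 2 : ZMod 3) * h3

theorem mem_S3b (f : F4) (n : ℤ) (hn : n % 12 = 1) (hf : DD f = -4 * n) : rM 3 f ∈ S3b := by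
  obtain ⟨a, b, c, d⟩ := f
  simp only [DD] at hf
  have hf3 := congrArg (Int.cast : ℤ → ZMod 3) hf
  have hn3 : ((n : ℤ) : ZMod 3) = 1 := by
    have : ((n : ℤ) : ZMod 3) = ((1 : ℤ) : ZMod 3) := by
      rw [ZMod.intCast_eq_intCast_iff]; unfold Int.ModEq; push_cast; omega
    rw [this]; norm_num
  have h3 : (3 : ZMod 3) = 0 := by decide
  push_cast at hf3
  rw [hn3] at hf3
  simp only [S3b, rM, Finset.mem_filter, Finset.mem_univ, true_and]
  linear_combination hf3 + (b ^ 3 * d + a * c ^ 3 + 9 * a ^ 2 * d ^ 2 - 6 * a * b * c * d - 2 : ZMod 3) * h3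

end MW

namespace MW

abbrev Z4 (M : ℕ) := ZMod M × ZMod M × ZMod M × ZMod M

theorem comb (m n : ℕ) (h : m.Coprime n) (S : Finset (Z4 m)) (T : Finset (Z4 n)) :
    ∃ U : Finset (Z4 (m * n)), U.card ≤ S.card * T.card ∧
      ∀ f : F4, rM m f ∈ S → rM n f ∈ T → rM (m * n) f ∈ U := by
  classical
  obtain ⟨e, he⟩ : ∃ e : ZMod (m * n) ≃+* ZMod m × ZMod n, e = ZMod.chineseRemainder h := ⟨_, rfl⟩
  refine ⟨(S ×ˢ T).image (fun q => (e.symm (q.1.1, q.2.1), e.symm (q.1.2.1, q.2.2.1),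
    e.symm (q.1.2.2.1, q.2.2.2.1), e.symm (q.1.2.2.2, q.2.2.2.2))), ?_, ?_⟩
  · rw [← Finset.card_product]; exact Finset.card_image_le
  · intro f h1 h2
    rw [Finset.mem_image]
    refine ⟨(rM m f, rM n f), Finset.mem_product.2 ⟨h1, h2⟩, ?_⟩
    have key : ∀ z : ℤ, e.symm ((z : ZMod m), (z : ZMod n)) = (z : ZMod (m * n)) := by
      intro z
      rw [RingEquiv.symm_apply_eq, map_intCast]; rfl
    simp only [rM, key]

theorem combP (C : F4 → Prop) (w : ℕ → ℝ) (hw : ∀ p, 0 ≤ w p) (c : ℝ) (hc : 0 ≤ c) (S4 : Finset (Z4 4)) (S3 : Finset (Z4 3))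
    (h4 : S4.card = 24) (h3 : S3.card = 24) (hC4 : ∀ f, C f → rM 4 f ∈ S4) (hC3 : ∀ f, C f → rM 3 f ∈ S3)
    (P : Finset ℕ) (hP : ∀ p ∈ P, p.Prime ∧ 5 ≤ p)
    (hS : ∀ p ∈ P, ∃ S : Finset (Z4 (p ^ 2)), (S.card : ℝ) ≤ w p * ((p ^ 2 : ℕ) : ℝ) ^ 4 ∧ ∀ f, C f → rM (p ^ 2) f ∈ S) :
    ∃ S : Finset (Z4 (4 * 3 * ∏ p ∈ P, p ^ 2)),
      (S.card : ℝ) ≤ (1 / 36 * ∏ p ∈ P, w p) * ((4 * 3 * ∏ p ∈ P, p ^ 2 : ℕ) : ℝ) ^ 4 ∧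
      ∀ f, C f → rM (4 * 3 * ∏ p ∈ P, p ^ 2) f ∈ S := by
  classical
  induction P using Finset.induction_on with
  | empty =>
    obtain ⟨U, h1, h2⟩ := comb 4 3 (by norm_num) S4 S3
    rw [Finset.prod_empty, Finset.prod_empty]
    refine ⟨U, ?_, fun f hf => h2 f (hC4 f hf) (hC3 f hf)⟩
    rw [h4, h3] at h1
    have : (U.card : ℝ) ≤ ((24 * 24 : ℕ) : ℝ) := by exact_mod_cast h1
    refine this.trans ?_
    norm_num
  | insert p P hp ih =>
    obtain ⟨S, h1, h2⟩ := ih (fun q hq => hP q (Finset.mem_insert_of_mem hq)) (fun q hq => hS q (Finset.mem_insert_of_mem hq))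
    obtain ⟨T, h3, h4⟩ := hS p (Finset.mem_insert_self _ _)
    obtain ⟨hpp, hp5⟩ := hP p (Finset.mem_insert_self _ _)
    have hcop : (4 * 3 * ∏ p ∈ P, p ^ 2).Coprime (p ^ 2) := by
      apply Nat.Coprime.pow_right
      apply Nat.Coprime.mul_left
      · rw [Nat.coprime_comm, Nat.Prime.coprime_iff_not_dvd hpp]
        intro hd
        have hd2 : p ∣ 2 * 2 * 3 := by simpa using hd
        rcases (Nat.Prime.dvd_mul hpp).1 hd2 with h | h
        · rcases (Nat.Prime.dvd_mul hpp).1 h with h | h <;> · have := Nat.le_of_dvd (by norm_num) h; omega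
        · have := Nat.le_of_dvd (by norm_num) h; omega
      · apply Nat.Coprime.prod_left
        intro q hq
        apply Nat.Coprime.pow_left
        rw [Nat.coprime_primes (hP q (Finset.mem_insert_of_mem hq)).1 hpp]
        intro h; rw [h] at hq; exact hp hq
    obtain ⟨U, h5, h6⟩ := comb _ _ hcop S T
    have e1 : 4 * 3 * ∏ p ∈ insert p P, p ^ 2 = (4 * 3 * ∏ p ∈ P, p ^ 2) * p ^ 2 := by
      rw [Finset.prod_insert hp]; ring
    rw [e1, Finset.prod_insert hp]
    refine ⟨U, ?_, fun f hf => h6 f (h2 f hf) (h4 f hf)⟩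
    have h7 : (U.card : ℝ) ≤ S.card * T.card := by exact_mod_cast h5
    have hw' : 0 ≤ ∏ p ∈ P, w p := Finset.prod_nonneg (fun q _ => hw q)
    calc (U.card : ℝ) ≤ S.card * T.card := h7
      _ ≤ ((1 / 36 * ∏ p ∈ P, w p) * ((4 * 3 * ∏ p ∈ P, p ^ 2 : ℕ) : ℝ) ^ 4) * (w p * ((p ^ 2 : ℕ) : ℝ) ^ 4) := by
        gcongr
      _ = _ := by
        rw [Nat.cast_mul (4 * 3 * ∏ p ∈ P, p ^ 2) (p ^ 2)]; ring

theorem wt_nonneg (A : ℤ) (p : ℕ) : 0 ≤ wt A p := by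
  unfold wt
  split_ifs
  · rcases Nat.eq_zero_or_pos p with h | h
    · subst h; simp
    · have : (1:ℝ) ≤ (p:ℝ) ^ 2 := one_le_pow₀ (by exact_mod_cast h)
      have := inv_le_one_of_one_le₀ this
      exact mul_nonneg (by positivity) (by linarith)
  · positivity

theorem icop_of (p : ℕ) (hpp : p.Prime) (hp : 5 ≤ p) (k : ℤ) (l : ℕ) (hk : k ∣ 6 ^ l) : IsCoprime k (p : ℤ) := by
  have h6 : IsCoprime (6:ℤ) (p:ℤ) := by
    have : Nat.Coprime 6 p := by
      rw [Nat.coprime_comm, Nat.Prime.coprime_iff_not_dvd hpp]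
      intro hd
      rcases (Nat.Prime.dvd_mul hpp).1 (show p ∣ 2 * 3 from hd) with h | h <;> · have := Nat.le_of_dvd (by norm_num) h; omega
    exact_mod_cast Nat.isCoprime_iff_coprime.2 this
  exact IsCoprime.of_isCoprime_of_dvd_left (h6.pow_left) hk

def Cnd (A : ℤ) (P : Finset ℕ) (n : ℤ) : Prop := n % 12 = 1 ∧ ∀ p ∈ P, condp A p n

theorem typ1 (A : ℤ) (hA : Squarefree A) (P : Finset ℕ) (hP : ∀ p ∈ P, p.Prime ∧ 5 ≤ p) :
    ∃ M : ℕ, 0 < M ∧ ∃ S : Finset (Z4 M), (S.card : ℝ) / (M:ℝ) ^ 4 ≤ 1 / 36 * ∏ p ∈ P, wt A p ∧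
      ∀ (f : F4) (n : ℤ), Cnd A P n → f ∈ NS 3 1 (-1) n → rM M f ∈ S := by
  obtain ⟨S, h1, h2⟩ := combP (fun f => ∃ n, Cnd A P n ∧ EF 1 f = -4 * n) (wt A) (wt_nonneg A) 1 zero_le_one
    S4a S3a S4a_card S3a_card (fun f ⟨n, hn, hf⟩ => mem_S4a f n hn.1 hf) (fun f ⟨n, hn, hf⟩ => mem_S3a f n hn.1 hf) P hP
    (by
      intro p hp
      obtain ⟨hpp, hp5⟩ := hP p hp
      obtain ⟨S, h1, h2⟩ := Sp p hpp hp5 A hA 108 3 (icop_of p hpp hp5 108 3 (by norm_num)) (icop_of p hpp hp5 3 1 (by norm_num))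
      refine ⟨S, h1, ?_⟩
      rintro f ⟨n, hn, hf⟩
      refine h2 f n ?_ (hn.2 p hp)
      have : DD (sc 3 f) = -27 * EF 1 f := by
        simp only [DD, sc, EF, EE]; ring
      rw [this, hf]; ring)
  have hM : 0 < 4 * 3 * ∏ p ∈ P, p ^ 2 := by
    have : 0 < ∏ p ∈ P, p ^ 2 := Finset.prod_pos (fun p hp => by have := (hP p hp).1.pos; positivity)
    positivity
  refine ⟨_, hM, S, ?_, ?_⟩
  · rw [div_le_iff₀ (by positivity)]; exact h1
  · intro f n hn hf
    refine h2 f ⟨n, hn, ?_⟩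
    have := hf.2.2
    rw [this]; ring

theorem typ2 (A : ℤ) (hA : Squarefree A) (P : Finset ℕ) (hP : ∀ p ∈ P, p.Prime ∧ 5 ≤ p) :
    ∃ M : ℕ, 0 < M ∧ ∃ S : Finset (Z4 M), (S.card : ℝ) / (M:ℝ) ^ 4 ≤ 1 / 36 * ∏ p ∈ P, wt A p ∧
      ∀ (f : F4) (n : ℤ), Cnd A P n → f ∈ NS 1 3 1 n → rM M f ∈ S := by
  obtain ⟨S, h1, h2⟩ := combP (fun f => ∃ n, Cnd A P n ∧ DD f = -4 * n) (wt A) (wt_nonneg A) 1 zero_le_one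
    S4b S3b S4b_card S3b_card (fun f ⟨n, hn, hf⟩ => mem_S4b f n hn.1 hf) (fun f ⟨n, hn, hf⟩ => mem_S3b f n hn.1 hf) P hP
    (by
      intro p hp
      obtain ⟨hpp, hp5⟩ := hP p hp
      obtain ⟨S, h1, h2⟩ := Sp p hpp hp5 A hA (-4) 1 (icop_of p hpp hp5 (-4) 2 (by norm_num)) (icop_of p hpp hp5 1 1 (by norm_num))
      refine ⟨S, h1, ?_⟩
      rintro f ⟨n, hn, hf⟩
      refine h2 f n ?_ (hn.2 p hp)
      have : DD (sc 1 f) = DD f := by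
        simp only [DD, sc]; ring
      rw [this, hf])
  have hM : 0 < 4 * 3 * ∏ p ∈ P, p ^ 2 := by
    have : 0 < ∏ p ∈ P, p ^ 2 := Finset.prod_pos (fun p hp => by have := (hP p hp).1.pos; positivity)
    positivity
  refine ⟨_, hM, S, ?_, ?_⟩
  · rw [div_le_iff₀ (by positivity)]; exact h1
  · intro f n hn hf
    refine h2 f ⟨n, hn, ?_⟩
    have h3 := hf.2.2
    have : EF 3 f = -27 * DD f := by
      simp only [DD, EF, EE]; ring
    rw [this] at h3
    linarith

end MW

namespace MW

theorem D_props (A : ℤ) (hApos : 0 < A) (hAmod : A % 36 = 1 ∨ A % 36 = 25)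
    (P : Finset ℕ) (hP : ∀ p ∈ P, p.Prime ∧ 5 ≤ p) (X : ℝ) (D : ℤ) (hD : D ∈ Nplus X 1 (12 * A)) :
    0 < D ∧ (D:ℝ) < X ∧ Squarefree D ∧ IsCoprime D 3 ∧ ((A * D ^ 3) % 9 = 1 ∨ (A * D ^ 3) % 9 = 7) ∧
      Cnd A P (A * D) := by
  obtain ⟨h0, hX, ⟨hne, hor⟩, hmod⟩ := hD
  obtain ⟨k, hk⟩ := hmod.symm.dvd
  have hk' : D = 1 + 12 * (A * k) := by linarith [hk, mul_assoc 12 A k]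
  have hsq : Squarefree D := by
    rcases hor with h | ⟨m', hm, _⟩
    · exact h.1
    · exfalso; rw [hm] at hk'; omega
  refine ⟨h0, hX, hsq, ?_, ?_, ?_, ?_⟩
  · exact ⟨1, -(4 * (A * k)), by rw [hk']; ring⟩
  · have : A * D ^ 3 = A + 9 * (A * (48 * (A * k) ^ 2 + 192 * (A * k) ^ 3 + 4 * (A * k))) := by
      rw [hk']; ring
    rw [this]; clear this hk hk' hmod hor; generalize A * _ = z; omega
  · have : A * D = A + 12 * (A * (A * k)) := by rw [hk']; ring
    rw [this]; clear this hk hk' hmod hor; generalize A * _ = z; omega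
  · intro p hp
    obtain ⟨hpp, hp5⟩ := hP p hp
    unfold condp
    split_ifs with h
    · obtain ⟨c, hc⟩ := h
      refine ⟨12 * c ^ 2 * k, ?_⟩
      rw [hk', hc]; ring
    · intro h2
      have hpi : Prime (p : ℤ) := Nat.prime_iff_prime_int.1 hpp
      have hc : IsCoprime ((p:ℤ) ^ 2) A := ((Prime.coprime_iff_not_dvd hpi).2 h).pow_left
      have h3 := hc.dvd_of_dvd_mul_left h2
      rw [pow_two] at h3
      exact hpi.not_unit (hsq _ h3)

theorem NS_RZ {κ σ ε : ℤ} (h : IsTy κ σ ε) (n : ℤ) (Z : ℝ) (hn : (n:ℝ) ≤ Z) (f : F4) (hf : f ∈ NS κ σ ε n) :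
    f ∈ RZ κ σ ε Set.univ Z := by
  obtain ⟨⟨x, s, hx, hs, h0, a, b0, hpar⟩, hne, hE⟩ := hf
  refine ⟨hne, x, s, a, b0, hx, hs, Set.mem_univ _, hpar, ?_⟩
  have h1 := Comp_EF h f a b0 x s hpar
  rw [hE] at h1
  push_cast at h1
  have h2 : (4 * (ε:ℝ) * (σ:ℝ) ^ 3) ≠ 0 := by
    rcases h with ⟨_, h1, h2⟩ | ⟨_, h1, h2⟩ <;> · rw [h1, h2]; norm_num
  rw [← mul_left_cancel₀ h2 h1]
  exact hn

theorem NS_disj {κ σ ε : ℤ} (h : IsTy κ σ ε) (n m : ℤ) (f : F4) (hf : f ∈ NS κ σ ε n) (hf' : f ∈ NS κ σ ε m) : n = m := by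
  have h1 := hf.2.2
  rw [hf'.2.2] at h1
  have h2 : (4 * ε * σ ^ 3) ≠ 0 := by
    rcases h with ⟨_, h1, h2⟩ | ⟨_, h1, h2⟩ <;> · rw [h1, h2]; norm_num
  exact (mul_left_cancel₀ h2 h1).symm

theorem sum_NS {κ σ ε : ℤ} (h : IsTy κ σ ε) (A : ℤ) (hA : 0 < A) (C : ℤ → Prop) (M : ℕ) (hM : 0 < M) (S : Finset (Z4 M))
    (hS : ∀ (f : F4) (n : ℤ), C n → f ∈ NS κ σ ε n → rM M f ∈ S) (δ : ℝ) (hδ : 0 < δ) :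
    ∀ᶠ X : ℝ in atTop, ∀ T : Finset ℤ, (∀ D ∈ T, 0 < D ∧ (D:ℝ) < X ∧ C (A * D)) →
      ∑ D ∈ T, ((NS κ σ ε (A * D)).ncard : ℝ) ≤ (S.card / (M:ℝ) ^ 4 * (2 * Real.pi ^ 2 / 3) + δ) * (A * X) := by
  classical
  have hA' : (0:ℝ) < A := by exact_mod_cast hA
  have ht : Tendsto (fun X : ℝ => (A:ℝ) * X) atTop atTop := tendsto_id.const_mul_atTop hA'
  filter_upwards [ht.eventually (full_count h M hM S δ hδ)] with X hX T hT
  have hpos : ∀ D ∈ T, 0 < A * D := fun D hD => mul_pos hA (hT D hD).1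
  have hfin : ∀ D : T, (NS κ σ ε (A * D)).Finite := fun D => NS_finite h _ (hpos D D.2)
  have h1 := hX (T.attach.biUnion (fun D => (hfin D).toFinset)) (by
    intro f hf
    rw [Finset.mem_biUnion] at hf
    obtain ⟨D, _, hD⟩ := hf
    rw [Set.Finite.mem_toFinset] at hD
    refine ⟨NS_RZ h _ _ ?_ f hD, hS f _ (hT D D.2).2.2 hD⟩
    push_cast
    exact mul_le_mul_of_nonneg_left (hT D D.2).2.1.le hA'.le)
  rw [Finset.card_biUnion] at h1
  · refine le_trans (le_of_eq ?_) h1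
    rw [Nat.cast_sum, ← Finset.sum_attach]
    refine Finset.sum_congr rfl (fun D _ => ?_)
    rw [Set.ncard_eq_toFinset_card _ (hfin D)]
  · intro D _ D' _ hne
    simp only [Function.onFun]
    rw [Finset.disjoint_left]
    intro f h2 h3
    rw [Set.Finite.mem_toFinset] at h2 h3
    apply hne
    have := NS_disj h _ _ f h2 h3
    exact Subtype.ext (mul_left_cancel₀ hA.ne' this)

theorem Nplus_finite (X : ℝ) (m N : ℤ) : (Nplus X m N).Finite := by
  refine (Set.finite_Ioo (0:ℤ) ⌈X⌉).subset ?_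
  intro D hD
  exact ⟨hD.1, Int.lt_ceil.2 hD.2.1⟩

theorem rank_sum (A : ℤ) (hApos : 0 < A) (hAsf : Squarefree A) (hAmod : A % 36 = 1 ∨ A % 36 = 25)
    (P : Finset ℕ) (hP : ∀ p ∈ P, p.Prime ∧ 5 ≤ p) (δ : ℝ) (hδ : 0 < δ) :
    ∀ᶠ X : ℝ in atTop, (∑ᶠ D ∈ Nplus X 1 (12 * A), (mordellRank (-(A * D ^ 3)) : ℝ)) ≤
      1 / 2 * ((1 / 36 * ∏ p ∈ P, wt A p) * (2 * Real.pi ^ 2 / 3) + δ) * (A * X) := by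
  obtain ⟨M1, hM1, S1, hc1, hS1⟩ := typ1 A hAsf P hP
  obtain ⟨M2, hM2, S2, hc2, hS2⟩ := typ2 A hAsf P hP
  have hA' : (0:ℝ) < A := by exact_mod_cast hApos
  filter_upwards [sum_NS ty1 A hApos (Cnd A P) M1 hM1 S1 hS1 δ hδ, sum_NS ty2 A hApos (Cnd A P) M2 hM2 S2 hS2 δ hδ,
    eventually_gt_atTop (0:ℝ)] with X h1 h2 hX
  rw [finsum_mem_eq_finite_toFinset_sum _ (Nplus_finite X 1 (12 * A))]
  have hT : ∀ D ∈ (Nplus_finite X 1 (12 * A)).toFinset, D ∈ Nplus X 1 (12 * A) := fun D hD => by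
    rwa [Set.Finite.mem_toFinset] at hD
  have h1' := h1 _ (fun D hD => by
    have := D_props A hApos hAmod P hP X D (hT D hD)
    exact ⟨this.1, this.2.1, this.2.2.2.2.2⟩)
  have h2' := h2 _ (fun D hD => by
    have := D_props A hApos hAmod P hP X D (hT D hD)
    exact ⟨this.1, this.2.1, this.2.2.2.2.2⟩)
  have h3 : ∑ D ∈ (Nplus_finite X 1 (12 * A)).toFinset, (4 * (mordellRank (-(A * D ^ 3)) : ℝ)) ≤
      ∑ D ∈ (Nplus_finite X 1 (12 * A)).toFinset, (((NS 3 1 (-1) (A * D)).ncard : ℝ) + ((NS 1 3 1 (A * D)).ncard : ℝ)) := by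
    refine Finset.sum_le_sum (fun D hD => ?_)
    have h := D_props A hApos hAmod P hP X D (hT D hD)
    exact_mod_cast rank_le A D hApos h.1 h.2.2.1 h.2.2.2.1 h.2.2.2.2.1
  rw [← Finset.mul_sum, Finset.sum_add_distrib] at h3
  have hp := Real.pi_pos
  have e1 : (S1.card / (M1:ℝ) ^ 4 * (2 * Real.pi ^ 2 / 3) + δ) * (A * X) ≤
      ((1 / 36 * ∏ p ∈ P, wt A p) * (2 * Real.pi ^ 2 / 3) + δ) * (A * X) := by gcongr
  have e2 : (S2.card / (M2:ℝ) ^ 4 * (2 * Real.pi ^ 2 / 3) + δ) * (A * X) ≤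
      ((1 / 36 * ∏ p ∈ P, wt A p) * (2 * Real.pi ^ 2 / 3) + δ) * (A * X) := by gcongr
  linarith

end MW

namespace MW

noncomputable def cnt (q r : ℤ) (Q : Finset ℕ) (n : ℤ) : ℕ := by
  classical exact ((Finset.Ioc 0 n).filter (fun D => D ≡ r [ZMOD q] ∧ ∀ p ∈ Q, ¬ (p:ℤ) ^ 2 ∣ D)).card

theorem cnt_base (q r : ℤ) (hq : 0 < q) (n : ℤ) (hn : 0 ≤ n) : |(cnt q r ∅ n : ℝ) - n / q| ≤ 1 := by
  classical
  have h1 : cnt q r ∅ n = ((Finset.Ioc 0 n).filter (fun D => D ≡ r [ZMOD q])).card := by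
    unfold cnt
    congr 1
    ext D; simp
  have h2 := Int.Ioc_filter_modEq_card 0 n hq r
  rw [max_eq_left] at h2
  · have h3 : (cnt q r ∅ n : ℝ) = ((⌊((n - r : ℤ) : ℚ) / q⌋ - ⌊((0 - r : ℤ) : ℚ) / q⌋ : ℤ) : ℝ) := by
      rw [h1]
      have := congrArg (Int.cast : ℤ → ℝ) h2
      push_cast at this ⊢
      exact this
    rw [h3]
    have a1 := Int.floor_le (((n - r : ℤ) : ℚ) / q)
    have a2 := Int.lt_floor_add_one (((n - r : ℤ) : ℚ) / q)
    have a3 := Int.floor_le (((0 - r : ℤ) : ℚ) / q)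
    have a4 := Int.lt_floor_add_one (((0 - r : ℤ) : ℚ) / q)
    generalize ⌊((n - r : ℤ) : ℚ) / q⌋ = u at *
    generalize ⌊((0 - r : ℤ) : ℚ) / q⌋ = v at *
    have key : |(((u - v : ℤ) : ℚ)) - (n:ℚ) / q| ≤ 1 := by
      push_cast at *
      rw [sub_div] at a1 a2 a3 a4
      rw [zero_div] at a3 a4
      rw [abs_le]; constructor <;> linarith
    exact_mod_cast key
  · rw [sub_nonneg]
    apply Int.floor_le_floor
    have : (0:ℚ) < q := by exact_mod_cast hq
    have : (0:ℚ) ≤ n := by exact_mod_cast hn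
    gcongr

theorem crt_mod (q r m : ℤ) (h : IsCoprime q m) : ∃ r', ∀ D : ℤ, (D ≡ r [ZMOD q] ∧ m ∣ D) ↔ D ≡ r' [ZMOD (q * m)] := by
  obtain ⟨a, b, hab⟩ := h
  refine ⟨r * (b * m), fun D => ?_⟩
  rw [Int.modEq_comm, Int.modEq_iff_dvd, Int.modEq_comm, Int.modEq_iff_dvd]
  have hc : IsCoprime q m := ⟨a, b, hab⟩
  constructor
  · rintro ⟨h1, h2⟩
    apply hc.mul_dvd
    · have : D - r * (b * m) = (D - r) + q * (r * a) := by linear_combination (-r) * hab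
      rw [this]; exact dvd_add h1 (dvd_mul_right _ _)
    · exact dvd_sub h2 ⟨r * b, by ring⟩
  · intro h
    constructor
    · have : D - r = (D - r * (b * m)) - q * (r * a) := by linear_combination r * hab
      rw [this]; exact dvd_sub ((dvd_mul_right _ _).trans h) (dvd_mul_right _ _)
    · have : D = (D - r * (b * m)) + m * (r * b) := by ring
      rw [this]; exact dvd_add ((dvd_mul_left _ _).trans h) (dvd_mul_right _ _)

theorem cnt_Q (Q : Finset ℕ) : ∀ (q r : ℤ), 0 < q → (∀ p ∈ Q, p.Prime ∧ ¬ (p:ℤ) ∣ q) →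
    ∃ C : ℝ, ∀ n : ℤ, 0 ≤ n → |(cnt q r Q n : ℝ) - n / q * ∏ p ∈ Q, (1 - ((p:ℝ) ^ 2)⁻¹)| ≤ C := by
  classical
  induction Q using Finset.induction_on with
  | empty =>
    intro q r hq _
    refine ⟨1, fun n hn => ?_⟩
    simpa using cnt_base q r hq n hn
  | insert p Q hp ih =>
    intro q r hq hQ
    obtain ⟨hpp, hpq⟩ := hQ p (Finset.mem_insert_self _ _)
    have hQ' : ∀ p ∈ Q, p.Prime ∧ ¬ (p:ℤ) ∣ q := fun p hp => hQ p (Finset.mem_insert_of_mem hp)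
    have hpi : Prime (p:ℤ) := Nat.prime_iff_prime_int.1 hpp
    have hp0 : (0:ℤ) < p := by exact_mod_cast hpp.pos
    have hcop : IsCoprime q ((p:ℤ) ^ 2) := (((Prime.coprime_iff_not_dvd hpi).2 hpq).pow_left).symm
    obtain ⟨r', hr'⟩ := crt_mod q r _ hcop
    obtain ⟨C1, h1⟩ := ih q r hq hQ'
    obtain ⟨C2, h2⟩ := ih (q * (p:ℤ) ^ 2) r' (by positivity) (by
      intro l hl
      refine ⟨(hQ' l hl).1, ?_⟩
      have hli : Prime (l:ℤ) := Nat.prime_iff_prime_int.1 (hQ' l hl).1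
      intro hd
      rcases hli.dvd_or_dvd hd with h | h
      · exact (hQ' l hl).2 h
      · have h3 := hli.dvd_of_dvd_pow h
        have h4 : l ∣ p := by exact_mod_cast h3
        rw [(Nat.prime_dvd_prime_iff_eq (hQ' l hl).1 hpp).1 h4] at hl
        exact hp hl)
    refine ⟨C1 + C2, fun n hn => ?_⟩
    have hsplit : cnt q r Q n = cnt (q * (p:ℤ) ^ 2) r' Q n + cnt q r (insert p Q) n := by
      unfold cnt
      rw [← Finset.card_filter_add_card_filter_not (fun D : ℤ => (p:ℤ) ^ 2 ∣ D)]
      congr 1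
      · congr 1
        ext D
        simp only [Finset.mem_filter, ← hr']
        tauto
      · congr 1
        ext D
        simp only [Finset.mem_filter, Finset.forall_mem_insert]
        tauto
    have hs : (cnt q r (insert p Q) n : ℝ) = cnt q r Q n - cnt (q * (p:ℤ) ^ 2) r' Q n := by
      rw [hsplit]; push_cast; ring
    rw [Finset.prod_insert hp, hs]
    have e1 := abs_le.1 (h1 n hn)
    have e2 := abs_le.1 (h2 n hn)
    have hqr : (q:ℝ) ≠ 0 := by exact_mod_cast hq.ne'
    have hpr : (p:ℝ) ≠ 0 := by exact_mod_cast hpp.ne_zero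
    have e3 : (n:ℝ) / ((q * (p:ℤ) ^ 2 : ℤ) : ℝ) = n / q * ((p:ℝ) ^ 2)⁻¹ := by
      push_cast; field_simp
    rw [e3] at e2
    rw [abs_le]
    constructor <;> linarith [e1.1, e1.2, e2.1, e2.2]

/-- squarefree count -/
noncomputable def sqf (q : ℤ) (n : ℤ) : ℕ := by
  classical exact ((Finset.Ioc 0 n).filter (fun D => D ≡ 1 [ZMOD q] ∧ Squarefree D)).card

theorem sqf_lower (q : ℤ) (hq : 0 < q) (Y : ℕ) (n : ℕ) :
    (cnt q 1 ((Finset.range (Y + 1)).filter (fun p : ℕ => p.Prime ∧ ¬ (p:ℤ) ∣ q)) n : ℝ) ≤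
      sqf q n + n / q * (2 / (Y + 1)) + Nat.sqrt n := by
  classical
  obtain ⟨Q, hQ⟩ : ∃ Q, Q = (Finset.range (Y + 1)).filter (fun p : ℕ => p.Prime ∧ ¬ (p:ℤ) ∣ q) := ⟨_, rfl⟩
  obtain ⟨I, hI⟩ : ∃ I, I = (Finset.Ioo Y (Nat.sqrt n + 1)).filter (fun p : ℕ => p.Prime ∧ ¬ (p:ℤ) ∣ q) := ⟨_, rfl⟩
  rw [← hQ]
  have hsub : (Finset.Ioc 0 (n:ℤ)).filter (fun D => D ≡ 1 [ZMOD q] ∧ ∀ p ∈ Q, ¬ (p:ℤ) ^ 2 ∣ D) ⊆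
      (Finset.Ioc 0 (n:ℤ)).filter (fun D => D ≡ 1 [ZMOD q] ∧ Squarefree D) ∪
      I.biUnion (fun p => (Finset.Ioc 0 (n:ℤ)).filter (fun D => D ≡ 1 [ZMOD q] ∧ (p:ℤ) ^ 2 ∣ D)) := by
    intro D hD
    rw [Finset.mem_filter] at hD
    obtain ⟨hD1, hD2, hD3⟩ := hD
    rw [Finset.mem_union]
    by_cases hsq : Squarefree D
    · left; rw [Finset.mem_filter]; exact ⟨hD1, hD2, hsq⟩
    · right
      rw [← Int.squarefree_natAbs, Nat.squarefree_iff_prime_squarefree] at hsq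
      push Not at hsq
      obtain ⟨p, hpp, hpd⟩ := hsq
      have hpd' : (p:ℤ) ^ 2 ∣ D := by
        rw [← Int.natCast_dvd_natCast, Int.dvd_natAbs] at hpd
        rw [pow_two]; exact_mod_cast hpd
      have hpq : ¬ (p:ℤ) ∣ q := by
        intro h
        have h1 : (p:ℤ) ∣ D := (dvd_pow_self _ two_ne_zero).trans hpd'
        have h2 : (p:ℤ) ∣ 1 - D := h.trans hD2.dvd
        have h3 : (p:ℤ) ∣ 1 := by
          have := dvd_add h2 h1
          rwa [sub_add_cancel] at this
        have h4 : p ∣ 1 := by exact_mod_cast h3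
        exact hpp.one_lt.ne' (Nat.dvd_one.1 h4)
      have hpY : Y < p := by
        by_contra hle
        exact hD3 p (by rw [hQ, Finset.mem_filter, Finset.mem_range]; exact ⟨by omega, hpp, hpq⟩) hpd'
      rw [Finset.mem_Ioc] at hD1
      have hple : p ≤ Nat.sqrt n := by
        rw [Nat.le_sqrt]
        have := Int.le_of_dvd hD1.1 hpd'
        rw [pow_two] at this
        exact_mod_cast this.trans hD1.2
      rw [Finset.mem_biUnion]
      refine ⟨p, ?_, ?_⟩
      · rw [hI, Finset.mem_filter, Finset.mem_Ioo]; exact ⟨⟨hpY, by omega⟩, hpp, hpq⟩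
      · rw [Finset.mem_filter, Finset.mem_Ioc]; exact ⟨hD1, hD2, hpd'⟩
  have h1 := (Finset.card_le_card hsub).trans ((Finset.card_union_le _ _).trans (Nat.add_le_add_left Finset.card_biUnion_le _))
  have h2 : (cnt q 1 Q n : ℝ) ≤ sqf q n + ∑ p ∈ I, (((Finset.Ioc 0 (n:ℤ)).filter (fun D => D ≡ 1 [ZMOD q] ∧ (p:ℤ) ^ 2 ∣ D)).card : ℝ) := by
    unfold cnt sqf
    exact_mod_cast h1
  have hqr : (0:ℝ) < q := by exact_mod_cast hq
  have h3 : ∀ p ∈ I, (((Finset.Ioc 0 (n:ℤ)).filter (fun D => D ≡ 1 [ZMOD q] ∧ (p:ℤ) ^ 2 ∣ D)).card : ℝ) ≤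
      n / q * ((p:ℝ) ^ 2)⁻¹ + 1 := by
    intro p hp
    rw [hI, Finset.mem_filter] at hp
    have hpi : Prime (p:ℤ) := Nat.prime_iff_prime_int.1 hp.2.1
    have hcop : IsCoprime q ((p:ℤ) ^ 2) := (((Prime.coprime_iff_not_dvd hpi).2 hp.2.2).pow_left).symm
    obtain ⟨r', hr'⟩ := crt_mod q 1 _ hcop
    have hp0 : (0:ℤ) < p := by exact_mod_cast hp.2.1.pos
    have hb := (abs_le.1 (cnt_base (q * (p:ℤ) ^ 2) r' (by positivity) n (by positivity))).2
    have e : cnt (q * (p:ℤ) ^ 2) r' ∅ n = ((Finset.Ioc 0 (n:ℤ)).filter (fun D => D ≡ 1 [ZMOD q] ∧ (p:ℤ) ^ 2 ∣ D)).card := by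
      unfold cnt
      congr 1
      ext D
      simp [hr']
    rw [e] at hb
    have hpr : (p:ℝ) ≠ 0 := by exact_mod_cast hp.2.1.ne_zero
    have e3 : ((n:ℤ):ℝ) / ((q * (p:ℤ) ^ 2 : ℤ) : ℝ) = n / q * ((p:ℝ) ^ 2)⁻¹ := by
      push_cast; field_simp
    rw [e3] at hb
    linarith
  have h4 := Finset.sum_le_sum h3
  rw [Finset.sum_add_distrib, ← Finset.mul_sum] at h4
  have h5 : ∑ p ∈ I, ((p:ℝ) ^ 2)⁻¹ ≤ 2 / (Y + 1) := by
    refine le_trans ?_ (sum_Ioo_inv_sq_le Y (Nat.sqrt n + 1))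
    rw [hI]
    exact Finset.sum_le_sum_of_subset_of_nonneg (Finset.filter_subset _ _) (fun _ _ _ => by positivity)
  have h6 : ∑ p ∈ I, (1:ℝ) ≤ Nat.sqrt n := by
    rw [Finset.sum_const, nsmul_one]
    have : I.card ≤ Nat.sqrt n := by
      rw [hI]
      refine (Finset.card_filter_le _ _).trans ?_
      rw [Nat.card_Ioo]; omega
    exact_mod_cast this
  have h7 : (n:ℝ) / q * ∑ p ∈ I, ((p:ℝ) ^ 2)⁻¹ ≤ n / q * (2 / (Y + 1)) := by gcongr
  linarith

theorem Nplus_lower (q : ℤ) (hq : 0 < q) (hq4 : 4 ∣ q) (Y : ℕ) (η : ℝ) (hη : 0 < η) :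
    ∀ᶠ X : ℝ in atTop, X / q * (∏ p ∈ (Finset.range (Y + 1)).filter (fun p : ℕ => p.Prime ∧ ¬ (p:ℤ) ∣ q), (1 - ((p:ℝ) ^ 2)⁻¹)
        - 2 / (Y + 1) - η) ≤ (Nat.card (Nplus X 1 q) : ℝ) := by
  classical
  obtain ⟨C, hC⟩ := cnt_Q ((Finset.range (Y + 1)).filter (fun p : ℕ => p.Prime ∧ ¬ (p:ℤ) ∣ q)) q 1 hq
    (fun p hp => (Finset.mem_filter.1 hp).2)
  generalize hw : ∏ p ∈ (Finset.range (Y + 1)).filter (fun p : ℕ => p.Prime ∧ ¬ (p:ℤ) ∣ q), (1 - ((p:ℝ) ^ 2)⁻¹) = w at *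
  have hw1 : w ≤ 1 := by
    rw [← hw]
    apply Finset.prod_le_one
    · intro p hp
      have : (1:ℝ) ≤ (p:ℝ) ^ 2 := one_le_pow₀ (by exact_mod_cast (Finset.mem_filter.1 hp).2.1.pos)
      linarith [inv_le_one_of_one_le₀ this]
    · intro p hp
      have : 0 ≤ ((p:ℝ) ^ 2)⁻¹ := by positivity
      linarith
  have hqr : (0:ℝ) < q := by exact_mod_cast hq
  have hw0 : 0 ≤ w := by
    rw [← hw]
    apply Finset.prod_nonneg
    intro p hp
    have : (1:ℝ) ≤ (p:ℝ) ^ 2 := one_le_pow₀ (by exact_mod_cast (Finset.mem_filter.1 hp).2.1.pos)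
    linarith [inv_le_one_of_one_le₀ this]
  have ht : ∀ᶠ X : ℝ in atTop, C + 2 + 2 / q + Real.sqrt X ≤ η / q * X := by
    have h1 : Tendsto (fun X : ℝ => Real.sqrt X) atTop atTop := Real.tendsto_sqrt_atTop
    filter_upwards [h1.eventually_ge_atTop ((|C + 2 + 2 / q| + 1) * (q / η) + 1), eventually_ge_atTop (0:ℝ)] with X hX h0
    have hs := Real.mul_self_sqrt h0
    have hpos : 0 < η / q := by positivity
    have e1 : (|C + 2 + 2 / q| + 1) ≤ η / q * Real.sqrt X := by
      have : (|C + 2 + 2 / q| + 1) = η / q * ((|C + 2 + 2 / q| + 1) * (q / η)) := by field_simp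
      rw [this]
      gcongr
      linarith
    have e2 : 1 ≤ Real.sqrt X := by
      have : 0 ≤ (|C + 2 + 2 / q| + 1) * (q / η) := by positivity
      linarith
    have e3 : η / q * X = (η / q * Real.sqrt X) * Real.sqrt X := by rw [mul_assoc, hs]
    rw [e3]
    have e4 : (|C + 2 + 2 / q| + 1) * Real.sqrt X ≤ (η / q * Real.sqrt X) * Real.sqrt X := by gcongr
    have e5 : |C + 2 + 2 / q| ≤ |C + 2 + 2 / q| * Real.sqrt X := le_mul_of_one_le_right (abs_nonneg _) e2
    linarith [le_abs_self (C + 2 + 2 / q)]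
  filter_upwards [ht, eventually_ge_atTop (1:ℝ)] with X hX h1
  obtain ⟨n, hn⟩ : ∃ n : ℕ, n = ⌈X⌉₊ - 1 := ⟨_, rfl⟩
  have hcpos : 0 < ⌈X⌉₊ := Nat.ceil_pos.2 (by linarith)
  have hnX : (n:ℝ) < X := by
    apply Nat.lt_ceil.1; omega
  have hXn : X ≤ n + 1 := by
    have := Nat.le_ceil X
    have h2 : ⌈X⌉₊ = n + 1 := by omega
    rw [h2] at this; exact_mod_cast this
  have hcard : sqf q n ≤ Nat.card (Nplus X 1 q) + 1 := by
    have hsub : (Finset.Ioc 0 (n:ℤ)).filter (fun D => D ≡ 1 [ZMOD q] ∧ Squarefree D) ⊆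
        insert 1 (Nplus_finite X 1 q).toFinset := by
      intro D hD
      rw [Finset.mem_filter, Finset.mem_Ioc] at hD
      rw [Finset.mem_insert, Set.Finite.mem_toFinset]
      by_cases h : D = 1
      · left; exact h
      · right
        refine ⟨hD.1.1, ?_, ⟨h, Or.inl ⟨hD.2.2, ?_⟩⟩, hD.2.1⟩
        · have : (D:ℝ) ≤ n := by exact_mod_cast hD.1.2
          linarith
        · have := hD.2.1.of_dvd hq4
          exact this
    have := (Finset.card_le_card hsub).trans (Finset.card_insert_le _ _)
    rw [Nat.card_coe_set_eq, Set.ncard_eq_toFinset_card _ (Nplus_finite X 1 q)]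
    unfold sqf
    exact this
  have hcard' : (sqf q n : ℝ) ≤ Nat.card (Nplus X 1 q) + 1 := by exact_mod_cast hcard
  have hl := sqf_lower q hq Y n
  have hc := (abs_le.1 (hC n (by positivity))).1
  have hs : (Nat.sqrt n : ℝ) ≤ Real.sqrt X := by
    apply Real.le_sqrt_of_sq_le
    have : (Nat.sqrt n) ^ 2 ≤ n := Nat.sqrt_le' n
    have : ((Nat.sqrt n : ℝ)) ^ 2 ≤ n := by exact_mod_cast this
    linarith
  have e1 : (n:ℝ) / q * (2 / (Y + 1)) ≤ X / q * (2 / (Y + 1)) := by gcongr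
  have e2 : X / q * w - 1 / q ≤ ((n:ℤ):ℝ) / q * w := by
    have : X / q * w ≤ (n + 1) / q * w := by gcongr
    have h3 : ((n:ℝ) + 1) / q * w = n / q * w + 1 / q * w := by ring
    have h4 : 1 / q * w ≤ 1 / q * 1 := by gcongr
    push_cast
    linarith
  have e3 : X / q * (w - 2 / (Y + 1) - η) = X / q * w - X / q * (2 / (Y + 1)) - η / q * X := by ring
  have e4 : (2:ℝ) / q = 1 / q + 1 / q := by ring
  have e5 : (0:ℝ) < 1 / q := by positivity
  rw [e3]
  linarith

end MW

namespace MW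

def PY (Y : ℕ) : Finset ℕ := (Finset.range (Y + 1)).filter (fun p : ℕ => p.Prime ∧ 5 ≤ p)

theorem PY_mem (Y p : ℕ) (hp : p ∈ PY Y) : p.Prime ∧ 5 ≤ p := (Finset.mem_filter.1 hp).2

theorem primes_split (Y : ℕ) (hY : 3 ≤ Y) (g : ℕ → ℝ) :
    ∏ p ∈ Nat.primesBelow (Y + 1), g p = g 2 * (g 3 * ∏ p ∈ PY Y, g p) := by
  have h : Nat.primesBelow (Y + 1) = insert 2 (insert 3 (PY Y)) := by
    ext p
    simp only [Nat.primesBelow, PY, Finset.mem_filter, Finset.mem_range, Finset.mem_insert]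
    constructor
    · rintro ⟨h1, h2⟩
      have h3 := h2.two_le
      rcases lt_or_ge p 5 with h4 | h4
      · interval_cases p
        · simp
        · simp
        · exact absurd h2 (by norm_num)
      · right; right; exact ⟨h1, h2, h4⟩
    · rintro (h | h | h)
      · subst h; exact ⟨by omega, by norm_num⟩
      · subst h; exact ⟨by omega, by norm_num⟩
      · exact ⟨h.1, h.2.1⟩
  rw [h, Finset.prod_insert, Finset.prod_insert]
  · intro h; have := (PY_mem _ _ h).2; omega
  · rw [Finset.mem_insert]
    rintro (h | h)
    · omega
    · have := (PY_mem _ _ h).2; omega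

noncomputable def invsq : ℕ →*₀ ℝ where
  toFun n := ((n:ℝ) ^ 2)⁻¹
  map_zero' := by simp
  map_one' := by simp
  map_mul' a b := by push_cast; rw [mul_pow, mul_inv]

theorem euler : Tendsto (fun Y : ℕ => ∏ p ∈ PY Y, (1 - ((p:ℝ) ^ 2)⁻¹)) atTop (nhds (9 / Real.pi ^ 2)) := by
  have hs : HasSum (fun n : ℕ => invsq n) (Real.pi ^ 2 / 6) := by
    have := hasSum_zeta_two
    simpa [invsq] using this
  have h1 := EulerProduct.eulerProduct_completely_multiplicative (f := invsq) (by
    have := hs.summable.norm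
    exact this)
  rw [hs.tsum_eq] at h1
  have hp := Real.pi_pos
  have h2 := (h1.inv₀ (by positivity)).comp (tendsto_add_atTop_nat 1)
  have h3 := h2.const_mul (3 / 2)
  have e : (3 / 2 : ℝ) * (Real.pi ^ 2 / 6)⁻¹ = 9 / Real.pi ^ 2 := by field_simp; norm_num
  rw [e] at h3
  refine h3.congr' ?_
  filter_upwards [eventually_ge_atTop 3] with Y hY
  simp only [Function.comp]
  rw [← Finset.prod_inv_distrib]
  simp only [inv_inv]
  rw [primes_split Y hY (fun p => 1 - invsq p)]
  simp only [invsq, MonoidWithZeroHom.coe_mk, ZeroHom.coe_mk]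
  norm_num
  ring

theorem wt_prod (A : ℤ) (hApos : 0 < A) (hAsf : Squarefree A) (hAmod : A % 36 = 1 ∨ A % 36 = 25) (Y : ℕ) (hY : A ≤ Y) :
    (∏ p ∈ PY Y, wt A p) * (A:ℝ) ^ 2 = (∏ p ∈ PY Y, (1 - ((p:ℝ) ^ 2)⁻¹)) *
      ∏ p ∈ (Finset.range (Y + 1)).filter (fun p : ℕ => p.Prime ∧ ¬ (p:ℤ) ∣ 12 * A), (1 - ((p:ℝ) ^ 2)⁻¹) := by
  classical
  have hQ : (Finset.range (Y + 1)).filter (fun p : ℕ => p.Prime ∧ ¬ (p:ℤ) ∣ 12 * A) = (PY Y).filter (fun p : ℕ => ¬ (p:ℤ) ∣ A) := by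
    ext p
    simp only [PY, Finset.mem_filter, Finset.mem_range]
    constructor
    · rintro ⟨h1, h2, h3⟩
      refine ⟨⟨h1, h2, ?_⟩, fun h => h3 (h.mul_left _)⟩
      have h4 := h2.two_le
      by_contra h5
      have h6 : p = 2 ∨ p = 3 ∨ p = 4 := by omega
      rcases h6 with h | h | h
      · subst h; exact h3 (by push_cast; omega)
      · subst h; exact h3 (by push_cast; omega)
      · subst h; exact absurd h2 (by norm_num)
    · rintro ⟨⟨h1, h2, h3⟩, h4⟩
      refine ⟨h1, h2, fun h => ?_⟩
      have hpi : Prime (p:ℤ) := Nat.prime_iff_prime_int.1 h2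
      rcases hpi.dvd_or_dvd h with h5 | h5
      · have h6 : p ∣ 2 * 2 * 3 := by exact_mod_cast h5
        rcases (Nat.Prime.dvd_mul h2).1 h6 with h | h
        · rcases (Nat.Prime.dvd_mul h2).1 h with h | h <;> · have := Nat.le_of_dvd (by norm_num) h; omega
        · have := Nat.le_of_dvd (by norm_num) h; omega
      · exact h4 h5
  have hA : ∏ p ∈ (PY Y).filter (fun p : ℕ => (p:ℤ) ∣ A), p = A.natAbs := by
    rw [← Nat.prod_primeFactors_of_squarefree (Int.squarefree_natAbs.2 hAsf)]
    congr 1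
    ext p
    simp only [PY, Finset.mem_filter, Finset.mem_range, Nat.mem_primeFactors]
    rw [← Int.dvd_natAbs, Int.natCast_dvd_natCast]
    constructor
    · rintro ⟨⟨h1, h2, h3⟩, h4⟩
      exact ⟨h2, h4, by omega⟩
    · rintro ⟨h1, h2, h3⟩
      have h4 := Nat.le_of_dvd (by omega) h2
      refine ⟨⟨by omega, h1, ?_⟩, h2⟩
      have h5 := h1.two_le
      by_contra h6
      have h6 : p = 2 ∨ p = 3 ∨ p = 4 := by omega
      rcases h6 with h | h | h
      · subst h; omega
      · subst h; omega
      · subst h; exact absurd h1 (by norm_num)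
  have hA' : (A:ℝ) = ∏ p ∈ (PY Y).filter (fun p : ℕ => (p:ℤ) ∣ A), (p:ℝ) := by
    have h1 : ((A.natAbs : ℕ) : ℝ) = (A:ℝ) := by
      have : ((A.natAbs : ℕ) : ℤ) = A := by omega
      have h2 := congrArg (Int.cast : ℤ → ℝ) this
      rwa [Int.cast_natCast] at h2
    rw [← h1, ← hA]; push_cast; rfl
  rw [hQ, hA', ← Finset.prod_pow, Finset.prod_filter, Finset.prod_filter, ← Finset.prod_mul_distrib, ← Finset.prod_mul_distrib]
  refine Finset.prod_congr rfl (fun p hp => ?_)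
  have hp0 : (p:ℝ) ≠ 0 := by exact_mod_cast (PY_mem Y p hp).1.ne_zero
  unfold wt
  by_cases h : (p:ℤ) ∣ A
  · simp only [h, if_true, not_true, if_false]
    field_simp
  · simp only [h, if_false, not_false_eq_true, if_true]
    ring

theorem avg_le (A : ℤ) (hApos : 0 < A) (hAsf : Squarefree A) (hAmod : A % 36 = 1 ∨ A % 36 = 25) (ε : ℝ) (hε : 0 < ε)
    (hε1 : ε ≤ 1 / 16) :
    ∀ᶠ X : ℝ in atTop, (∑ᶠ D ∈ Nplus X 1 (12 * A), (mordellRank (-(A * D ^ 3)) : ℝ)) /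
        (Nat.card (Nplus X 1 (12 * A)) : ℝ) ≤ 1 + 10 * ε := by
  have hp := Real.pi_pos
  have hA' : (0:ℝ) < A := by exact_mod_cast hApos
  have hp2 : 0 < 9 / Real.pi ^ 2 := by positivity
  have hpi : (1/2 : ℝ) < 9 / Real.pi ^ 2 := by
    rw [lt_div_iff₀ (by positivity)]
    nlinarith [Real.pi_lt_d2, Real.pi_gt_three]
  have ev1 := euler.eventually_const_lt hpi
  have ev2 : ∀ᶠ Y : ℕ in atTop, ∏ p ∈ PY Y, (1 - ((p:ℝ) ^ 2)⁻¹) < 9 / Real.pi ^ 2 * (1 + ε) :=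
    euler.eventually_lt_const (by nlinarith)
  have ev3 : ∀ᶠ Y : ℕ in atTop, 2 / ε ≤ (Y:ℝ) := tendsto_natCast_atTop_atTop.eventually_ge_atTop _
  have ev4 : ∀ᶠ Y : ℕ in atTop, (A:ℤ) ≤ (Y:ℤ) := tendsto_natCast_atTop_atTop.eventually_ge_atTop _
  obtain ⟨Y, h1, h2, h3, h4⟩ := (ev1.and (ev2.and (ev3.and ev4))).exists
  have hW := wt_prod A hApos hAsf hAmod Y h4
  have hr := rank_sum A hApos hAsf hAmod (PY Y) (PY_mem Y) (ε / (6 * A ^ 2)) (by positivity)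
  have hn := Nplus_lower (12 * A) (by linarith) ⟨3 * A, by ring⟩ Y ε hε
  have hfac : ∀ p : ℕ, p.Prime → 0 < 1 - ((p:ℝ) ^ 2)⁻¹ ∧ 1 - ((p:ℝ) ^ 2)⁻¹ ≤ 1 := by
    intro p hp
    have : (1:ℝ) < (p:ℝ) ^ 2 := one_lt_pow₀ (by exact_mod_cast hp.one_lt) two_ne_zero
    have h2 := inv_lt_one_of_one_lt₀ this
    have h3 : 0 ≤ ((p:ℝ) ^ 2)⁻¹ := by positivity
    constructor <;> linarith
  have hQP : ∏ p ∈ PY Y, (1 - ((p:ℝ) ^ 2)⁻¹) ≤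
      ∏ p ∈ (Finset.range (Y + 1)).filter (fun p : ℕ => p.Prime ∧ ¬ (p:ℤ) ∣ 12 * A), (1 - ((p:ℝ) ^ 2)⁻¹) := by
    apply Finset.prod_le_prod_of_subset_of_le_one
    · intro p hp
      simp only [PY, Finset.mem_filter, Finset.mem_range] at hp ⊢
      refine ⟨hp.1, hp.2.1, ?_⟩
      have h4 := hp.2.1.two_le
      by_contra h5
      have h6 : p = 2 ∨ p = 3 ∨ p = 4 := by omega
      rcases h6 with h | h | h
      · subst h; exact hp.2.2 (by push_cast; omega)
      · subst h; exact hp.2.2 (by push_cast; omega)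
      · subst h; exact absurd hp.2.1 (by norm_num)
    · intro p hp; exact (hfac p (PY_mem Y p hp).1).1.le
    · intro p hp _; exact (hfac p (PY_mem Y p hp).1).2
  generalize ∏ p ∈ PY Y, (1 - ((p:ℝ) ^ 2)⁻¹) = u at *
  generalize ∏ p ∈ (Finset.range (Y + 1)).filter (fun p : ℕ => p.Prime ∧ ¬ (p:ℤ) ∣ 12 * A), (1 - ((p:ℝ) ^ 2)⁻¹) = w at *
  generalize ∏ p ∈ PY Y, wt A p = W at *
  have hY2 : 2 / ((Y:ℝ) + 1) ≤ ε := by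
    rw [div_le_iff₀ hε] at h3
    rw [div_le_iff₀ (by positivity)]
    nlinarith
  have hWe : W = u * w / A ^ 2 := by rw [← hW]; field_simp
  filter_upwards [hr, hn, eventually_gt_atTop (0:ℝ)] with X hX1 hX2 hX0
  have hw : 1 / 2 < w := by linarith
  have hqX : 0 < X / (12 * A) := by positivity
  have e1 : X / (12 * A) * (w - 2 * ε) ≤ (Nat.card (Nplus X 1 (12 * A)) : ℝ) := by
    refine le_trans ?_ hX2
    push_cast
    apply mul_le_mul_of_nonneg_left _ hqX.le
    linarith
  have hpos : 0 < X / (12 * A) * (w - 2 * ε) := mul_pos hqX (by linarith)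
  rw [div_le_iff₀ (by linarith)]
  have e2 : 1 / 2 * ((1 / 36 * W) * (2 * Real.pi ^ 2 / 3) + ε / (6 * A ^ 2)) * (A * X) =
      X / (12 * A) * (Real.pi ^ 2 / 9 * u * w + ε) := by
    rw [hWe]; field_simp; ring
  rw [e2] at hX1
  have e3 : Real.pi ^ 2 / 9 * u ≤ 1 + ε := by
    have : Real.pi ^ 2 / 9 * (9 / Real.pi ^ 2 * (1 + ε)) = 1 + ε := by field_simp
    rw [← this]
    gcongr
  have e4 : Real.pi ^ 2 / 9 * u * w + ε ≤ (1 + 10 * ε) * (w - 2 * ε) := by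
    have : Real.pi ^ 2 / 9 * u * w ≤ (1 + ε) * w := by gcongr
    nlinarith
  calc _ ≤ X / (12 * A) * (Real.pi ^ 2 / 9 * u * w + ε) := hX1
    _ ≤ X / (12 * A) * ((1 + 10 * ε) * (w - 2 * ε)) := by gcongr
    _ = (1 + 10 * ε) * (X / (12 * A) * (w - 2 * ε)) := by ring
    _ ≤ _ := by gcongr

end MW

/-- Theorem 1.2 for `A > 0`: for a positive square-free integer `A ≡ 1` or `25 (mod 36)`,
the average rank of `E_D : y² = x³ - A·D³` over fundamental discriminants
`D ∈ N⁺(X, 1, 12A)` is at most `1` in the limsup as `X → ∞`. -/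
theorem main_theorem_2_positive
    (A : ℤ) (hApos : 0 < A) (hAsf : Squarefree A)
    (hAmod : A % 36 = 1 ∨ A % 36 = 25) :
    limsup (fun X : ℝ =>
      (∑ᶠ D ∈ Nplus X 1 (12 * A), (mordellRank (-(A * D ^ 3)) : ℝ)) /
        (Nat.card (Nplus X 1 (12 * A)) : ℝ)) atTop ≤ 1 := by
  have hcob : IsCoboundedUnder (· ≤ ·) atTop (fun X : ℝ =>
      (∑ᶠ D ∈ Nplus X 1 (12 * A), (mordellRank (-(A * D ^ 3)) : ℝ)) /
        (Nat.card (Nplus X 1 (12 * A)) : ℝ)) := by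
    refine IsBoundedUnder.isCoboundedUnder_le ⟨0, ?_⟩
    rw [eventually_map]
    refine Eventually.of_forall (fun X => ?_)
    exact div_nonneg (finsum_nonneg (fun D => finsum_nonneg (fun _ => Nat.cast_nonneg _))) (Nat.cast_nonneg _)
  apply le_of_forall_pos_le_add
  intro ε hε
  have h := MW.avg_le A hApos hAsf hAmod (min (ε / 10) (1 / 16)) (by positivity) (min_le_right _ _)
  refine limsup_le_of_le hcob ?_
  filter_upwards [h] with X hX
  linarith [min_le_left (ε / 10) (1 / 16 : ℝ)]
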